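/- Let Ω₁ ⊊ Ω₂ be bounded Lipschitz domains in ℝ² having the same number of boundary components, with decompositions ∂Ω_i = ∂_SΩ_i ⊔ ∂_*Ω_i (i = 1,2) satisfying ∂_SΩ₁ = ∂_SΩ₂ (in particular this common set lies in ∂Ω₁ ∩ ∂Ω₂). Then for every k ≥ 1 one has the strict domain-monotonicity inequalities σ_k^D(Ω₁) > σ_k^D(Ω₂) and σ_k^N(Ω₁) < σ_k^N(Ω₂). (Planar case of Lemma 3.3 of the paper.) -/

import Mathlib

open Set MeasureTheory Metric Filter Asymptotics
open scoped ENNReal Topology NNReal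

noncomputable section

abbrev E2 : Type := EuclideanSpace ℝ (Fin 2)

def IsLipschitzDomain (Ω : Set E2) : Prop :=
  IsOpen Ω ∧ IsConnected Ω ∧ Bornology.IsBounded Ω ∧
    ∀ p ∈ frontier Ω, ∃ (e : E2 ≃ₗᵢ[ℝ] E2) (K : ℝ≥0) (φ : ℝ → ℝ) (U : Set E2),
      LipschitzWith K φ ∧ IsOpen U ∧ p ∈ U ∧
      ∀ x ∈ U, (x ∈ Ω ↔ φ (e x 0) < e x 1)

def dirEnergy (Ω : Set E2) (f : E2 → ℝ) : ℝ≥0∞ :=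
  ∫⁻ x in Ω, (‖fderiv ℝ f x‖₊ : ℝ≥0∞) ^ 2

def bdryInt (Γ : Set E2) (ρ f : E2 → ℝ) : ℝ≥0∞ :=
  ∫⁻ x in Γ, ENNReal.ofReal (ρ x * (f x) ^ 2) ∂μH[1]

def rayleigh (Ω Γ : Set E2) (ρ f : E2 → ℝ) : ℝ≥0∞ :=
  dirEnergy Ω f / bdryInt Γ ρ f

def steklovMixed (Ω ΓS ΓD : Set E2) (ρ : E2 → ℝ) (k : ℕ) : ℝ≥0∞ :=
  ⨅ (V : Submodule ℝ (E2 → ℝ))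
    (_ : Module.finrank ℝ V = k + 1)
    (_ : ∀ f ∈ V, ContDiff ℝ (⊤ : ℕ∞) f)
    (_ : ∀ f ∈ V, ∀ᶠ x in nhdsSet ΓD, f x = 0)
    (_ : ∀ f ∈ V, Set.EqOn f 0 (closure Ω) → f = 0),
    ⨆ f ∈ V, ⨆ (_ : ¬ Set.EqOn f 0 (closure Ω)), rayleigh Ω ΓS ρ f

def steklovN (Ω ΓS : Set E2) (k : ℕ) : ℝ≥0∞ :=
  steklovMixed Ω ΓS ∅ (fun _ => 1) k

def steklovD (Ω ΓS ΓD : Set E2) (k : ℕ) : ℝ≥0∞ :=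
  steklovMixed Ω ΓS ΓD (fun _ => 1) k

def steklovW (Ω : Set E2) (ρ : E2 → ℝ) (k : ℕ) : ℝ≥0∞ :=
  steklovMixed Ω (frontier Ω) ∅ ρ k

def steklov (Ω : Set E2) (k : ℕ) : ℝ≥0∞ := steklovW Ω (fun _ => 1) k

def IsArc (A : Set E2) : Prop :=
  ∃ γ : ℝ → E2, ContinuousOn γ (Icc 0 1) ∧ InjOn γ (Icc 0 1) ∧ A = γ '' Icc 0 1

def IsLoop (A : Set E2) : Prop :=
  ∃ γ : ℝ → E2, ContinuousOn γ (Icc 0 1) ∧ InjOn γ (Ico 0 1) ∧ γ 0 = γ 1 ∧ A = γ '' Icc 0 1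

def IsBoundaryPart (Γ : Set E2) : Prop :=
  ∃ F : Finset (Set E2), (∀ A ∈ F, IsArc A ∨ IsLoop A) ∧ Γ = ⋃₀ ↑F

structure SteklovDecomp (Ω ΓS Γstar : Set E2) : Prop where
  partS : IsBoundaryPart ΓS
  partStar : IsBoundaryPart Γstar
  union_eq : ΓS ∪ Γstar = frontier Ω
  inter_finite : (ΓS ∩ Γstar).Finite
  nonemptyS : ΓS.Nonempty

section CompactOperators

open ContinuousLinearMap

variable {H B : Type*} [NormedAddCommGroup H] [InnerProductSpace ℝ H]
  [NormedAddCommGroup B] [InnerProductSpace ℝ B]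

/-- A subspace of dimension larger than `F` contains, after a linear map, a nonzero vector mapped
into the orthogonal complement of `F`. -/
theorem exists_mem_map_orthogonal {H' : Type*} [AddCommGroup H'] [Module ℝ H']
    (S : H' →ₗ[ℝ] H) (F : Submodule ℝ H) [FiniteDimensional ℝ F] (V : Submodule ℝ H')
    (hV : Module.finrank ℝ F < Module.finrank ℝ V) : ∃ x ∈ V, x ≠ 0 ∧ S x ∈ Fᗮ := by
  have : FiniteDimensional ℝ V := Module.finite_of_finrank_pos (by omega)
  let L : V →ₗ[ℝ] F := (F.orthogonalProjectionOnto.toLinearMap.comp S).comp V.subtype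
  have hL : LinearMap.ker L ≠ ⊥ := LinearMap.ker_ne_bot_of_finrank_lt hV
  obtain ⟨x, hx, hx0⟩ := Submodule.exists_mem_ne_zero_of_ne_bot hL
  refine ⟨x, x.2, by simpa using hx0, ?_⟩
  have hx' : F.orthogonalProjectionOnto (S x) = 0 := hx
  rwa [Submodule.orthogonalProjectionOnto_eq_zero_iff] at hx'

/-- A lower bound for `‖T x‖² / ‖x‖²` on a finite-dimensional subspace persists, up to an
arbitrarily small loss, on a nearby subspace spanned by elements of a dense range. -/
theorem exists_approx_subspace (T : H →L[ℝ] B) (hT1 : ∀ x, ‖T x‖ ≤ ‖x‖)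
    {X : Type*} [AddCommGroup X] [Module ℝ X] (J : X →ₗ[ℝ] H) (hJ : DenseRange J)
    {n : ℕ} (V : Submodule ℝ H) [FiniteDimensional ℝ V] (hV : Module.finrank ℝ V = n)
    {l m : ℝ} (hl : ∀ x ∈ V, l * ‖x‖ ^ 2 ≤ ‖T x‖ ^ 2) (hm : 0 ≤ m) (hml : m < l) :
    ∃ x : Fin n → X, LinearIndependent ℝ (fun i => J (x i)) ∧
      ∀ z ∈ Submodule.span ℝ (Set.range x), m * ‖J z‖ ^ 2 ≤ ‖T (J z)‖ ^ 2 := by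
  subst hV
  set n := Module.finrank ℝ V
  let e := stdOrthonormalBasis ℝ V
  have hsq : √m < √l := Real.sqrt_lt_sqrt hm hml
  have hm0 : 0 ≤ √m := Real.sqrt_nonneg m
  set d : ℝ := min (1 / 2) ((√l - √m) / (1 + √m)) with hd
  have hdpos : 0 < d := lt_min (by norm_num) (div_pos (by linarith) (by linarith))
  have hd2 : d ≤ 1 / 2 := min_le_left _ _
  have hd3 : d * (1 + √m) ≤ √l - √m := by
    rw [← le_div_iff₀ (by linarith)]; exact min_le_right _ _
  have hex : ∀ i, ∃ x : X, ‖J x - (e i : H)‖ < d / (n + 1) := by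
    intro i
    obtain ⟨x, hx⟩ := hJ.exists_dist_lt (e i : H) (show 0 < d / ((n : ℝ) + 1) by positivity)
    exact ⟨x, by rwa [dist_comm, dist_eq_norm] at hx⟩
  choose x hx using hex
  have key : ∀ c : Fin n → ℝ, ∃ y : V, ‖(∑ i, c i • J (x i)) - y‖ ≤ d * ‖y‖ ∧
      ∀ i, c i = inner ℝ (e i) y := by
    intro c
    refine ⟨∑ i, c i • e i, ?_, ?_⟩
    · have hc : ∀ i, |c i| ≤ ‖∑ i, c i • e i‖ := by
        intro i
        have h1 : c i = inner ℝ (e i) (∑ i, c i • e i) :=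
          (e.orthonormal.inner_right_fintype c i).symm
        rw [h1]
        refine (abs_real_inner_le_norm _ _).trans ?_
        rw [e.norm_eq_one, one_mul]
      have h2 : (∑ i, c i • J (x i)) - ((∑ i, c i • e i : V) : H)
          = ∑ i, c i • (J (x i) - (e i : H)) := by
        simp [smul_sub, Finset.sum_sub_distrib]
      rw [h2]
      calc ‖∑ i, c i • (J (x i) - (e i : H))‖ ≤ ∑ i, ‖c i • (J (x i) - (e i : H))‖ :=
            norm_sum_le _ _
        _ ≤ ∑ _i : Fin n, ‖∑ i, c i • e i‖ * (d / (n + 1)) := by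
            refine Finset.sum_le_sum fun i _ => ?_
            rw [norm_smul, Real.norm_eq_abs]
            exact mul_le_mul (hc i) (hx i).le (norm_nonneg _) (norm_nonneg _)
        _ = (n / (n + 1)) * (d * ‖∑ i, c i • e i‖) := by
            simp; ring
        _ ≤ 1 * (d * ‖∑ i, c i • e i‖) := by
            refine mul_le_mul_of_nonneg_right ?_ (by positivity)
            rw [div_le_one (by positivity)]
            linarith
        _ = _ := one_mul _
    · intro i
      exact (e.orthonormal.inner_right_fintype c i).symm
  refine ⟨x, ?_, ?_⟩
  · rw [Fintype.linearIndependent_iff]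
    intro c hc i
    obtain ⟨y, hy, hyc⟩ := key c
    rw [hc, zero_sub, norm_neg] at hy
    have : ‖(y : H)‖ = ‖y‖ := rfl
    have h0 : ‖y‖ = 0 := by
      rw [this] at hy
      nlinarith [norm_nonneg y]
    rw [hyc i, norm_eq_zero.1 h0, inner_zero_right]
  · intro z hz
    obtain ⟨c, rfl⟩ := (Submodule.mem_span_range_iff_exists_fun ℝ).1 hz
    obtain ⟨y, hy, -⟩ := key c
    simp only [map_sum, map_smul]
    simp only [← map_smul, ← map_sum] at hy ⊢
    set w := J (∑ i, c i • x i)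
    have hyn : ‖(y : H)‖ = ‖y‖ := rfl
    have h1 : √l * ‖y‖ ≤ ‖T y‖ := by
      rw [← abs_of_nonneg (norm_nonneg (T y)), ← Real.sqrt_sq_eq_abs]
      have := Real.sqrt_le_sqrt (hl y y.2)
      rwa [Real.sqrt_mul (by linarith), Real.sqrt_sq (norm_nonneg _)] at this
    have h2 : ‖T y‖ - d * ‖y‖ ≤ ‖T w‖ := by
      have h3 : ‖T y‖ - ‖T w‖ ≤ ‖T y - T w‖ := norm_sub_norm_le _ _
      have h4 : ‖T y - T w‖ ≤ ‖w - y‖ := by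
        rw [← map_sub, norm_sub_rev w]; exact hT1 _
      linarith
    have h3 : ‖w‖ ≤ (1 + d) * ‖y‖ := by
      have := norm_sub_norm_le w (y : H)
      rw [hyn] at this
      linarith
    have h4 : √m * ‖w‖ ≤ ‖T w‖ := by
      have := mul_le_mul_of_nonneg_left h3 hm0
      nlinarith [mul_le_mul_of_nonneg_right hd3 (norm_nonneg y)]
    have h5 := pow_le_pow_left₀ (by positivity) h4 2
    rwa [mul_pow, Real.sq_sqrt hm] at h5

variable [CompleteSpace H] [CompleteSpace B]

/-- On a closed subspace invariant under `T† T`, the quotient `‖T x‖² / ‖x‖²` of a compact operator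
attains its maximum at an eigenvector. -/
theorem exists_eigenvector_of_compact (T : H →L[ℝ] B) (hT : IsCompactOperator T)
    (M : Submodule ℝ H) (hMc : IsClosed (M : Set H)) (hM : M ≠ ⊥)
    (hinv : ∀ x ∈ M, adjoint T (T x) ∈ M) :
    ∃ e ∈ M, ‖e‖ = 1 ∧ ∃ l : ℝ, 0 ≤ l ∧ adjoint T (T e) = l • e ∧
      ∀ x ∈ M, ‖T x‖ ^ 2 ≤ l * ‖x‖ ^ 2 := by
  set N := ‖T.comp M.subtypeL‖ with hN
  have hbd : ∀ x ∈ M, ‖T x‖ ≤ N * ‖x‖ := fun x hx => (T.comp M.subtypeL).le_opNorm ⟨x, hx⟩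
  have hbd2 : ∀ x ∈ M, ‖T x‖ ^ 2 ≤ N ^ 2 * ‖x‖ ^ 2 := fun x hx => by
    rw [← mul_pow]; exact pow_le_pow_left₀ (norm_nonneg _) (hbd x hx) 2
  have hN0 : 0 ≤ N := norm_nonneg (T.comp M.subtypeL)
  rcases hN0.eq_or_lt with h0 | hpos
  · obtain ⟨x, hx, hx0⟩ := M.exists_mem_ne_zero_of_ne_bot hM
    have hz : T x = 0 := by
      have := hbd x hx
      rw [← h0, zero_mul] at this
      exact norm_le_zero_iff.1 this
    refine ⟨‖x‖⁻¹ • x, M.smul_mem _ hx, ?_, 0, le_rfl, ?_, ?_⟩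
    · rw [norm_smul, norm_inv, norm_norm, inv_mul_cancel₀ (norm_ne_zero_iff.2 hx0)]
    · simp [hz]
    · intro y hy
      have := hbd2 y hy
      rw [← h0] at this
      simpa using this
  · have happ : ∀ n : ℕ, ∃ x ∈ M, ‖x‖ ≤ 1 ∧ N - 1 / (n + 1) < ‖T x‖ := by
      intro n
      have hlt : N - 1 / ((n : ℝ) + 1) < N := by
        have : 0 < 1 / ((n : ℝ) + 1) := by positivity
        linarith
      obtain ⟨x, hx1, hx2⟩ := (T.comp M.subtypeL).exists_lt_apply_of_lt_opNorm hlt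
      exact ⟨x, x.2, hx1.le, hx2⟩
    choose x hxM hx1 hxT using happ
    have hTle : ∀ n, ‖T (x n)‖ ≤ N := fun n =>
      (hbd _ (hxM n)).trans (by nlinarith [hx1 n])
    have hTlim : Tendsto (fun n => ‖T (x n)‖) atTop (𝓝 N) := by
      refine tendsto_of_tendsto_of_tendsto_of_le_of_le (g := fun n : ℕ => N - 1 / ((n : ℝ) + 1))
        (h := fun _ => N) ?_ tendsto_const_nhds (fun n => (hxT n).le) hTle
      simpa using tendsto_const_nhds.sub (tendsto_one_div_add_atTop_nhds_zero_nat (𝕜 := ℝ))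
    have hA : ∀ y ∈ M, ‖adjoint T (T y)‖ ≤ N ^ 2 * ‖y‖ := by
      intro y hy
      by_cases hz : ‖adjoint T (T y)‖ = 0
      · rw [hz]; positivity
      have h1 : ‖adjoint T (T y)‖ ^ 2 ≤ ‖T y‖ * ‖T (adjoint T (T y))‖ := by
        rw [← real_inner_self_eq_norm_sq, adjoint_inner_left]
        exact real_inner_le_norm _ _
      have h2 := hbd _ (hinv y hy)
      have h3 := hbd y hy
      have h4 : ‖adjoint T (T y)‖ ^ 2 ≤ (N * ‖y‖) * (N * ‖adjoint T (T y)‖) :=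
        h1.trans (mul_le_mul h3 h2 (norm_nonneg _) (by positivity))
      have h5 : 0 < ‖adjoint T (T y)‖ := lt_of_le_of_ne (norm_nonneg _) (Ne.symm hz)
      nlinarith
    have hdiff : Tendsto (fun n => adjoint T (T (x n)) - N ^ 2 • x n) atTop (𝓝 0) := by
      rw [tendsto_zero_iff_norm_tendsto_zero]
      have hsq : ∀ n, ‖adjoint T (T (x n)) - N ^ 2 • x n‖ ^ 2
          ≤ 2 * N ^ 4 - 2 * N ^ 2 * ‖T (x n)‖ ^ 2 := by
        intro n
        rw [@norm_sub_sq_real, inner_smul_right, adjoint_inner_left, real_inner_self_eq_norm_sq,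
          norm_smul, Real.norm_of_nonneg (by positivity)]
        have h1 : ‖adjoint T (T (x n))‖ ≤ N ^ 2 :=
          (hA _ (hxM n)).trans (by nlinarith [hx1 n, sq_nonneg N])
        have h2 : ‖adjoint T (T (x n))‖ ^ 2 ≤ (N ^ 2) ^ 2 :=
          pow_le_pow_left₀ (norm_nonneg _) h1 2
        have h3 : (N ^ 2 * ‖x n‖) ^ 2 ≤ (N ^ 2) ^ 2 :=
          pow_le_pow_left₀ (by positivity) (by nlinarith [hx1 n, sq_nonneg N]) 2
        nlinarith
      have hlim : Tendsto (fun n => 2 * N ^ 4 - 2 * N ^ 2 * ‖T (x n)‖ ^ 2) atTop (𝓝 0) := by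
        have := (hTlim.pow 2).const_mul (2 * N ^ 2)
        have h := this.const_sub (2 * N ^ 4)
        convert h using 2
        ring
      have hs := squeeze_zero (fun n => sq_nonneg _) hsq hlim
      have := hs.sqrt
      simpa [Real.sqrt_sq (norm_nonneg _)] using this
    have hAc : IsCompactOperator ((adjoint T).comp T) := hT.clm_comp (adjoint T)
    obtain ⟨y, -, φ, hφ, hy⟩ := (hAc.isCompact_closure_image_closedBall 1).tendsto_subseq
      (x := fun n => ((adjoint T).comp T) (x n))
      (fun n => subset_closure ⟨x n, by simpa using hx1 n, rfl⟩)
    have hxl : Tendsto (fun n => x (φ n)) atTop (𝓝 ((N ^ 2)⁻¹ • y)) := by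
      have h1 := (hy.sub (hdiff.comp hφ.tendsto_atTop)).const_smul (N ^ 2)⁻¹
      simp only [sub_zero] at h1
      refine h1.congr fun n => ?_
      simp [smul_smul, hpos.ne']
    set e := (N ^ 2)⁻¹ • y with he
    have heM : e ∈ M := hMc.mem_of_tendsto hxl (Eventually.of_forall fun n => hxM _)
    have hTe : ‖T e‖ = N := by
      refine tendsto_nhds_unique ((T.continuous.tendsto e).comp hxl).norm
        (hTlim.comp hφ.tendsto_atTop)
    have he1 : ‖e‖ ≤ 1 := le_of_tendsto hxl.norm (Eventually.of_forall fun n => hx1 _)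
    have he2 : ‖e‖ = 1 := by
      have := hbd e heM
      rw [hTe] at this
      nlinarith
    refine ⟨e, heM, he2, N ^ 2, by positivity, ?_, hbd2⟩
    have h1 : Tendsto (fun n => adjoint T (T (x (φ n)))) atTop (𝓝 (adjoint T (T e))) :=
      (((adjoint T).comp T).continuous.tendsto e).comp hxl
    rw [tendsto_nhds_unique h1 hy, he, smul_smul, mul_inv_cancel₀ (by positivity), one_smul]

/-- A maximizer of `‖T x‖² / ‖x‖²` on the orthogonal complement of an invariant subspace satisfies
the weak eigenvalue equation. -/
theorem inner_eq_of_isMax (T : H →L[ℝ] B) (F : Submodule ℝ H) [FiniteDimensional ℝ F]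
    (hinv : ∀ x ∈ F, adjoint T (T x) ∈ F) {l : ℝ}
    (hl : ∀ x ∈ Fᗮ, ‖T x‖ ^ 2 ≤ l * ‖x‖ ^ 2) {x : H} (hx : x ∈ Fᗮ)
    (hmax : l * ‖x‖ ^ 2 ≤ ‖T x‖ ^ 2) (y : H) :
    inner ℝ (T x) (T y) = l * inner ℝ x y := by
  have key : ∀ y ∈ Fᗮ, inner ℝ (T x) (T y) = l * inner ℝ x y := by
    intro y hy
    have h : ∀ t : ℝ, 0 ≤ (l * ‖y‖ ^ 2 - ‖T y‖ ^ 2) * (t * t)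
        + (2 * (l * inner ℝ x y - inner ℝ (T x) (T y))) * t + 0 := by
      intro t
      have h1 := hl (x + t • y) (Fᗮ.add_mem hx (Fᗮ.smul_mem t hy))
      rw [map_add, map_smul, norm_add_sq_real, norm_add_sq_real, inner_smul_right,
        inner_smul_right, norm_smul, norm_smul, mul_pow, mul_pow, Real.norm_eq_abs, sq_abs] at h1
      nlinarith
    have hd := discrim_le_zero h
    rw [discrim] at hd
    nlinarith [sq_nonneg (l * inner ℝ x y - inner ℝ (T x) (T y))]
  obtain ⟨u, hu, v, hv, rfl⟩ := F.exists_add_mem_mem_orthogonal y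
  rw [map_add, inner_add_right, inner_add_right, key v hv]
  have h1 : inner ℝ x u = 0 := Submodule.inner_left_of_mem_orthogonal hu hx
  have h2 : inner ℝ (T x) (T u) = 0 := by
    rw [← adjoint_inner_right]
    exact Submodule.inner_left_of_mem_orthogonal (hinv u hu) hx
  rw [h1, h2]; ring

/-- An invariant subspace on which the quotient is at least `l`, and at most `l` on the complement,
can be enlarged by one dimension. -/
theorem exists_extend_invariant (T : H →L[ℝ] B) (hT : IsCompactOperator T) (F : Submodule ℝ H)
    [FiniteDimensional ℝ F] (hF : F ≠ ⊤) (hinv : ∀ x ∈ F, adjoint T (T x) ∈ F)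
    (hl : ∃ l : ℝ, (∀ x ∈ F, l * ‖x‖ ^ 2 ≤ ‖T x‖ ^ 2) ∧ ∀ x ∈ Fᗮ, ‖T x‖ ^ 2 ≤ l * ‖x‖ ^ 2) :
    ∃ (V : Submodule ℝ H) (l : ℝ), F ≤ V ∧ FiniteDimensional ℝ V ∧
      Module.finrank ℝ V = Module.finrank ℝ F + 1 ∧ (∀ x ∈ V, adjoint T (T x) ∈ V) ∧ 0 ≤ l ∧
      (∀ x ∈ V, l * ‖x‖ ^ 2 ≤ ‖T x‖ ^ 2) ∧ ∀ x ∈ Fᗮ, ‖T x‖ ^ 2 ≤ l * ‖x‖ ^ 2 := by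
  obtain ⟨l₀, hl₀, hl₁⟩ := hl
  have hinv' : ∀ x ∈ Fᗮ, adjoint T (T x) ∈ Fᗮ := by
    intro x hx
    rw [Submodule.mem_orthogonal]
    intro u hu
    rw [adjoint_inner_right, ← adjoint_inner_left]
    exact Submodule.inner_right_of_mem_orthogonal (hinv u hu) hx
  obtain ⟨e, he, he1, l, hl0, hel, hlM⟩ := exists_eigenvector_of_compact T hT Fᗮ
    F.isClosed_orthogonal (by rwa [Ne, Submodule.orthogonal_eq_bot_iff]) hinv'
  have he0 : e ≠ 0 := by
    rintro rfl; simp at he1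
  have hle : l ≤ l₀ := by
    have h := hl₁ e he
    have : ‖T e‖ ^ 2 = l * ‖e‖ ^ 2 := by
      rw [← real_inner_self_eq_norm_sq, ← adjoint_inner_left, hel, inner_smul_left,
        real_inner_self_eq_norm_sq]
      rfl
    rw [this, he1] at h
    linarith
  have hsup : ∀ x ∈ F ⊔ ℝ ∙ e, ∃ u ∈ F, ∃ c : ℝ, x = u + c • e := by
    intro x hx
    obtain ⟨u, hu, v, hv, rfl⟩ := Submodule.mem_sup.1 hx
    obtain ⟨c, rfl⟩ := Submodule.mem_span_singleton.1 hv
    exact ⟨u, hu, c, rfl⟩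
  have hdisj : F ⊓ ℝ ∙ e = ⊥ := by
    rw [Submodule.eq_bot_iff]
    rintro x ⟨hx, hx'⟩
    have : x ∈ Fᗮ := by
      obtain ⟨c, rfl⟩ := Submodule.mem_span_singleton.1 hx'
      exact Fᗮ.smul_mem c he
    exact inner_self_eq_zero.1 (Submodule.inner_right_of_mem_orthogonal hx this)
  refine ⟨F ⊔ ℝ ∙ e, l, le_sup_left, inferInstance, ?_, ?_, hl0, ?_, hlM⟩
  · have := Submodule.finrank_sup_add_finrank_inf_eq F (ℝ ∙ e)
    rw [hdisj, finrank_bot, finrank_span_singleton he0] at this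
    omega
  · intro x hx
    obtain ⟨u, hu, c, rfl⟩ := hsup x hx
    rw [map_add, map_add, map_smul, map_smul, hel]
    exact Submodule.add_mem_sup (hinv u hu)
      (Submodule.smul_mem _ _ (Submodule.smul_mem _ _ (Submodule.mem_span_singleton_self e)))
  · intro x hx
    obtain ⟨u, hu, c, rfl⟩ := hsup x hx
    have h1 : inner ℝ u e = 0 := Submodule.inner_right_of_mem_orthogonal hu he
    have h2 : inner ℝ (T u) (T e) = 0 := by
      rw [← adjoint_inner_right, hel, inner_smul_right, h1, mul_zero]
    have h3 : ‖T e‖ ^ 2 = l := by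
      rw [← real_inner_self_eq_norm_sq, ← adjoint_inner_left, hel, inner_smul_left,
        real_inner_self_eq_norm_sq, he1]
      simp
    rw [map_add, map_smul, norm_add_sq_real, norm_add_sq_real, inner_smul_right,
        inner_smul_right, norm_smul, norm_smul, mul_pow, mul_pow, Real.norm_eq_abs, sq_abs,
        h1, h2, h3, he1]
    have h4 := hl₀ u hu
    nlinarith [sq_nonneg ‖u‖, mul_le_mul_of_nonneg_right hle (sq_nonneg ‖u‖)]

/-- Min-max data for a compact operator. -/
theorem exists_minmax (T : H →L[ℝ] B) (hT : IsCompactOperator T) (k : ℕ)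
    (hdim : ∃ V : Submodule ℝ H, Module.finrank ℝ V = k + 1) :
    ∃ (F V : Submodule ℝ H) (l : ℝ), FiniteDimensional ℝ F ∧ FiniteDimensional ℝ V ∧
      Module.finrank ℝ F = k ∧ Module.finrank ℝ V = k + 1 ∧ 0 ≤ l ∧
      (∀ x ∈ F, adjoint T (T x) ∈ F) ∧ (∀ x ∈ V, adjoint T (T x) ∈ V) ∧ F ≤ V ∧
      (∀ x ∈ V, l * ‖x‖ ^ 2 ≤ ‖T x‖ ^ 2) ∧ ∀ x ∈ Fᗮ, ‖T x‖ ^ 2 ≤ l * ‖x‖ ^ 2 := by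
  have htop : ∀ j ≤ k, ∀ F : Submodule ℝ H, FiniteDimensional ℝ F → Module.finrank ℝ F = j →
      F ≠ ⊤ := by
    rintro j hj F hfd hF rfl
    obtain ⟨V, hV⟩ := hdim
    have : Module.finrank ℝ V ≤ Module.finrank ℝ (⊤ : Submodule ℝ H) :=
      Submodule.finrank_mono le_top
    omega
  have hind : ∀ j ≤ k, ∃ (F V : Submodule ℝ H) (l : ℝ), FiniteDimensional ℝ F ∧
      FiniteDimensional ℝ V ∧
      Module.finrank ℝ F = j ∧ Module.finrank ℝ V = j + 1 ∧ 0 ≤ l ∧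
      (∀ x ∈ F, adjoint T (T x) ∈ F) ∧ (∀ x ∈ V, adjoint T (T x) ∈ V) ∧ F ≤ V ∧
      (∀ x ∈ V, l * ‖x‖ ^ 2 ≤ ‖T x‖ ^ 2) ∧ ∀ x ∈ Fᗮ, ‖T x‖ ^ 2 ≤ l * ‖x‖ ^ 2 := by
    intro j
    induction j with
    | zero =>
      intro hj
      have hinv : ∀ x ∈ (⊥ : Submodule ℝ H), adjoint T (T x) ∈ (⊥ : Submodule ℝ H) := by
        intro x hx
        rw [Submodule.mem_bot] at hx
        simp [hx]
      obtain ⟨V, l, h1, h2, h3, h4, h5, h6, h7⟩ := exists_extend_invariant T hT ⊥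
        (htop 0 hj ⊥ inferInstance (finrank_bot ℝ H)) hinv
        ⟨‖T‖ ^ 2, by
          intro x hx
          rw [Submodule.mem_bot] at hx
          simp [hx], by
          intro x _
          rw [← mul_pow]
          exact pow_le_pow_left₀ (norm_nonneg _) (T.le_opNorm x) 2⟩
      exact ⟨⊥, V, l, inferInstance, h2, finrank_bot ℝ H, by simpa using h3, h5, hinv, h4, h1, h6,
        h7⟩
    | succ j ih =>
      intro hj
      obtain ⟨F, V, l, h1, h2, h3, h4, h5, h6, h7, h8, h9, h10⟩ := ih (by omega)
      obtain ⟨V', l', g1, g2, g3, g4, g5, g6, g7⟩ := exists_extend_invariant T hT V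
        (htop _ hj V h2 h4) h7 ⟨l, h9, fun x hx => h10 x (Submodule.orthogonal_le h8 hx)⟩
      exact ⟨V, V', l', h2, g2, h4, by omega, g5, h7, g4, g1, g6, g7⟩
  exact hind k le_rfl

/-- Comparison of two min-max problems linked by a contraction `S` preserving the compact part: if
the `k`-th value does not improve, then some extremal vector of the first problem is mapped
isometrically to an eigenvector of the second. -/
theorem exists_common_eigenvector {H' : Type*} [NormedAddCommGroup H'] [InnerProductSpace ℝ H']
    [CompleteSpace H'] (T : H →L[ℝ] B) (hT : IsCompactOperator T) (T' : H' →L[ℝ] B)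
    (hT' : IsCompactOperator T') (hT1' : ∀ x, ‖T' x‖ ≤ ‖x‖)
    (S : H →ₗ[ℝ] H') (hS : ∀ x, T' (S x) = T x) (hS1 : ∀ x, ‖S x‖ ≤ ‖x‖)
    {X : Type*} [AddCommGroup X] [Module ℝ X] (J : X →ₗ[ℝ] H') (hJ : DenseRange J) (k : ℕ)
    (hcomp : ∀ m : ℝ, 0 < m → (∃ x : Fin (k + 1) → X, LinearIndependent ℝ (fun i => J (x i)) ∧
      ∀ z ∈ Submodule.span ℝ (Set.range x), m * ‖J z‖ ^ 2 ≤ ‖T' (J z)‖ ^ 2) →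
      ∀ m' : ℝ, 0 < m' → m' < m → ∃ V : Submodule ℝ H, Module.finrank ℝ V = k + 1 ∧
        ∀ x ∈ V, m' * ‖x‖ ^ 2 ≤ ‖T x‖ ^ 2)
    (hpos : ∃ m : ℝ, 0 < m ∧ ∃ V : Submodule ℝ H, Module.finrank ℝ V = k + 1 ∧
        ∀ x ∈ V, m * ‖x‖ ^ 2 ≤ ‖T x‖ ^ 2) :
    ∃ l : ℝ, 0 < l ∧ ∃ V : Submodule ℝ H, Module.finrank ℝ V = k + 1 ∧
      (∀ x ∈ V, l * ‖x‖ ^ 2 ≤ ‖T x‖ ^ 2) ∧ ∃ x ∈ V, x ≠ 0 ∧ ‖S x‖ = ‖x‖ ∧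
        ‖T x‖ ^ 2 = l * ‖x‖ ^ 2 ∧ ∀ y, inner ℝ (T' (S x)) (T' y) = l * inner ℝ (S x) y := by
  obtain ⟨m₀, hm₀, V₀, hV₀, hV₀m⟩ := hpos
  obtain ⟨F, V, l, hF1, hV1, hF2, hV2, hl0, hFi, -, -, hVl, hFl⟩ := exists_minmax T hT k ⟨V₀, hV₀⟩
  have hup : ∀ m : ℝ, ∀ V' : Submodule ℝ H, Module.finrank ℝ V' = k + 1 →
      (∀ x ∈ V', m * ‖x‖ ^ 2 ≤ ‖T x‖ ^ 2) → m ≤ l := by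
    intro m V' hV' hm
    obtain ⟨x, hx, hx0, hxF⟩ := exists_mem_map_orthogonal LinearMap.id F V' (by omega)
    have h1 := hm x hx
    have h2 := hFl x hxF
    have h3 : 0 < ‖x‖ ^ 2 := by positivity
    exact le_of_mul_le_mul_right (h1.trans h2) h3
  have hlpos : 0 < l := hm₀.trans_le (hup m₀ V₀ hV₀ hV₀m)
  have hinj : Module.finrank ℝ (V₀.map S) = k + 1 := by
    rw [← hV₀]
    have hi : Function.Injective (S.comp V₀.subtype) := by
      rw [← LinearMap.ker_eq_bot, LinearMap.ker_eq_bot']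
      intro x hx
      have h1 : S x = 0 := hx
      have h2 : T x = 0 := by rw [← hS, h1, map_zero]
      have h3 := hV₀m x x.2
      rw [h2, norm_zero] at h3
      have h4 : ‖(x : H)‖ ^ 2 ≤ 0 := by nlinarith [sq_nonneg ‖(x : H)‖]
      have h5 : ‖(x : H)‖ = 0 := by nlinarith [sq_nonneg ‖(x : H)‖]
      exact Subtype.ext (norm_eq_zero.1 h5)
    rw [← LinearMap.finrank_range_of_inj hi, LinearMap.range_comp, Submodule.range_subtype]
  obtain ⟨F', V', l', hF1', hV1', hF2', hV2', hl0', hFi', -, -, hVl', hFl'⟩ :=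
    exists_minmax T' hT' k ⟨_, hinj⟩
  have hle : l' ≤ l := by
    by_contra! hlt
    obtain ⟨m', h1, h2⟩ := exists_between hlt
    obtain ⟨m, h3, h4⟩ := exists_between h2
    obtain ⟨W, hW, hWm⟩ := hcomp m (by linarith)
      (exists_approx_subspace T' hT1' J hJ V' hV2' hVl' (by linarith) h4) m' (by linarith) h3
    exact absurd (hup m' W hW hWm) (by linarith)
  obtain ⟨x, hx, hx0, hxF⟩ := exists_mem_map_orthogonal S F' V (by omega)
  have h1 := hVl x hx
  have h2 := hFl' (S x) hxF
  rw [hS] at h2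
  have hxpos : 0 < ‖x‖ ^ 2 := by positivity
  have hSx2 : ‖S x‖ ^ 2 ≤ ‖x‖ ^ 2 := pow_le_pow_left₀ (norm_nonneg _) (hS1 x) 2
  have h3 : l' * ‖S x‖ ^ 2 ≤ l' * ‖x‖ ^ 2 := mul_le_mul_of_nonneg_left hSx2 hl0'
  have hll : l = l' := le_antisymm (le_of_mul_le_mul_right (h1.trans (h2.trans h3)) hxpos) hle
  subst hll
  have hSx : ‖S x‖ = ‖x‖ := by
    refine le_antisymm (hS1 x) ?_
    exact le_of_sq_le_sq (le_of_mul_le_mul_left (h1.trans h2) hlpos) (norm_nonneg _)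
  refine ⟨l, hlpos, V, hV2, hVl, x, hx, hx0, hSx, le_antisymm (by rw [hSx] at h2; exact h2) h1, ?_⟩
  exact inner_eq_of_isMax T' F' hFi' hFl' hxF (by rw [hSx, hS]; exact h1)

end CompactOperators

section WeakHolomorphic

open scoped Convolution

/-- The `i`-th standard basis vector of the plane. -/
abbrev stdVec (i : Fin 2) : E2 := EuclideanSpace.single i 1

theorem repr_one : Complex.orthonormalBasisOneI.repr 1 = stdVec 0 := by
  have := Complex.orthonormalBasisOneI.repr_self 0
  simpa using this

theorem repr_I : Complex.orthonormalBasisOneI.repr Complex.I = stdVec 1 := by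
  have := Complex.orthonormalBasisOneI.repr_self 1
  simpa using this

/-- A function annihilating `∂φ/∂x + i ∂φ/∂y` for all test functions `φ` supported in `Ω`. -/
def IsWeaklyHolomorphicOn (g : E2 → ℂ) (Ω : Set E2) : Prop :=
  ∀ φ : E2 → ℝ, ContDiff ℝ (⊤ : ℕ∞) φ → HasCompactSupport φ → tsupport φ ⊆ Ω →
    ∫ x, ((fderiv ℝ φ x (stdVec 0) : ℂ) + Complex.I * (fderiv ℝ φ x (stdVec 1) : ℂ)) * g x = 0

theorem integrable_bump_mul {g : E2 → ℂ} (hg : LocallyIntegrable g) {u : E2 → ℝ}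
    (hu : Continuous u) (hc : HasCompactSupport u) : Integrable (fun x => (u x : ℂ) * g x) := by
  have := hg.integrable_smul_left_of_hasCompactSupport hu hc
  simpa [Complex.real_smul] using this

/-- Mollifications of weakly holomorphic functions are holomorphic. -/
theorem differentiableAt_mollify {g : E2 → ℂ} (hg : LocallyIntegrable g) {Ω : Set E2}
    (hw : IsWeaklyHolomorphicOn g Ω) (ρ : ContDiffBump (0 : E2)) {z : ℂ}
    (hz : closedBall (Complex.orthonormalBasisOneI.repr z) ρ.rOut ⊆ Ω) :
    DifferentiableAt ℂ (fun w : ℂ =>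
      (ρ.normed volume ⋆[ContinuousLinearMap.lsmul ℝ ℝ, volume] g)
        (Complex.orthonormalBasisOneI.repr w)) z := by
  set Ψ := Complex.orthonormalBasisOneI.repr with hΨ
  set L : ℝ →L[ℝ] ℂ →L[ℝ] ℂ := ContinuousLinearMap.lsmul ℝ ℝ with hL
  set f := ρ.normed (volume : Measure E2) with hf
  have hfc : HasCompactSupport f := ρ.hasCompactSupport_normed
  have hfs : ContDiff ℝ (⊤ : ℕ∞) f := ρ.contDiff_normed
  set y := Ψ z with hy
  have hD := hfc.hasFDerivAt_convolution_left L (hfs.of_le (by norm_cast)) hg y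
  set D := (fderiv ℝ f ⋆[L.precompL E2, volume] g) y with hDdef
  have hDv : ∀ v, D v = ∫ t, (fderiv ℝ f (y - t) v : ℂ) * g t := by
    intro v
    have hintg : Integrable (fun t => (L.precompL E2) (fderiv ℝ f t) (g (y - t))) :=
      (hfc.fderiv (𝕜 := ℝ)).convolutionExists_left (L.precompL E2)
        (hfs.continuous_fderiv (by norm_num)) hg y
    rw [hDdef, convolution_def, ContinuousLinearMap.integral_apply hintg]
    rw [← integral_sub_left_eq_self _ volume y]
    refine integral_congr_ae (Eventually.of_forall fun t => ?_)
    simp [hL, ContinuousLinearMap.precompL_apply]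
  have hF : HasFDerivAt (fun w : ℂ => (f ⋆[L, volume] g) (Ψ w))
      (D.comp (Ψ.toContinuousLinearEquiv : ℂ →L[ℝ] E2)) z :=
    HasFDerivAt.comp (g := (f ⋆[L, volume] g)) z hD (Ψ.toContinuousLinearEquiv : ℂ →L[ℝ] E2).hasFDerivAt
  rw [differentiableAt_complex_iff_differentiableAt_real]
  refine ⟨hF.differentiableAt, ?_⟩
  rw [hF.fderiv]
  have e1 : Ψ 1 = stdVec 0 := repr_one
  have e2 : Ψ Complex.I = stdVec 1 := repr_I
  change D (Ψ Complex.I) = Complex.I • D (Ψ 1)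
  rw [e1, e2, hDv, hDv]
  have hφ := hw (fun t => f (y - t)) (hfs.comp (contDiff_const.sub contDiff_id))
    (hfc.comp_homeomorph (Homeomorph.subLeft y)) (by
      refine (closure_minimal ?_ isClosed_closedBall).trans hz
      intro t ht
      have h1 : y - t ∈ Function.support f := ht
      rw [hf, ρ.support_normed_eq, mem_ball_zero_iff] at h1
      rw [mem_closedBall, dist_comm, dist_eq_norm]
      exact h1.le)
  have hder : ∀ t v, fderiv ℝ (fun t => f (y - t)) t v = - fderiv ℝ f (y - t) v := by
    intro t v
    have h1 : HasFDerivAt (fun t => y - t) (-ContinuousLinearMap.id ℝ E2) t :=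
      (hasFDerivAt_id t).const_sub y
    have h2 := ((hfs.differentiable (by norm_num)) (y - t)).hasFDerivAt.comp t h1
    have h3 : fderiv ℝ (fun t => f (y - t)) t = _ := h2.fderiv
    rw [h3]
    simp
  simp only [hder] at hφ
  have hi : ∀ v, Integrable (fun t => (fderiv ℝ f (y - t) v : ℂ) * g t) := by
    intro v
    refine integrable_bump_mul hg (u := fun t => fderiv ℝ f (y - t) v) ?_ ?_
    · exact ((hfs.continuous_fderiv (by norm_num)).comp (continuous_const.sub continuous_id)).clm_apply
        continuous_const
    · exact ((hfc.fderiv_apply (𝕜 := ℝ) v).comp_homeomorph (Homeomorph.subLeft y))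
  have hsum : (∫ t, (fderiv ℝ f (y - t) (stdVec 0) : ℂ) * g t)
      + Complex.I * ∫ t, (fderiv ℝ f (y - t) (stdVec 1) : ℂ) * g t = 0 := by
    rw [← integral_const_mul, ← integral_add (hi _) ((hi _).const_mul _), ← neg_eq_zero,
      ← integral_neg, ← hφ]
    refine integral_congr_ae (Eventually.of_forall fun t => ?_)
    simp only [Complex.ofReal_neg]
    ring
  rw [smul_eq_mul]
  linear_combination (-Complex.I) * hsum + (∫ t, (fderiv ℝ f (y - t) (stdVec 1) : ℂ) * g t) *
    Complex.I_sq

/-- Unique continuation for weakly holomorphic functions. -/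
theorem ae_eq_zero_of_weaklyHolomorphic {Ω U : Set E2} (hΩ : IsOpen Ω) (hconn : IsConnected Ω)
    {g : E2 → ℂ} (hg : LocallyIntegrable g) (hw : IsWeaklyHolomorphicOn g Ω) (hU : IsOpen U)
    (hUne : U.Nonempty) (hUΩ : U ⊆ Ω) (hgU : ∀ᵐ x, x ∈ U → g x = 0) :
    ∀ᵐ x, x ∈ Ω → g x = 0 := by
  set Ψ := Complex.orthonormalBasisOneI.repr with hΨ
  let ρ : ℕ → ContDiffBump (0 : E2) := fun n =>
    ⟨1 / (2 * ((n : ℝ) + 1)), 1 / ((n : ℝ) + 1), by positivity, by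
      apply one_div_lt_one_div_of_lt <;> linarith [(Nat.cast_nonneg n : (0 : ℝ) ≤ n)]⟩
  have hρ : Tendsto (fun n => (ρ n).rOut) atTop (𝓝 0) := tendsto_one_div_add_atTop_nhds_zero_nat
  have hae := ContDiffBump.ae_convolution_tendsto_right_of_locallyIntegrable (K := 2) hρ
    (Eventually.of_forall fun n => by
      change 1 / ((n : ℝ) + 1) ≤ 2 * (1 / (2 * ((n : ℝ) + 1)))
      have : (n : ℝ) + 1 ≠ 0 := by positivity
      field_simp
      rfl) hg
  obtain ⟨b, hb⟩ := hUne
  have hpath := (hΩ.isConnected_iff_isPathConnected).1 hconn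
  filter_upwards [hae] with x hx hxΩ
  obtain ⟨γ, hγ⟩ := hpath.joinedIn b (hUΩ hb) x hxΩ
  have hK : IsCompact (range γ) := isCompact_range γ.continuous
  obtain ⟨d, hd, hdΩ⟩ := hK.exists_cthickening_subset_open hΩ (range_subset_iff.2 hγ)
  obtain ⟨d', hd', hdU⟩ := Metric.isOpen_iff.1 hU b hb
  have hsmall : ∀ᶠ n in atTop, (ρ n).rOut < min (d / 2) (d' / 2) :=
    hρ.eventually_lt_const (by positivity)
  refine tendsto_nhds_unique hx (tendsto_const_nhds.congr' ?_)
  filter_upwards [hsmall] with n hn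
  have hn1 : (ρ n).rOut < d / 2 := hn.trans_le (min_le_left _ _)
  have hn2 : (ρ n).rOut < d' / 2 := hn.trans_le (min_le_right _ _)
  set F : ℂ → ℂ := fun w => ((ρ n).normed volume ⋆[ContinuousLinearMap.lsmul ℝ ℝ, volume] g) (Ψ w)
    with hF
  have hdiff : DifferentiableOn ℂ F (Ψ ⁻¹' (Metric.thickening (d / 2) (range γ))) := by
    intro z hz
    refine (differentiableAt_mollify hg hw (ρ n) (z := z) ?_).differentiableWithinAt
    refine subset_trans ?_ hdΩ
    intro y hy
    obtain ⟨p, hp, hpz⟩ := Metric.mem_thickening_iff.1 hz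
    refine mem_cthickening_of_dist_le y p d _ hp ?_
    have h1 := dist_triangle y (Ψ z) p
    have h2 : dist y (Ψ z) ≤ (ρ n).rOut := hy
    linarith
  have hopen : IsOpen (Ψ ⁻¹' (Metric.thickening (d / 2) (range γ))) :=
    isOpen_thickening.preimage Ψ.continuous
  have hmem : ∀ p ∈ range γ, Ψ.symm p ∈ Ψ ⁻¹' (Metric.thickening (d / 2) (range γ)) := by
    intro p hp
    simpa using self_subset_thickening (by positivity) _ hp
  have han : AnalyticOnNhd ℂ F (Ψ.symm '' range γ) := by
    refine (hdiff.analyticOnNhd hopen).mono ?_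
    rintro _ ⟨p, hp, rfl⟩
    exact hmem p hp
  have hpre : IsPreconnected (Ψ.symm '' range γ) :=
    (isPreconnected_range γ.continuous).image _ Ψ.symm.continuous.continuousOn
  have hzero : F =ᶠ[𝓝 (Ψ.symm b)] 0 := by
    have hball : Ψ ⁻¹' (ball b (d' / 2)) ∈ 𝓝 (Ψ.symm b) := by
      refine Ψ.continuous.continuousAt.preimage_mem_nhds ?_
      simpa using ball_mem_nhds b (by positivity)
    filter_upwards [hball] with w hw'
    have hw2 : dist (Ψ w) b < d' / 2 := hw'
    simp only [hF, Pi.zero_apply, convolution_eq_swap]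
    refine integral_eq_zero_of_ae ?_
    filter_upwards [hgU] with t ht
    by_cases htU : t ∈ U
    · simp [ht htU]
    · have : (ρ n).normed volume (Ψ w - t) = 0 := by
        rw [← Function.notMem_support, (ρ n).support_normed_eq, mem_ball_zero_iff, not_lt]
        by_contra! hlt
        refine htU (hdU ?_)
        rw [mem_ball]
        have h1 := dist_triangle t (Ψ w) b
        rw [← dist_eq_norm, dist_comm] at hlt
        linarith
      simp [this]
  have := han.eqOn_zero_of_preconnected_of_eventuallyEq_zero hpre
    (mem_image_of_mem _ ⟨0, γ.source⟩) hzero (mem_image_of_mem Ψ.symm ⟨1, γ.target⟩)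
  simpa [hF] using this.symm

end WeakHolomorphic

section Columns

/-- The point with coordinates `(s, y)` in the frame given by the isometry `e`. -/
def pt (e : E2 ≃ₗᵢ[ℝ] E2) (s y : ℝ) : E2 := e.symm !₂[s, y]

@[simp] theorem apply_pt_zero (e : E2 ≃ₗᵢ[ℝ] E2) (s y : ℝ) : e (pt e s y) 0 = s := by
  simp [pt]

@[simp] theorem apply_pt_one (e : E2 ≃ₗᵢ[ℝ] E2) (s y : ℝ) : e (pt e s y) 1 = y := by
  simp [pt]

@[simp] theorem pt_apply (e : E2 ≃ₗᵢ[ℝ] E2) (x : E2) : pt e (e x 0) (e x 1) = x := by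
  rw [pt, LinearIsometryEquiv.symm_apply_eq]
  ext i
  fin_cases i <;> simp

theorem pt_eq_add_fst (e : E2 ≃ₗᵢ[ℝ] E2) (s y : ℝ) :
    pt e s y = pt e 0 y + s • e.symm (EuclideanSpace.single 0 1) := by
  rw [pt, pt, ← map_smul, ← map_add]
  congr 1
  ext i
  fin_cases i <;> simp

theorem pt_eq_add_snd (e : E2 ≃ₗᵢ[ℝ] E2) (s y : ℝ) :
    pt e s y = pt e s 0 + y • e.symm (EuclideanSpace.single 1 1) := by
  rw [pt, pt, ← map_smul, ← map_add]
  congr 1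
  ext i
  fin_cases i <;> simp

theorem continuous_pt (e : E2 ≃ₗᵢ[ℝ] E2) : Continuous fun z : ℝ × ℝ => pt e z.1 z.2 := by
  unfold pt
  refine e.symm.continuous.comp ?_
  refine (PiLp.continuous_toLp 2 _).comp ?_
  refine continuous_pi fun i => ?_
  fin_cases i <;> simp <;> fun_prop

theorem measurePreserving_pt (e : E2 ≃ₗᵢ[ℝ] E2) :
    MeasurePreserving (fun z : ℝ × ℝ => pt e z.1 z.2) := by
  have h1 := (volume_preserving_finTwoArrow ℝ).symm
  have h2 := PiLp.volume_preserving_toLp (Fin 2)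
  have h3 := e.symm.measurePreserving
  exact h3.comp (h2.comp h1)

theorem dist_pt_le (e : E2 ≃ₗᵢ[ℝ] E2) (s y s' y' : ℝ) :
    dist (pt e s y) (pt e s' y') ≤ |s - s'| + |y - y'| := by
  rw [pt, pt, e.symm.dist_map, EuclideanSpace.dist_eq]
  simp only [Fin.sum_univ_two, Real.dist_eq]
  refine Real.sqrt_le_iff.2 ⟨by positivity, ?_⟩
  simp
  nlinarith [sq_abs (s - s'), sq_abs (y - y'), abs_nonneg (s - s'), abs_nonneg (y - y')]

theorem lintegral_pt (e : E2 ≃ₗᵢ[ℝ] E2) {g : E2 → ℝ≥0∞} (hg : Measurable g) :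
    ∫⁻ x, g x = ∫⁻ s, ∫⁻ y, g (pt e s y) := by
  rw [← (measurePreserving_pt e).lintegral_comp hg, Measure.volume_eq_prod, lintegral_prod]
  exact (hg.comp (continuous_pt e).measurable).aemeasurable

/-- The pointwise energy density of `f`. -/
def energyDensity (f : E2 → ℝ) (x : E2) : ℝ≥0∞ := (‖fderiv ℝ f x‖₊ : ℝ≥0∞) ^ 2

theorem continuous_energyDensity {f : E2 → ℝ} (hf : ContDiff ℝ (⊤ : ℕ∞) f) :
    Continuous (energyDensity f) := by
  have h : Continuous (fderiv ℝ f) := hf.continuous_fderiv (by simp)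
  unfold energyDensity
  fun_prop

/-- The energy of `f` on the slice of `Ω` at abscissa `s`. -/
def columnEnergy (Ω : Set E2) (e : E2 ≃ₗᵢ[ℝ] E2) (f : E2 → ℝ) (s : ℝ) : ℝ≥0∞ :=
  ∫⁻ y, Ω.indicator (energyDensity f) (pt e s y)

variable {Ω : Set E2} {e : E2 ≃ₗᵢ[ℝ] E2} {f : E2 → ℝ}

theorem measurable_indicator_energyDensity (hΩ : IsOpen Ω) (hf : ContDiff ℝ (⊤ : ℕ∞) f) :
    Measurable (Ω.indicator (energyDensity f)) :=
  (continuous_energyDensity hf).measurable.indicator hΩ.measurableSet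

theorem measurable_columnEnergy (hΩ : IsOpen Ω) (hf : ContDiff ℝ (⊤ : ℕ∞) f) :
    Measurable (columnEnergy Ω e f) :=
  Measurable.lintegral_prod_right'
    (f := fun z : ℝ × ℝ => Ω.indicator (energyDensity f) (pt e z.1 z.2))
    ((measurable_indicator_energyDensity hΩ hf).comp (continuous_pt e).measurable)

theorem lintegral_columnEnergy (hΩ : IsOpen Ω) (hf : ContDiff ℝ (⊤ : ℕ∞) f) :
    ∫⁻ s, columnEnergy Ω e f s = dirEnergy Ω f := by
  unfold columnEnergy
  rw [← lintegral_pt e (measurable_indicator_energyDensity hΩ hf),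
    lintegral_indicator hΩ.measurableSet]
  rfl

theorem sq_intervalIntegral_le {h : ℝ → ℝ} (hh : Continuous h) {a b : ℝ} (hab : a ≤ b) :
    (∫ t in a..b, h t) ^ 2 ≤ (b - a) * ∫ t in a..b, h t ^ 2 := by
  rcases hab.eq_or_lt with rfl | hlt
  · simp
  set I := ∫ t in a..b, h t
  have h0 : 0 ≤ ∫ t in a..b, ((b - a) * h t - I) ^ 2 :=
    intervalIntegral.integral_nonneg hab fun t _ => sq_nonneg _
  have h1 : ∫ t in a..b, ((b - a) * h t - I) ^ 2
      = (b - a) ^ 2 * (∫ t in a..b, h t ^ 2) - 2 * (b - a) * I * I + (b - a) * I ^ 2 := by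
    have : ∀ t, ((b - a) * h t - I) ^ 2
        = ((b - a) ^ 2 * h t ^ 2 - (2 * (b - a) * I) * h t) + I ^ 2 := fun t => by ring
    simp_rw [this]
    rw [intervalIntegral.integral_add, intervalIntegral.integral_sub,
      intervalIntegral.integral_const_mul, intervalIntegral.integral_const_mul]
    · simp [I]
    all_goals exact Continuous.intervalIntegrable (by fun_prop) _ _
  rw [h1] at h0
  have hpos : 0 < b - a := sub_pos.2 hlt
  have : 0 ≤ (b - a) * ((b - a) * (∫ t in a..b, h t ^ 2) - I ^ 2) := by nlinarith
  nlinarith [nonneg_of_mul_nonneg_right this hpos]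

theorem ofReal_sq_sub_le_line (hf : ContDiff ℝ (⊤ : ℕ∞) f) (p : E2) {v : E2} (hv : ‖v‖ = 1)
    {a b : ℝ} (hab : a ≤ b) :
    ENNReal.ofReal ((f (p + b • v) - f (p + a • v)) ^ 2)
      ≤ ENNReal.ofReal (b - a) * ∫⁻ t in Ioc a b, energyDensity f (p + t • v) := by
  have hc : Continuous (fderiv ℝ f) := hf.continuous_fderiv (by simp)
  have hd : ∀ t : ℝ, HasDerivAt (fun t : ℝ => f (p + t • v)) (fderiv ℝ f (p + t • v) v) t := by
    intro t
    have h1 : HasDerivAt (fun t : ℝ => p + t • v) v t := by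
      simpa using ((hasDerivAt_id t).smul_const v).const_add p
    exact ((hf.differentiable (by simp)) _).hasFDerivAt.comp_hasDerivAt t h1
  have hcd : Continuous fun t : ℝ => fderiv ℝ f (p + t • v) v := by fun_prop
  have hcn : Continuous fun t : ℝ => ‖fderiv ℝ f (p + t • v)‖ ^ 2 := by fun_prop
  have hFTC : ∫ t in a..b, fderiv ℝ f (p + t • v) v = f (p + b • v) - f (p + a • v) :=
    intervalIntegral.integral_eq_sub_of_hasDerivAt (fun t _ => hd t)
      (hcd.intervalIntegrable _ _)
  have hle : (f (p + b • v) - f (p + a • v)) ^ 2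
      ≤ (b - a) * ∫ t in a..b, ‖fderiv ℝ f (p + t • v)‖ ^ 2 := by
    rw [← hFTC]
    refine (sq_intervalIntegral_le hcd hab).trans ?_
    refine mul_le_mul_of_nonneg_left ?_ (sub_nonneg.2 hab)
    refine intervalIntegral.integral_mono_on hab ((hcd.pow 2).intervalIntegrable _ _)
      (hcn.intervalIntegrable _ _) fun t _ => ?_
    have := (fderiv ℝ f (p + t • v)).le_opNorm v
    rw [hv, mul_one] at this
    rw [← sq_abs]
    exact pow_le_pow_left₀ (abs_nonneg _) this 2
  refine (ENNReal.ofReal_le_ofReal hle).trans ?_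
  rw [ENNReal.ofReal_mul (sub_nonneg.2 hab), intervalIntegral.integral_of_le hab,
    ofReal_integral_eq_lintegral_ofReal]
  · refine le_of_eq ?_
    congr 1
    refine lintegral_congr fun t => ?_
    rw [ENNReal.ofReal_pow (norm_nonneg _), ofReal_norm]
    rfl
  · exact (hcn.integrableOn_Icc).mono_set Ioc_subset_Icc_self
  · exact Eventually.of_forall fun t => by positivity

theorem ofReal_sq_sub_le_column (hf : ContDiff ℝ (⊤ : ℕ∞) f) {s y₁ y₂ : ℝ} (h12 : y₁ ≤ y₂)
    (hin : ∀ y ∈ Ioc y₁ y₂, pt e s y ∈ Ω) :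
    ENNReal.ofReal ((f (pt e s y₂) - f (pt e s y₁)) ^ 2)
      ≤ ENNReal.ofReal (y₂ - y₁) * columnEnergy Ω e f s := by
  rw [pt_eq_add_snd e s y₂, pt_eq_add_snd e s y₁]
  refine (ofReal_sq_sub_le_line hf _ (by simp) h12).trans ?_
  gcongr
  rw [columnEnergy, ← lintegral_indicator measurableSet_Ioc]
  refine lintegral_mono fun y => ?_
  by_cases hy : y ∈ Ioc y₁ y₂
  · rw [indicator_of_mem hy, indicator_of_mem (hin y hy), ← pt_eq_add_snd]
  · rw [indicator_of_notMem hy]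
    exact zero_le

theorem ofReal_sq_sub_le_row (hf : ContDiff ℝ (⊤ : ℕ∞) f) {y s₁ s₂ : ℝ} (h12 : s₁ ≤ s₂) :
    ENNReal.ofReal ((f (pt e s₂ y) - f (pt e s₁ y)) ^ 2)
      ≤ ENNReal.ofReal (s₂ - s₁) * ∫⁻ s in Ioc s₁ s₂, energyDensity f (pt e s y) := by
  have := ofReal_sq_sub_le_line hf (pt e 0 y) (v := e.symm (EuclideanSpace.single 0 1))
    (by simp) h12
  simpa only [← pt_eq_add_fst] using this

theorem ofReal_sq_sub_le (x y z : ℝ) :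
    ENNReal.ofReal ((x - z) ^ 2)
      ≤ 2 * ENNReal.ofReal ((x - y) ^ 2) + 2 * ENNReal.ofReal ((y - z) ^ 2) := by
  have h2 : (2 : ℝ≥0∞) = ENNReal.ofReal 2 := by simp
  rw [h2, ← ENNReal.ofReal_mul (by norm_num), ← ENNReal.ofReal_mul (by norm_num),
    ← ENNReal.ofReal_add (by positivity) (by positivity)]
  refine ENNReal.ofReal_le_ofReal ?_
  nlinarith [sq_nonneg (x - y - (y - z))]

/-- Poincaré-type pointwise estimate on the region between a graph and a horizontal segment. -/
theorem exists_forall_ofReal_sq_sub_le (hf : ContDiff ℝ (⊤ : ℕ∞) f)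
    {φ : ℝ → ℝ} {α η c l : ℝ} (hη : 0 < η) (hφc : ∀ s ∈ Icc α (α + η), φ s ≤ c)
    (hl : ∀ s ∈ Icc α (α + η), c + η - φ s ≤ l)
    (hin : ∀ s ∈ Icc α (α + η), ∀ y ∈ Ioc (φ s) (c + η), pt e s y ∈ Ω) :
    ∃ m : ℝ, ∀ s ∈ Icc α (α + η), ∀ y ∈ Icc (φ s) (c + η),
      ENNReal.ofReal ((f (pt e s y) - m) ^ 2)
        ≤ 2 * ENNReal.ofReal l * columnEnergy Ω e f s
          + 2 * ∫⁻ s in Icc α (α + η), columnEnergy Ω e f s := by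
  have hmeas : Measurable fun z : ℝ × ℝ => energyDensity f (pt e z.1 z.2) :=
    ((continuous_energyDensity hf).comp (continuous_pt e)).measurable
  have hvol : volume (Ioc c (c + η)) = ENNReal.ofReal η := by simp
  have hη0 : ENNReal.ofReal η ≠ 0 := by simpa using hη
  obtain ⟨y₀, hy₀, hy₀le⟩ := exists_le_setLAverage (μ := volume) (s := Ioc c (c + η))
    (f := fun y => ∫⁻ s in Icc α (α + η), energyDensity f (pt e s y))
    (by rw [hvol]; exact hη0) (by simp [hvol])
    (hmeas.lintegral_prod_left' (μ := volume.restrict (Icc α (α + η)))).aemeasurable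
  have hrow : ENNReal.ofReal η * ∫⁻ s in Icc α (α + η), energyDensity f (pt e s y₀)
      ≤ ∫⁻ s in Icc α (α + η), columnEnergy Ω e f s := by
    calc _ ≤ ENNReal.ofReal η * ⨍⁻ y in Ioc c (c + η), (∫⁻ s in Icc α (α + η),
            energyDensity f (pt e s y)) ∂volume := by gcongr
      _ = ∫⁻ y in Ioc c (c + η), ∫⁻ s in Icc α (α + η), energyDensity f (pt e s y) := by
          rw [setLAverage_eq, hvol, ENNReal.mul_div_cancel hη0 ENNReal.ofReal_ne_top]
      _ = ∫⁻ s in Icc α (α + η), ∫⁻ y in Ioc c (c + η), energyDensity f (pt e s y) := by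
          rw [lintegral_lintegral_swap]
          exact (hmeas.comp measurable_swap).aemeasurable
      _ ≤ _ := by
          refine setLIntegral_mono' measurableSet_Icc fun s hs => ?_
          rw [columnEnergy, ← lintegral_indicator measurableSet_Ioc]
          refine lintegral_mono fun y => ?_
          by_cases hy : y ∈ Ioc c (c + η)
          · rw [indicator_of_mem hy, indicator_of_mem
              (hin s hs y ⟨(hφc s hs).trans_lt hy.1, hy.2⟩)]
          · rw [indicator_of_notMem hy]
            exact zero_le
  refine ⟨f (pt e α y₀), fun s hs y hy => ?_⟩
  refine (ofReal_sq_sub_le _ (f (pt e s y₀)) _).trans ?_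
  refine add_le_add ?_ ?_
  · rw [mul_assoc]
    gcongr
    have hy₀' : y₀ ∈ Icc (φ s) (c + η) := ⟨(hφc s hs).trans hy₀.1.le, hy₀.2⟩
    rcases le_total y y₀ with h | h
    · rw [← neg_sub, neg_sq]
      refine (ofReal_sq_sub_le_column hf h fun τ hτ =>
        hin s hs τ ⟨hy.1.trans_lt hτ.1, hτ.2.trans hy₀.2⟩).trans ?_
      gcongr
      linarith [hl s hs, hy₀'.2, hy.1]
    · refine (ofReal_sq_sub_le_column hf h fun τ hτ =>
        hin s hs τ ⟨hy₀'.1.trans_lt hτ.1, hτ.2.trans hy.2⟩).trans ?_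
      gcongr
      linarith [hl s hs, hy₀'.1, hy.2]
  · gcongr
    refine (ofReal_sq_sub_le_row hf hs.1).trans (le_trans ?_ hrow)
    gcongr
    · linarith [hs.2]
    · exact fun τ hτ => ⟨hτ.1.le, hτ.2.trans hs.2⟩

end Columns

section Charts

variable {Ω : Set E2} {e : E2 ≃ₗᵢ[ℝ] E2} {f : E2 → ℝ}

theorem exists_column_estimates (hΩ : IsOpen Ω) (hf : ContDiff ℝ (⊤ : ℕ∞) f)
    {φ : ℝ → ℝ} {α η c l : ℝ} (hη : 0 < η) (hφc : ∀ s ∈ Icc α (α + η), φ s ≤ c)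
    (hl : ∀ s ∈ Icc α (α + η), c + η - φ s ≤ l)
    (hin : ∀ s ∈ Icc α (α + η), ∀ y ∈ Ioc (φ s) (c + η), pt e s y ∈ Ω) :
    ∃ m : ℝ, (∫⁻ s in Icc α (α + η), ∫⁻ y in Icc (φ s) (c + η),
        ENNReal.ofReal ((f (pt e s y) - m) ^ 2)
          ≤ (2 * ENNReal.ofReal l + 2 * ENNReal.ofReal η) * ENNReal.ofReal l *
            ∫⁻ s in Icc α (α + η), columnEnergy Ω e f s) ∧
      ∫⁻ s in Icc α (α + η), ENNReal.ofReal ((f (pt e s (φ s)) - m) ^ 2)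
        ≤ (2 * ENNReal.ofReal l + 2 * ENNReal.ofReal η) *
          ∫⁻ s in Icc α (α + η), columnEnergy Ω e f s := by
  obtain ⟨m, hm⟩ := exists_forall_ofReal_sq_sub_le hf hη hφc hl hin
  set Q := ∫⁻ s in Icc α (α + η), columnEnergy Ω e f s with hQ
  have hintg : ∫⁻ s in Icc α (α + η), (2 * ENNReal.ofReal l * columnEnergy Ω e f s + 2 * Q)
      = (2 * ENNReal.ofReal l + 2 * ENNReal.ofReal η) * Q := by
    rw [lintegral_add_right _ measurable_const,
      lintegral_const_mul _ (measurable_columnEnergy hΩ hf), lintegral_const, ← hQ]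
    simp
    ring
  refine ⟨m, ?_, ?_⟩
  · calc _ ≤ ∫⁻ s in Icc α (α + η),
          (2 * ENNReal.ofReal l * columnEnergy Ω e f s + 2 * Q) * ENNReal.ofReal l := by
          refine setLIntegral_mono' measurableSet_Icc fun s hs => ?_
          refine (setLIntegral_mono' measurableSet_Icc fun y hy => hm s hs y hy).trans ?_
          rw [setLIntegral_const, Real.volume_Icc]
          gcongr
          exact hl s hs
      _ = _ := by
          rw [lintegral_mul_const' _ _ ENNReal.ofReal_ne_top, hintg]
          ring
  · rw [← hintg]
    refine setLIntegral_mono' measurableSet_Icc fun s hs => hm s hs _ ⟨le_rfl, ?_⟩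
    linarith [hφc s hs]

theorem lipschitzWith_graph (e : E2 ≃ₗᵢ[ℝ] E2) {K : ℝ≥0} {φ : ℝ → ℝ} (hφ : LipschitzWith K φ) :
    LipschitzWith (1 + K) fun s => pt e s (φ s) := by
  refine LipschitzWith.of_dist_le_mul fun s t => (dist_pt_le e _ _ _ _).trans ?_
  have := hφ.dist_le_mul s t
  rw [Real.dist_eq, Real.dist_eq] at this
  rw [Real.dist_eq]
  push_cast
  linarith

theorem setLIntegral_hausdorff_le {γ : ℝ → E2} {K : ℝ≥0} (hγ : LipschitzWith K γ)
    {I : Set ℝ} {A : Set E2} (hA : A ⊆ γ '' I)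
    {h : E2 → ℝ≥0∞} (hh : Measurable h) :
    ∫⁻ x in A, h x ∂μH[1] ≤ K * ∫⁻ s in I, h (γ s) := by
  have hle : (μH[1] : Measure E2).restrict A
      ≤ (K : ℝ≥0∞) • (volume.restrict I).map γ := by
    refine Measure.le_iff.2 fun S hS => ?_
    rw [Measure.restrict_apply hS, Measure.smul_apply,
      Measure.map_apply hγ.continuous.measurable hS,
      Measure.restrict_apply (hγ.continuous.measurable hS)]
    have hsub : S ∩ A ⊆ γ '' (γ ⁻¹' S ∩ I) := by
      rintro x ⟨hxS, hxA⟩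
      obtain ⟨s, hs, rfl⟩ := hA hxA
      exact ⟨s, ⟨hxS, hs⟩, rfl⟩
    refine (measure_mono hsub).trans ?_
    have := (hγ.lipschitzOnWith (s := γ ⁻¹' S ∩ I)).hausdorffMeasure_image_le
      (d := 1) zero_le_one
    rw [← hausdorffMeasure_real]
    simpa using this
  refine (lintegral_mono' hle le_rfl).trans ?_
  rw [lintegral_smul_measure, lintegral_map hh hγ.continuous.measurable, smul_eq_mul]

/-- Over `[a, a + δ]` the set `Ω` is, in the frame `e` and in a rectangle of half-height
`(K + 1) δ`, the epigraph of the `K`-Lipschitz function `φ`. -/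
structure IsChart (Ω : Set E2) (e : E2 ≃ₗᵢ[ℝ] E2) (K : ℝ≥0) (φ : ℝ → ℝ) (a δ : ℝ) : Prop where
  pos : 0 < δ
  lip : LipschitzWith K φ
  mem_iff : ∀ s ∈ Icc a (a + δ), ∀ y ∈ Icc (φ a - (K + 1) * δ) (φ a + (K + 1) * δ),
    (pt e s y ∈ Ω ↔ φ s < y)

/-- The open rectangle on which a chart is defined. -/
def chartBox (e : E2 ≃ₗᵢ[ℝ] E2) (K : ℝ≥0) (φ : ℝ → ℝ) (a δ : ℝ) : Set E2 :=
  {x | e x 0 ∈ Ioo a (a + δ) ∧ e x 1 ∈ Ioo (φ a - (K + 1) * δ) (φ a + (K + 1) * δ)}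

theorem isOpen_chartBox (e : E2 ≃ₗᵢ[ℝ] E2) (K : ℝ≥0) (φ : ℝ → ℝ) (a δ : ℝ) :
    IsOpen (chartBox e K φ a δ) := by
  refine IsOpen.inter ?_ ?_
  · exact isOpen_Ioo.preimage (by fun_prop)
  · exact isOpen_Ioo.preimage (by fun_prop)

variable {K : ℝ≥0} {φ : ℝ → ℝ} {a δ : ℝ}

theorem LipschitzWith.abs_sub_le (h : LipschitzWith K φ) {s t d : ℝ} (hd : |s - t| ≤ d) :
    |φ s - φ t| ≤ K * d := by
  have := h.dist_le_mul s t
  rw [Real.dist_eq, Real.dist_eq] at this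
  exact this.trans (by gcongr)

namespace IsChart

theorem mem_iff_of_mem (h : IsChart Ω e K φ a δ) {x : E2} (hx : x ∈ chartBox e K φ a δ) :
    x ∈ Ω ↔ φ (e x 0) < e x 1 := by
  have := h.mem_iff (e x 0) (Ioo_subset_Icc_self hx.1) (e x 1) (Ioo_subset_Icc_self hx.2)
  rwa [pt_apply] at this

theorem eq_of_mem_frontier (h : IsChart Ω e K φ a δ) (hΩ : IsOpen Ω) {x : E2}
    (hx : x ∈ chartBox e K φ a δ) (hxf : x ∈ frontier Ω) : e x 1 = φ (e x 0) := by
  rw [hΩ.frontier_eq] at hxf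
  have h1 : ¬ φ (e x 0) < e x 1 := fun hlt => hxf.2 ((h.mem_iff_of_mem hx).2 hlt)
  refine le_antisymm (not_lt.1 h1) (not_lt.1 fun hlt => ?_)
  have hopen : IsOpen (chartBox e K φ a δ ∩ {x | e x 1 < φ (e x 0)}) :=
    (isOpen_chartBox e K φ a δ).inter
      (isOpen_lt (by fun_prop) (h.lip.continuous.comp (by fun_prop)))
  obtain ⟨y, hy, hyΩ⟩ := mem_closure_iff.1 hxf.1 _ hopen ⟨hx, hlt⟩
  exact lt_asymm hy.2 ((h.mem_iff_of_mem hy.1).1 hyΩ)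

theorem frontier_inter_subset (h : IsChart Ω e K φ a δ) (hΩ : IsOpen Ω) :
    frontier Ω ∩ chartBox e K φ a δ ⊆ (fun s => pt e s (φ s)) '' Ioo a (a + δ) := by
  rintro x ⟨hxf, hx⟩
  refine ⟨e x 0, hx.1, ?_⟩
  simp only [← h.eq_of_mem_frontier hΩ hx hxf, pt_apply]

theorem column_estimates (h : IsChart Ω e K φ a δ) (hΩ : IsOpen Ω)
    (hf : ContDiff ℝ (⊤ : ℕ∞) f) {α η : ℝ} (hη : 0 < η) (hα : a ≤ α) (hαη : α + η ≤ a + δ) :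
    ∃ m : ℝ, (∫⁻ s in Icc α (α + η), ∫⁻ y in Icc (φ s) (φ α + K * η + η),
        ENNReal.ofReal ((f (pt e s y) - m) ^ 2)
          ≤ (2 * ENNReal.ofReal ((2 * K + 1) * η) + 2 * ENNReal.ofReal η) *
              ENNReal.ofReal ((2 * K + 1) * η) *
            ∫⁻ s in Icc α (α + η), columnEnergy Ω e f s) ∧
      ∫⁻ s in Icc α (α + η), ENNReal.ofReal ((f (pt e s (φ s)) - m) ^ 2)
        ≤ (2 * ENNReal.ofReal ((2 * K + 1) * η) + 2 * ENNReal.ofReal η) *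
          ∫⁻ s in Icc α (α + η), columnEnergy Ω e f s := by
  have key : ∀ s ∈ Icc α (α + η), |φ s - φ α| ≤ K * η := fun s hs =>
    h.lip.abs_sub_le (by rw [abs_le]; constructor <;> linarith [hs.1, hs.2])
  have hK : (0 : ℝ) ≤ K := K.2
  refine exists_column_estimates hΩ hf hη (fun s hs => ?_) (fun s hs => ?_) fun s hs y hy => ?_
  · linarith [(abs_le.1 (key s hs)).2]
  · linarith [(abs_le.1 (key s hs)).1]
  · have hs' : s ∈ Icc a (a + δ) := ⟨hα.trans hs.1, hs.2.trans hαη⟩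
    have hsa : |φ s - φ a| ≤ K * δ :=
      h.lip.abs_sub_le (by rw [abs_le]; constructor <;> linarith [hs'.1, hs'.2])
    have hαa : |φ α - φ a| ≤ K * (α - a) :=
      h.lip.abs_sub_le (by rw [abs_le]; constructor <;> linarith)
    refine (h.mem_iff s hs' y ⟨?_, ?_⟩).2 hy.1
    · have := h.pos
      linarith [(abs_le.1 hsa).1, hy.1]
    · have h3 := (abs_le.1 hαa).2
      have h4 : (K : ℝ) * (α - a + η) ≤ K * δ := by gcongr; linarith
      linarith [hy.2]

end IsChart

theorem exists_isChart (hΩ : IsLipschitzDomain Ω) {p : E2} (hp : p ∈ frontier Ω) {W : Set E2}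
    (hW : W ∈ 𝓝 p) : ∃ (e : E2 ≃ₗᵢ[ℝ] E2) (K : ℝ≥0) (φ : ℝ → ℝ) (a δ : ℝ),
      IsChart Ω e K φ a δ ∧ p ∈ chartBox e K φ a δ ∧ chartBox e K φ a δ ⊆ W := by
  obtain ⟨e, K, φ, U, hφ, hU, hpU, hmem⟩ := hΩ.2.2.2 p hp
  have hopen := hΩ.1
  have hpφ : e p 1 = φ (e p 0) := by
    have hp' := hp
    rw [hopen.frontier_eq] at hp'
    have h1 : ¬ φ (e p 0) < e p 1 := fun hlt => hp'.2 ((hmem p hpU).2 hlt)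
    refine le_antisymm (not_lt.1 h1) (not_lt.1 fun hlt => ?_)
    have hopen : IsOpen (U ∩ {x | e x 1 < φ (e x 0)}) :=
      hU.inter (isOpen_lt (by fun_prop) (hφ.continuous.comp (by fun_prop)))
    obtain ⟨y, hy, hyΩ⟩ := mem_closure_iff.1 hp'.1 _ hopen ⟨hpU, hlt⟩
    exact lt_asymm hy.2 ((hmem y hy.1).1 hyΩ)
  obtain ⟨r, hr, hball⟩ := Metric.mem_nhds_iff.1 (inter_mem (hU.mem_nhds hpU) hW)
  have hK : (0 : ℝ) ≤ K := K.2
  set δ : ℝ := r / (2 * K + 3) with hδ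
  have hδ0 : 0 < δ := by positivity
  have hδr : (2 * K + 3) * δ = r := by
    rw [hδ]
    field_simp
  have hpa : |φ (e p 0 - δ / 2) - φ (e p 0)| ≤ K * δ :=
    hφ.abs_sub_le (by rw [abs_le]; constructor <;> linarith)
  have hsub : ∀ x : E2, e x 0 ∈ Icc (e p 0 - δ / 2) (e p 0 - δ / 2 + δ) →
      e x 1 ∈ Icc (φ (e p 0 - δ / 2) - (K + 1) * δ) (φ (e p 0 - δ / 2) + (K + 1) * δ) →
      x ∈ U ∩ W := by
    intro x h0 h1
    refine hball ?_
    rw [mem_ball, ← pt_apply e x, ← pt_apply e p]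
    refine (dist_pt_le _ _ _ _ _).trans_lt ?_
    have h2 : |e x 0 - e p 0| ≤ δ / 2 := by rw [abs_le]; constructor <;> linarith [h0.1, h0.2]
    have h3 : |e x 1 - e p 1| ≤ (2 * K + 1) * δ := by
      rw [hpφ, abs_le]
      constructor <;> linarith [h1.1, h1.2, abs_le.1 hpa |>.1, abs_le.1 hpa |>.2]
    linarith
  refine ⟨e, K, φ, e p 0 - δ / 2, δ, ⟨hδ0, hφ, fun s hs y hy => ?_⟩, ⟨?_, ?_⟩, ?_⟩
  · have := hmem (pt e s y) (hsub _ (by simpa using hs) (by simpa using hy)).1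
    simpa using this
  · constructor <;> linarith
  · rw [hpφ]
    constructor <;> linarith [abs_le.1 hpa |>.1, abs_le.1 hpa |>.2]
  · exact fun x hx => (hsub x (Ioo_subset_Icc_self hx.1) (Ioo_subset_Icc_self hx.2)).2

end Charts

section Trace

variable {Ω : Set E2} {e : E2 ≃ₗᵢ[ℝ] E2} {f : E2 → ℝ} {K : ℝ≥0} {φ : ℝ → ℝ} {a δ : ℝ}

theorem IsLipschitzDomain.isCompact_frontier (hΩ : IsLipschitzDomain Ω) :
    IsCompact (frontier Ω) :=
  hΩ.2.2.1.isCompact_closure.of_isClosed_subset isClosed_frontier frontier_subset_closure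

theorem IsLipschitzDomain.hausdorffMeasure_frontier_lt_top (hΩ : IsLipschitzDomain Ω) :
    μH[1] (frontier Ω) < ∞ := by
  have : μH[1] (frontier Ω ∩ frontier Ω) < ∞ := by
    refine hΩ.isCompact_frontier.induction_on (p := fun A => μH[1] (frontier Ω ∩ A) < ∞)
      (by simp) (fun A B hAB hB => (measure_mono (by gcongr)).trans_lt hB)
      (fun A B hA hB => ?_) fun p hp => ?_
    · rw [inter_union_distrib_left]
      exact measure_union_lt_top hA hB
    · obtain ⟨e, K, φ, a, δ, h, hpb, -⟩ := exists_isChart hΩ hp univ_mem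
      refine ⟨_, mem_nhdsWithin_of_mem_nhds ((isOpen_chartBox ..).mem_nhds hpb), ?_⟩
      have := setLIntegral_hausdorff_le (lipschitzWith_graph e h.lip)
        (h.frontier_inter_subset hΩ.1) (measurable_const (a := (1 : ℝ≥0∞)))
      refine lt_of_le_of_lt (by simpa using this) ?_
      exact ENNReal.mul_lt_top ENNReal.coe_lt_top ENNReal.ofReal_lt_top
  simpa using this

theorem measurable_ofReal_sq_sub (hf : ContDiff ℝ (⊤ : ℕ∞) f) {g : E2 → ℝ} (hg : Measurable g) :
    Measurable fun x => ENNReal.ofReal ((f x - g x) ^ 2) :=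
  ((hf.continuous.measurable.sub hg).pow_const 2).ennreal_ofReal

theorem IsChart.exists_label (h : IsChart Ω e K φ a δ) (hΩ : IsOpen Ω) {ε : ℝ≥0∞} (hε : ε ≠ 0) :
    ∃ (N : ℕ) (label : E2 → ℕ), Measurable label ∧ (∀ x, label x < N) ∧
      ∀ f : E2 → ℝ, ContDiff ℝ (⊤ : ℕ∞) f → ∃ m : ℕ → ℝ,
        ∫⁻ x in frontier Ω ∩ chartBox e K φ a δ, ENNReal.ofReal ((f x - m (label x)) ^ 2) ∂μH[1]
          ≤ ε * dirEnergy Ω f := by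
  have hlim : Tendsto (fun n : ℕ => ENNReal.ofReal ((1 + K) * (4 * K + 4) * δ * (1 / ((n : ℝ) + 1))))
      atTop (𝓝 0) := by
    rw [← ENNReal.ofReal_zero]
    refine ENNReal.tendsto_ofReal ?_
    simpa using (tendsto_one_div_add_atTop_nhds_zero_nat (𝕜 := ℝ)).const_mul
      ((1 + (K : ℝ)) * (4 * K + 4) * δ)
  obtain ⟨n, hn⟩ := (hlim.eventually (ge_mem_nhds (pos_iff_ne_zero.2 hε))).exists
  have hδ := h.pos
  set η : ℝ := δ / (n + 1) with hη
  have hη0 : 0 < η := by positivity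
  have hηδ : (n + 1) * η = δ := by rw [hη]; field_simp
  have hconst : ((1 + K : ℝ≥0) : ℝ≥0∞) * (2 * ENNReal.ofReal ((2 * K + 1) * η)
      + 2 * ENNReal.ofReal η) ≤ ε := by
    refine le_trans (le_of_eq ?_) hn
    rw [← ENNReal.ofReal_coe_nnreal, ← ENNReal.ofReal_ofNat 2, ← ENNReal.ofReal_mul (by norm_num),
      ← ENNReal.ofReal_mul (by norm_num), ← ENNReal.ofReal_add (by positivity) (by positivity),
      ← ENNReal.ofReal_mul (by positivity)]
    congr 1
    rw [hη]
    push_cast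
    ring
  refine ⟨n + 1, fun x => min n ⌊(e x 0 - a) / η⌋₊, ?_, fun x => by simp, fun f hf => ?_⟩
  · refine measurable_const.min (Nat.measurable_floor.comp ?_)
    fun_prop
  have hpiece : ∀ j : Fin (n + 1), a ≤ a + j * η ∧ a + j * η + η ≤ a + δ := fun j => by
    have hj : ((j : ℕ) : ℝ) + 1 ≤ n + 1 := by exact_mod_cast j.2
    constructor
    · have : 0 ≤ (j : ℝ) * η := by positivity
      linarith
    · nlinarith
  choose m hm using fun j : Fin (n + 1) =>
    h.column_estimates hΩ hf hη0 (hpiece j).1 (hpiece j).2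
  set I : Fin (n + 1) → Set ℝ := fun j => Ico (a + j * η) (a + j * η + η) with hI
  have hfloor : ∀ j : Fin (n + 1), ∀ s ∈ I j, ⌊(s - a) / η⌋₊ = j := fun j s hs => by
    have hsa : 0 ≤ (s - a) / η := div_nonneg (by linarith [hs.1, (hpiece j).1]) hη0.le
    rw [Nat.floor_eq_iff hsa, le_div_iff₀ hη0, div_lt_iff₀ hη0]
    constructor <;> linarith [hs.1, hs.2]
  refine ⟨fun j => if hj : j < n + 1 then m ⟨j, hj⟩ else 0, ?_⟩
  refine (setLIntegral_hausdorff_le (lipschitzWith_graph e h.lip)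
    (h.frontier_inter_subset hΩ) ?_).trans ?_
  · refine measurable_ofReal_sq_sub hf (Measurable.comp
      (g := fun j : ℕ => if hj : j < n + 1 then m ⟨j, hj⟩ else 0) measurable_from_top ?_)
    refine measurable_const.min (Nat.measurable_floor.comp ?_)
    fun_prop
  have hcover : Ioo a (a + δ) ⊆ ⋃ j, I j := fun s hs => by
    have hsa : 0 ≤ (s - a) / η := div_nonneg (by linarith [hs.1]) hη0.le
    have hlt : ⌊(s - a) / η⌋₊ < n + 1 := by
      rw [Nat.floor_lt hsa, div_lt_iff₀ hη0]
      push_cast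
      linarith [hs.2]
    refine mem_iUnion.2 ⟨⟨_, hlt⟩, ?_, ?_⟩
    · have := Nat.floor_le hsa
      rw [le_div_iff₀ hη0] at this
      simp only
      linarith
    · have := Nat.lt_floor_add_one ((s - a) / η)
      rw [div_lt_iff₀ hη0] at this
      simp only
      linarith
  have hdisj : Pairwise (Function.onFun Disjoint I) := fun i j hij => by
    refine Set.disjoint_left.2 fun s hi hj => hij (Fin.ext ?_)
    rw [← hfloor i s hi, ← hfloor j s hj]
  calc _ ≤ ((1 + K : ℝ≥0) : ℝ≥0∞) * ∑' j, ∫⁻ s in I j, ENNReal.ofReal ((f (pt e s (φ s))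
          - (fun j : ℕ => if hj : j < n + 1 then m ⟨j, hj⟩ else 0)
            (min n ⌊(e (pt e s (φ s)) 0 - a) / η⌋₊)) ^ 2) := by
        gcongr
        exact (lintegral_mono_set hcover).trans (lintegral_iUnion_le _ _)
    _ ≤ ((1 + K : ℝ≥0) : ℝ≥0∞) * ∑' j, (2 * ENNReal.ofReal ((2 * K + 1) * η)
          + 2 * ENNReal.ofReal η) * ∫⁻ s in I j, columnEnergy Ω e f s := by
        gcongr with j
        rw [show ∫⁻ s in I j, columnEnergy Ω e f s = _ from
          setLIntegral_congr Ico_ae_eq_Icc]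
        refine le_trans ?_ (hm j).2
        rw [← setLIntegral_congr (Ico_ae_eq_Icc (a := a + j * η) (b := a + j * η + η))]
        refine le_of_eq (setLIntegral_congr_fun measurableSet_Ico fun s hs => ?_)
        have hjn : min n (j : ℕ) = j := min_eq_right (Nat.lt_succ_iff.1 j.2)
        simp only [apply_pt_zero, hfloor j s hs, hjn, j.2, dif_pos]
    _ = ((1 + K : ℝ≥0) : ℝ≥0∞) * (2 * ENNReal.ofReal ((2 * K + 1) * η)
          + 2 * ENNReal.ofReal η) * ∫⁻ s in ⋃ j, I j, columnEnergy Ω e f s := by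
        rw [ENNReal.tsum_mul_left, lintegral_iUnion (fun j => measurableSet_Ico) hdisj, mul_assoc]
    _ ≤ _ := by
        rw [← lintegral_columnEnergy (e := e) hΩ hf]
        exact mul_le_mul' hconst (setLIntegral_le_lintegral _ _)

/-- Up to a small multiple of the energy, boundary values take finitely many values, on the
cells of a finite partition that does not depend on the function. -/
theorem IsLipschitzDomain.exists_label (hΩ : IsLipschitzDomain Ω) {ε : ℝ≥0∞} (hε : ε ≠ 0) :
    ∃ (N : ℕ) (label : E2 → ℕ), Measurable label ∧ (∀ x, label x < N) ∧
      ∀ f : E2 → ℝ, ContDiff ℝ (⊤ : ℕ∞) f → ∃ m : ℕ → ℝ,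
        ∫⁻ x in frontier Ω, ENNReal.ofReal ((f x - m (label x)) ^ 2) ∂μH[1]
          ≤ ε * dirEnergy Ω f := by
  have key : ∀ ε : ℝ≥0∞, ε ≠ 0 → ∃ A, MeasurableSet A ∧ frontier Ω ⊆ A ∧
      ∃ (N : ℕ) (label : E2 → ℕ), Measurable label ∧ (∀ x, label x < N) ∧
      ∀ f : E2 → ℝ, ContDiff ℝ (⊤ : ℕ∞) f → ∃ m : ℕ → ℝ,
        ∫⁻ x in frontier Ω ∩ A, ENNReal.ofReal ((f x - m (label x)) ^ 2) ∂μH[1]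
          ≤ ε * dirEnergy Ω f := by
    refine hΩ.isCompact_frontier.induction_on (p := fun S => ∀ ε : ℝ≥0∞, ε ≠ 0 →
      ∃ A, MeasurableSet A ∧ S ⊆ A ∧
      ∃ (N : ℕ) (label : E2 → ℕ), Measurable label ∧ (∀ x, label x < N) ∧
      ∀ f : E2 → ℝ, ContDiff ℝ (⊤ : ℕ∞) f → ∃ m : ℕ → ℝ,
        ∫⁻ x in frontier Ω ∩ A, ENNReal.ofReal ((f x - m (label x)) ^ 2) ∂μH[1]
          ≤ ε * dirEnergy Ω f) (fun ε _ => ?_) (fun S T hST hT ε hε => ?_)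
      (fun S T hS hT ε hε => ?_) fun p hp => ?_
    · exact ⟨∅, .empty, subset_rfl, 1, fun _ => 0, measurable_const, by simp, by simp⟩
    · obtain ⟨A, hA, hTA, h⟩ := hT ε hε
      exact ⟨A, hA, hST.trans hTA, h⟩
    · have hε2 : ε / 2 ≠ 0 := by simpa using hε
      obtain ⟨A, hA, hSA, N, l, hl, hlN, hfl⟩ := hS (ε / 2) hε2
      obtain ⟨B, hB, hTB, N', l', hl', hlN', hfl'⟩ := hT (ε / 2) hε2
      classical
      refine ⟨A ∪ B, hA.union hB, union_subset_union hSA hTB, N + N',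
        A.piecewise l (fun x => N + l' x), hl.piecewise hA (measurable_const.add hl'),
        fun x => ?_, fun f hf => ?_⟩
      · by_cases hx : x ∈ A
        · simpa [hx] using (hlN x).trans_le (Nat.le_add_right _ _)
        · simpa [hx] using hlN' x
      · obtain ⟨m, hm⟩ := hfl f hf
        obtain ⟨m', hm'⟩ := hfl' f hf
        refine ⟨fun j => if j < N then m j else m' (j - N), ?_⟩
        have hF : MeasurableSet (frontier Ω) := isClosed_frontier.measurableSet
        rw [show frontier Ω ∩ (A ∪ B) = frontier Ω ∩ A ∪ frontier Ω ∩ (B \ A) by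
          rw [← inter_union_distrib_left, union_sdiff_self]]
        refine (lintegral_union_le _ _ _).trans ?_
        rw [← ENNReal.add_halves ε, add_mul]
        refine add_le_add (le_trans (le_of_eq ?_) hm) (le_trans ?_ hm')
        · refine setLIntegral_congr_fun (hF.inter hA) fun x hx => ?_
          simp [hx.2, hlN x]
        · refine le_trans (le_of_eq ?_) (lintegral_mono_set (inter_subset_inter_right _ (sdiff_subset (t := A))))
          refine setLIntegral_congr_fun (hF.inter (hB.diff hA)) fun x hx => ?_
          simp [hx.2.2]
    · obtain ⟨e, K, φ, a, δ, h, hpb, -⟩ := exists_isChart hΩ hp univ_mem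
      refine ⟨_, mem_nhdsWithin_of_mem_nhds ((isOpen_chartBox ..).mem_nhds hpb), fun ε hε =>
        ⟨_, (isOpen_chartBox ..).measurableSet, subset_rfl, h.exists_label hΩ.1 hε⟩⟩
  obtain ⟨A, -, hA, h⟩ := key ε hε
  rwa [inter_eq_left.2 hA] at h

end Trace

section Poincare

variable {Ω : Set E2} {e : E2 ≃ₗᵢ[ℝ] E2} {f : E2 → ℝ} {K : ℝ≥0} {φ : ℝ → ℝ} {a δ : ℝ}

theorem setLIntegral_le_columns (e : E2 ≃ₗᵢ[ℝ] E2) {g : E2 → ℝ≥0∞} (hg : Measurable g)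
    {A : Set E2} (hA : MeasurableSet A) {I : Set ℝ} (hI : MeasurableSet I) {J : ℝ → Set ℝ}
    (hJ : ∀ s, MeasurableSet (J s)) (h : ∀ x ∈ A, e x 0 ∈ I ∧ e x 1 ∈ J (e x 0)) :
    ∫⁻ x in A, g x ≤ ∫⁻ s in I, ∫⁻ y in J s, g (pt e s y) := by
  rw [← lintegral_indicator hA, lintegral_pt e (hg.indicator hA), ← lintegral_indicator hI]
  refine lintegral_mono fun s => ?_
  by_cases hs : s ∈ I
  · rw [indicator_of_mem hs, ← lintegral_indicator (hJ s)]
    refine lintegral_mono fun y => ?_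
    by_cases hy : pt e s y ∈ A
    · have := (h _ hy).2
      simp only [apply_pt_zero, apply_pt_one] at this
      rw [indicator_of_mem hy, indicator_of_mem this]
    · rw [indicator_of_notMem hy]
      exact zero_le
  · have : ∀ y, A.indicator g (pt e s y) = 0 := fun y =>
      indicator_of_notMem (fun hy => hs (by simpa using (h _ hy).1)) _
    simp [this]

theorem lintegral_ofReal_sq_sub_triangle {α : Type*} [MeasurableSpace α] {μ : Measure α}
    {u : α → ℝ} (hu : Measurable u) (m m' : ℝ) :
    ENNReal.ofReal ((m - m') ^ 2) * μ univ ≤ 2 * ∫⁻ x, ENNReal.ofReal ((u x - m) ^ 2) ∂μ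
      + 2 * ∫⁻ x, ENNReal.ofReal ((u x - m') ^ 2) ∂μ := by
  have hm : ∀ c : ℝ, Measurable fun x => ENNReal.ofReal ((u x - c) ^ 2) := fun c =>
    ((hu.sub_const c).pow_const 2).ennreal_ofReal
  rw [← lintegral_const, ← lintegral_const_mul _ (hm m), ← lintegral_const_mul _ (hm m'),
    ← lintegral_add_left ((hm m).const_mul _)]
  refine lintegral_mono fun x => ?_
  refine (ofReal_sq_sub_le m (u x) m').trans ?_
  rw [← neg_sub (u x) m, neg_sq]

/-- Both on an open set and on its boundary part, all functions are within a multiple of the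
energy of a constant. -/
def PoincareOn (Ω W : Set E2) : Prop :=
  ∃ C : ℝ≥0∞, C ≠ ∞ ∧ ∀ f : E2 → ℝ, ContDiff ℝ (⊤ : ℕ∞) f → ∃ m : ℝ,
    ∫⁻ x in W ∩ Ω, ENNReal.ofReal ((f x - m) ^ 2) ≤ C * dirEnergy Ω f ∧
    ∫⁻ x in W ∩ frontier Ω, ENNReal.ofReal ((f x - m) ^ 2) ∂μH[1] ≤ C * dirEnergy Ω f

theorem exists_poincareOn_of_mem (hΩ : IsOpen Ω) {p : E2} (hp : p ∈ Ω) :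
    ∃ W, IsOpen W ∧ p ∈ W ∧ PoincareOn Ω W := by
  obtain ⟨r, hr, hball⟩ := Metric.isOpen_iff.1 hΩ p hp
  set e := LinearIsometryEquiv.refl ℝ E2
  set W : Set E2 := {x | e x 0 ∈ Ioo (p 0 - r / 8) (p 0 - r / 8 + r / 4) ∧
    e x 1 ∈ Ioo (p 1 - r / 8) (p 1 - r / 8 + r / 4)} with hW
  have hWo : IsOpen W := (isOpen_Ioo.preimage (f := fun x : E2 => e x 0) (by fun_prop)).inter
    (isOpen_Ioo.preimage (f := fun x : E2 => e x 1) (by fun_prop))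
  have hin : ∀ s ∈ Icc (p 0 - r / 8) (p 0 - r / 8 + r / 4),
      ∀ y ∈ Icc (p 1 - r / 8) (p 1 - r / 8 + r / 4), pt e s y ∈ Ω := by
    intro s hs y hy
    refine hball ?_
    rw [mem_ball, ← pt_apply e p]
    refine (dist_pt_le _ _ _ _ _).trans_lt ?_
    have h2 : |s - e p 0| ≤ r / 8 := by
      rw [abs_le]; constructor <;> simp [e] <;> linarith [hs.1, hs.2]
    have h3 : |y - e p 1| ≤ r / 8 := by
      rw [abs_le]; constructor <;> simp [e] <;> linarith [hy.1, hy.2]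
    linarith
  have hWΩ : W ⊆ Ω := fun x hx => by
    simpa using hin _ (Ioo_subset_Icc_self hx.1) _ (Ioo_subset_Icc_self hx.2)
  refine ⟨W, hWo, ?_, (2 * ENNReal.ofReal (r / 4) + 2 * ENNReal.ofReal (r / 4)) *
    ENNReal.ofReal (r / 4), by finiteness, fun f hf => ?_⟩
  · constructor <;> constructor <;> simp [e] <;> linarith
  obtain ⟨m, hm, -⟩ := exists_column_estimates (e := e) hΩ hf (φ := fun _ => p 1 - r / 8)
    (c := p 1 - r / 8) (l := r / 4) (α := p 0 - r / 8) (η := r / 4) (by positivity)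
    (fun _ _ => le_rfl) (fun _ _ => by linarith)
    (fun s hs y hy => hin s hs y (Ioc_subset_Icc_self hy))
  refine ⟨m, ?_, ?_⟩
  · refine (setLIntegral_le_columns e (measurable_ofReal_sq_sub hf measurable_const)
      (hWo.inter hΩ).measurableSet (I := Icc (p 0 - r / 8) (p 0 - r / 8 + r / 4)) measurableSet_Icc
      (J := fun _ => Icc (p 1 - r / 8) (p 1 - r / 8 + r / 4)) (fun _ => measurableSet_Icc)
      fun x hx => ⟨Ioo_subset_Icc_self hx.1.1, Ioo_subset_Icc_self hx.1.2⟩).trans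
      (hm.trans ?_)
    gcongr
    rw [← lintegral_columnEnergy (e := e) hΩ hf]
    exact setLIntegral_le_lintegral _ _
  · have : W ∩ frontier Ω = ∅ := by
      rw [hΩ.frontier_eq]
      ext x
      simpa using fun hx _ => hWΩ hx
    simp [this]

theorem exists_poincareOn_of_mem_frontier (hΩ : IsLipschitzDomain Ω) {p : E2}
    (hp : p ∈ frontier Ω) : ∃ W, IsOpen W ∧ p ∈ W ∧ PoincareOn Ω W := by
  obtain ⟨e, K, φ, a, δ, h, hpb, -⟩ := exists_isChart hΩ hp univ_mem
  set c : ℝ≥0∞ := 2 * ENNReal.ofReal ((2 * K + 1) * δ) + 2 * ENNReal.ofReal δ with hc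
  refine ⟨_, isOpen_chartBox .., hpb,
    c * ENNReal.ofReal ((2 * K + 1) * δ) + ((1 + K : ℝ≥0) : ℝ≥0∞) * c, by finiteness,
    fun f hf => ?_⟩
  obtain ⟨m, hm, hm'⟩ := h.column_estimates hΩ.1 hf h.pos le_rfl le_rfl
  have hE : ∫⁻ s in Icc a (a + δ), columnEnergy Ω e f s ≤ dirEnergy Ω f := by
    rw [← lintegral_columnEnergy (e := e) hΩ.1 hf]
    exact setLIntegral_le_lintegral _ _
  refine ⟨m, ?_, ?_⟩
  · refine (setLIntegral_le_columns e (measurable_ofReal_sq_sub hf measurable_const)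
      ((isOpen_chartBox ..).inter hΩ.1).measurableSet (I := Icc a (a + δ)) measurableSet_Icc
      (J := fun s => Icc (φ s) (φ a + K * δ + δ)) (fun _ => measurableSet_Icc)
      fun x hx => ⟨Ioo_subset_Icc_self hx.1.1, ((h.mem_iff_of_mem hx.1).1 hx.2).le, ?_⟩).trans
      (hm.trans ?_)
    · linarith [hx.1.2.2]
    · exact mul_le_mul' (le_add_right le_rfl) hE
  · rw [inter_comm]
    refine (setLIntegral_hausdorff_le (lipschitzWith_graph e h.lip)
      (h.frontier_inter_subset hΩ.1) (measurable_ofReal_sq_sub hf measurable_const)).trans ?_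
    rw [add_mul, mul_assoc _ c]
    refine le_add_left ?_
    gcongr
    exact (lintegral_mono_set Ioo_subset_Icc_self).trans (hm'.trans (by gcongr))

/-- Poincaré-type trace inequality: boundary values are close to a constant. -/
theorem IsLipschitzDomain.exists_trace_poincare (hΩ : IsLipschitzDomain Ω) :
    ∃ C : ℝ≥0∞, C ≠ ∞ ∧ ∀ f : E2 → ℝ, ContDiff ℝ (⊤ : ℕ∞) f → ∃ m : ℝ,
      ∫⁻ x in frontier Ω, ENNReal.ofReal ((f x - m) ^ 2) ∂μH[1] ≤ C * dirEnergy Ω f := by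
  have hloc : ∀ p ∈ closure Ω, ∃ W, IsOpen W ∧ p ∈ W ∧ PoincareOn Ω W := fun p hp => by
    by_cases h : p ∈ Ω
    · exact exists_poincareOn_of_mem hΩ.1 h
    · exact exists_poincareOn_of_mem_frontier hΩ (by rw [hΩ.1.frontier_eq]; exact ⟨hp, h⟩)
  have hloc' : ∀ p, ∃ (W : Set E2) (C : ℝ≥0∞) (m : (E2 → ℝ) → ℝ), p ∈ closure Ω → IsOpen W ∧
      p ∈ W ∧ C ≠ ∞ ∧ ∀ f : E2 → ℝ, ContDiff ℝ (⊤ : ℕ∞) f →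
      ∫⁻ x in W ∩ Ω, ENNReal.ofReal ((f x - m f) ^ 2) ≤ C * dirEnergy Ω f ∧
      ∫⁻ x in W ∩ frontier Ω, ENNReal.ofReal ((f x - m f) ^ 2) ∂μH[1] ≤ C * dirEnergy Ω f := by
    intro p
    by_cases hp : p ∈ closure Ω
    · obtain ⟨W, hW, hpW, C, hC, h⟩ := hloc p hp
      choose! m hm using h
      exact ⟨W, C, m, fun _ => ⟨hW, hpW, hC, hm⟩⟩
    · exact ⟨∅, 0, 0, fun h => absurd h hp⟩
  choose W C m hWm using hloc'
  let P : E2 → E2 → Prop := fun p q => ∃ D : ℝ≥0∞, D ≠ ∞ ∧ ∀ f : E2 → ℝ,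
    ContDiff ℝ (⊤ : ℕ∞) f → ENNReal.ofReal ((m p f - m q f) ^ 2) ≤ D * dirEnergy Ω f
  have hP : ∀ p ∈ closure Ω, ∀ q ∈ closure Ω, P p q := by
    intro p hp q hq
    refine hΩ.2.1.isPreconnected.closure.induction₂ P (fun x hx => ?_) (fun x y z _ _ _ h h' => ?_)
      (fun x y _ _ h => ?_) hp hq
    · obtain ⟨hWo, hxW, hC, hf⟩ := hWm x hx
      filter_upwards [mem_nhdsWithin_of_mem_nhds (hWo.mem_nhds hxW), self_mem_nhdsWithin]
        with y hyW hy
      obtain ⟨hWo', hyW', hC', hf'⟩ := hWm y hy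
      have hO : IsOpen (W x ∩ W y) := hWo.inter hWo'
      obtain ⟨z, hz, hzΩ⟩ := mem_closure_iff.1 hy _ hO ⟨hyW, hyW'⟩
      set A := W x ∩ W y ∩ Ω
      have hA : volume A ≠ 0 := ((hO.inter hΩ.1).measure_pos volume ⟨z, hz, hzΩ⟩).ne'
      have hA' : volume A ≠ ∞ :=
        ((measure_mono inter_subset_right).trans_lt hΩ.2.2.1.measure_lt_top).ne
      refine ⟨(2 * C x + 2 * C y) / volume A, ENNReal.div_ne_top (by finiteness) hA,
        fun f hfs => ?_⟩
      rw [ENNReal.mul_comm_div, ← mul_div_assoc, ENNReal.le_div_iff_mul_le (.inl hA) (.inl hA')]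
      have := lintegral_ofReal_sq_sub_triangle (μ := volume.restrict A)
        hfs.continuous.measurable (m x f) (m y f)
      rw [Measure.restrict_apply_univ] at this
      refine this.trans ?_
      rw [add_mul, mul_assoc, mul_assoc]
      gcongr
      · exact (lintegral_mono_set (show A ⊆ W x ∩ Ω from fun w hw => ⟨hw.1.1, hw.2⟩)).trans (hf f hfs).1
      · exact (lintegral_mono_set (show A ⊆ W y ∩ Ω from fun w hw => ⟨hw.1.2, hw.2⟩)).trans (hf' f hfs).1
    · obtain ⟨D, hD, h⟩ := h
      obtain ⟨D', hD', h'⟩ := h'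
      refine ⟨2 * D + 2 * D', by finiteness, fun f hfs => (ofReal_sq_sub_le _ (m y f) _).trans ?_⟩
      rw [add_mul, mul_assoc, mul_assoc]
      gcongr
      exacts [h f hfs, h' f hfs]
    · obtain ⟨D, hD, h⟩ := h
      refine ⟨D, hD, fun f hfs => ?_⟩
      rw [← neg_sub, neg_sq]
      exact h f hfs
  obtain ⟨p, hp⟩ := hΩ.2.1.nonempty.closure
  have hfin := hΩ.hausdorffMeasure_frontier_lt_top
  have key : ∃ D : ℝ≥0∞, D ≠ ∞ ∧ ∀ f : E2 → ℝ, ContDiff ℝ (⊤ : ℕ∞) f →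
      ∫⁻ x in frontier Ω ∩ frontier Ω, ENNReal.ofReal ((f x - m p f) ^ 2) ∂μH[1]
        ≤ D * dirEnergy Ω f := by
    refine hΩ.isCompact_frontier.induction_on (p := fun S => ∃ D : ℝ≥0∞, D ≠ ∞ ∧
      ∀ f : E2 → ℝ, ContDiff ℝ (⊤ : ℕ∞) f →
      ∫⁻ x in S ∩ frontier Ω, ENNReal.ofReal ((f x - m p f) ^ 2) ∂μH[1]
        ≤ D * dirEnergy Ω f) ⟨0, by simp, by simp⟩ (fun S T hST hT => ?_)
      (fun S T hS hT => ?_) fun q hq => ?_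
    · obtain ⟨D, hD, h⟩ := hT
      exact ⟨D, hD, fun f hfs => (lintegral_mono_set (by gcongr)).trans (h f hfs)⟩
    · obtain ⟨D, hD, h⟩ := hS
      obtain ⟨D', hD', h'⟩ := hT
      refine ⟨D + D', by finiteness, fun f hfs => ?_⟩
      rw [union_inter_distrib_right, add_mul]
      exact (lintegral_union_le _ _ _).trans (add_le_add (h f hfs) (h' f hfs))
    · have hq' := frontier_subset_closure hq
      obtain ⟨hWo, hqW, hC, hf⟩ := hWm q hq'
      obtain ⟨D, hD, h⟩ := hP q hq' p hp
      refine ⟨W q, mem_nhdsWithin_of_mem_nhds (hWo.mem_nhds hqW),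
        2 * C q + 2 * (D * μH[1] (frontier Ω)), by finiteness, fun f hfs => ?_⟩
      calc _ ≤ ∫⁻ x in W q ∩ frontier Ω, (2 * ENNReal.ofReal ((f x - m q f) ^ 2)
              + 2 * ENNReal.ofReal ((m q f - m p f) ^ 2)) ∂μH[1] :=
            lintegral_mono fun x => ofReal_sq_sub_le _ _ _
        _ = 2 * ∫⁻ x in W q ∩ frontier Ω, ENNReal.ofReal ((f x - m q f) ^ 2) ∂μH[1]
              + 2 * ENNReal.ofReal ((m q f - m p f) ^ 2) * μH[1] (W q ∩ frontier Ω) := by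
            rw [lintegral_add_right _ measurable_const, setLIntegral_const,
              lintegral_const_mul _ (measurable_ofReal_sq_sub hfs measurable_const)]
        _ ≤ 2 * (C q * dirEnergy Ω f)
              + 2 * (D * dirEnergy Ω f) * μH[1] (frontier Ω) := by
            gcongr
            exacts [(hf f hfs).2, h f hfs, inter_subset_right]
        _ = _ := by ring
  obtain ⟨D, hD, h⟩ := key
  exact ⟨D, hD, fun f hfs => ⟨m p f, by simpa using h f hfs⟩⟩

end Poincare

section BoundaryTopology

variable {Ω Ω₁ Ω₂ Γ ΓS Γstar₁ Γstar₂ : Set E2} {e : E2 ≃ₗᵢ[ℝ] E2} {K : ℝ≥0} {φ : ℝ → ℝ} {a δ : ℝ}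

theorem nonempty_diff_closure (h1 : IsLipschitzDomain Ω₁) (h2 : IsOpen Ω₂) (hsub : Ω₁ ⊆ Ω₂)
    (hne : Ω₁ ≠ Ω₂) : (Ω₂ \ closure Ω₁).Nonempty := by
  obtain ⟨x, hx2, hx1⟩ : ∃ x ∈ Ω₂, x ∉ Ω₁ := by
    by_contra! h
    exact hne (hsub.antisymm h)
  by_cases hxc : x ∈ closure Ω₁
  swap
  · exact ⟨x, hx2, hxc⟩
  have hxf : x ∈ frontier Ω₁ := by
    rw [h1.1.frontier_eq]
    exact ⟨hxc, hx1⟩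
  obtain ⟨e, K, φ, a, δ, h, hxb, hb⟩ := exists_isChart h1 hxf (h2.mem_nhds hx2)
  have hxφ := h.eq_of_mem_frontier h1.1 hxb hxf
  obtain ⟨y, hy, hyφ⟩ := exists_between hxb.2.1
  have hopen : IsOpen (chartBox e K φ a δ ∩ {x | e x 1 < φ (e x 0)}) :=
    (isOpen_chartBox e K φ a δ).inter
      (isOpen_lt (by fun_prop) (h.lip.continuous.comp (by fun_prop)))
  have hmem : pt e (e x 0) y ∈ chartBox e K φ a δ :=
    ⟨by simpa using hxb.1, by simpa using ⟨hy, hyφ.trans hxb.2.2⟩⟩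
  refine ⟨pt e (e x 0) y, hb hmem, fun hcl => ?_⟩
  obtain ⟨z, hz, hz1⟩ := mem_closure_iff.1 hcl _ hopen ⟨hmem, by simpa [← hxφ] using hyφ⟩
  exact lt_asymm hz.2 ((h.mem_iff_of_mem hz.1).1 hz1)

theorem IsArc.exists_curve {A : Set E2} (h : IsArc A ∨ IsLoop A) :
    ∃ γ : ℝ → E2, ContinuousOn γ (Icc 0 1) ∧ A = γ '' Icc 0 1 ∧ ∃ s ∈ Icc (0 : ℝ) 1,
      ∃ t ∈ Icc (0 : ℝ) 1, γ s ≠ γ t := by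
  rcases h with ⟨γ, hc, hi, rfl⟩ | ⟨γ, hc, hi, -, rfl⟩
  · exact ⟨γ, hc, rfl, 0, by simp, 1, by simp, fun h => by simpa using hi (by simp) (by simp) h⟩
  · exact ⟨γ, hc, rfl, 0, by simp, 1 / 2, by norm_num, fun h => by
      simpa using hi (by simp) (by norm_num) h⟩

theorem IsBoundaryPart.isCompact (h : IsBoundaryPart Γ) : IsCompact Γ := by
  obtain ⟨F, hF, rfl⟩ := h
  refine F.finite_toSet.isCompact_sUnion fun A hA => ?_
  obtain ⟨γ, hc, rfl, -⟩ := IsArc.exists_curve (hF A hA)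
  exact isCompact_Icc.image_of_continuousOn hc

theorem IsBoundaryPart.hausdorffMeasure_ball_pos (h : IsBoundaryPart Γ) {p : E2} (hp : p ∈ Γ)
    {r : ℝ} (hr : 0 < r) : 0 < μH[1] (Γ ∩ ball p r) := by
  obtain ⟨F, hF, rfl⟩ := h
  obtain ⟨A, hA, hpA⟩ := hp
  obtain ⟨γ, hc, rfl, s, hs, t, ht, hst⟩ := IsArc.exists_curve (hF A hA)
  obtain ⟨t₁, ht₁, hne⟩ : ∃ t₁ ∈ Icc (0 : ℝ) 1, γ t₁ ≠ p := by
    by_cases h : γ s = p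
    · exact ⟨t, ht, fun h' => hst (h.trans h'.symm)⟩
    · exact ⟨s, hs, h⟩
  obtain ⟨t₀, ht₀, rfl⟩ := hpA
  have hd : 0 < dist (γ t₁) (γ t₀) := dist_pos.2 hne
  have hIVT := isPreconnected_Icc.intermediate_value ht₀ ht₁
    (f := fun τ => dist (γ τ) (γ t₀)) (by fun_prop)
  simp only [dist_self] at hIVT
  have hsub : Ico 0 (min (dist (γ t₁) (γ t₀)) r)
      ⊆ (fun x => dist x (γ t₀)) '' (⋃₀ ↑F ∩ ball (γ t₀) r) := by
    intro d hd
    obtain ⟨τ, hτ, rfl⟩ := hIVT ⟨hd.1, (hd.2.trans_le (min_le_left _ _)).le⟩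
    exact ⟨γ τ, ⟨⟨_, hA, mem_image_of_mem _ hτ⟩, hd.2.trans_le (min_le_right _ _)⟩, rfl⟩
  have h1 := (LipschitzWith.dist_left (γ t₀)).lipschitzOnWith
    (s := ⋃₀ ↑F ∩ ball (γ t₀) r) |>.hausdorffMeasure_image_le (d := 1) zero_le_one
  have h2 := (measure_mono hsub).trans h1
  rw [hausdorffMeasure_real, Real.volume_Ico] at h2
  refine lt_of_lt_of_le ?_ (h2.trans_eq (by simp))
  simp [hd, hr]

theorem IsBoundaryPart.infinite_inter_ball (h : IsBoundaryPart Γ) {p : E2} (hp : p ∈ Γ)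
    {r : ℝ} (hr : 0 < r) : (Γ ∩ ball p r).Infinite := fun hfin => by
  have : NullSingletonClass (μH[1] : Measure E2) := Measure.nullSingletonClass_hausdorff E2 one_pos
  exact (h.hausdorffMeasure_ball_pos hp hr).ne' (hfin.measure_zero _)

theorem SteklovDecomp.subset_frontier (h : SteklovDecomp Ω ΓS Γ) : ΓS ⊆ frontier Ω :=
  h.union_eq ▸ subset_union_left

theorem SteklovDecomp.star_subset_frontier (h : SteklovDecomp Ω ΓS Γ) : Γ ⊆ frontier Ω :=
  h.union_eq ▸ subset_union_right

theorem SteklovDecomp.infinite_diff (h : SteklovDecomp Ω ΓS Γ) : (ΓS \ Γ).Infinite := by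
  obtain ⟨p, hp⟩ := h.nonemptyS
  have := (h.partS.infinite_inter_ball hp one_pos).mono inter_subset_left
  rw [← sdiff_self_inter]
  exact this.sdiff h.inter_finite

theorem IsChart.isPreconnected_inter (h : IsChart Ω e K φ a δ) :
    IsPreconnected (Ω ∩ chartBox e K φ a δ) := by
  set t := φ a + (K + 1) * δ with ht
  have hδ := h.pos
  have hφ : ∀ s ∈ Ioo a (a + δ), φ a - (K + 1) * δ < φ s ∧ φ s < t := fun s hs => by
    have := h.lip.abs_sub_le (s := s) (t := a) (d := δ)
      (by rw [abs_le]; constructor <;> linarith [hs.1, hs.2])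
    rw [abs_le] at this
    constructor <;> linarith
  have himg : Ω ∩ chartBox e K φ a δ
      = (fun z : ℝ × ℝ => pt e z.1 (φ z.1 + z.2 * (t - φ z.1))) ''
        (Ioo a (a + δ) ×ˢ Ioo (0 : ℝ) 1) := by
    ext x
    constructor
    · rintro ⟨hx, hxb⟩
      have h1 := (h.mem_iff_of_mem hxb).1 hx
      have h2 := (hφ _ hxb.1).2
      refine ⟨(e x 0, (e x 1 - φ (e x 0)) / (t - φ (e x 0))), ⟨hxb.1, ?_, ?_⟩, ?_⟩
      · exact div_pos (by linarith) (by linarith)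
      · rw [div_lt_one (by linarith)]
        linarith [hxb.2.2]
      · simp only
        rw [div_mul_cancel₀ _ (by linarith), add_sub_cancel, pt_apply]
    · rintro ⟨⟨s, u⟩, ⟨hs, hu⟩, rfl⟩
      have h1 := hφ s hs
      have h3 : 0 < u * (t - φ s) := mul_pos hu.1 (by linarith)
      have h4 : u * (t - φ s) < t - φ s := mul_lt_of_lt_one_left (by linarith) hu.2
      have hb : pt e s (φ s + u * (t - φ s)) ∈ chartBox e K φ a δ := by
        refine ⟨by simpa using hs, ?_⟩
        simp only [apply_pt_one]
        constructor <;> linarith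
      exact ⟨(h.mem_iff_of_mem hb).2 (by simpa using h3), hb⟩
  rw [himg]
  refine IsPreconnected.image (isPreconnected_Ioo.prod isPreconnected_Ioo) _
    (Continuous.continuousOn ?_)
  have := h.lip.continuous
  exact (continuous_pt e).comp (f := fun z : ℝ × ℝ => (z.1, φ z.1 + z.2 * (t - φ z.1)))
    (by fun_prop)

theorem exists_open_inter_subset (h2 : IsLipschitzDomain Ω₂) (hΩ₁ : IsOpen Ω₁) (hsub : Ω₁ ⊆ Ω₂)
    {p : E2} (hp1 : p ∈ frontier Ω₁) (hp2 : p ∈ frontier Ω₂) {W : Set E2} (hW : W ∈ 𝓝 p)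
    (hWf : W ∩ frontier Ω₁ ⊆ frontier Ω₂) :
    ∃ O ⊆ W, IsOpen O ∧ p ∈ O ∧ Ω₂ ∩ O ⊆ Ω₁ := by
  obtain ⟨e, K, φ, a, δ, h, hpb, hb⟩ := exists_isChart h2 hp2 hW
  refine ⟨_, hb, isOpen_chartBox .., hpb, ?_⟩
  have hpre := h.isPreconnected_inter
  refine hpre.subset_left_of_subset_union hΩ₁ (isClosed_closure (s := Ω₁)).isOpen_compl
    (disjoint_compl_right.mono_left subset_closure) (fun x hx => ?_) ?_
  · by_contra hcon
    rw [mem_union, not_or, notMem_compl_iff] at hcon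
    have : x ∈ frontier Ω₁ := by
      rw [hΩ₁.frontier_eq]
      exact ⟨hcon.2, hcon.1⟩
    have h3 := hWf ⟨hb hx.2, this⟩
    rw [h2.1.frontier_eq] at h3
    exact h3.2 hx.1
  · obtain ⟨x, hx, hx1⟩ := mem_closure_iff.1 (frontier_subset_closure hp1) _
      (isOpen_chartBox e K φ a δ) hpb
    exact ⟨x, ⟨hsub hx1, hx⟩, hx1⟩

/-- Away from the free part of the boundary of the smaller domain, its closure touches neither
the rest of the larger domain nor the free part of the boundary of the larger domain. -/
theorem disjoint_closure_diff (h1 : IsLipschitzDomain Ω₁) (h2 : IsLipschitzDomain Ω₂)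
    (hsub : Ω₁ ⊆ Ω₂) (hd1 : SteklovDecomp Ω₁ ΓS Γstar₁) (hd2 : SteklovDecomp Ω₂ ΓS Γstar₂) :
    Disjoint (closure Ω₁ \ Γstar₁) (closure (Ω₂ \ Ω₁) ∪ Γstar₂) := by
  refine Set.disjoint_left.2 fun p ⟨hp, hpstar⟩ hpL => ?_
  by_cases hpΩ : p ∈ Ω₁
  · rcases hpL with hpL | hpL
    · obtain ⟨x, hx, hx'⟩ := mem_closure_iff.1 hpL _ h1.1 hpΩ
      exact hx'.2 hx
    · have := hd2.star_subset_frontier hpL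
      rw [h2.1.frontier_eq] at this
      exact this.2 (hsub hpΩ)
  have hpf : p ∈ frontier Ω₁ := by
    rw [h1.1.frontier_eq]
    exact ⟨hp, hpΩ⟩
  have hpS : p ∈ ΓS := (hd1.union_eq ▸ hpf : p ∈ ΓS ∪ Γstar₁).resolve_right hpstar
  have hW : Γstar₁ᶜ ∈ 𝓝 p := hd1.partStar.isCompact.isClosed.isOpen_compl.mem_nhds hpstar
  have hWS : Γstar₁ᶜ ∩ frontier Ω₁ ⊆ ΓS := fun x hx =>
    (hd1.union_eq ▸ hx.2 : x ∈ ΓS ∪ Γstar₁).resolve_right hx.1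
  obtain ⟨O, hOW, hO, hpO, hOΩ⟩ := exists_open_inter_subset h2 h1.1 hsub hpf
    (hd2.subset_frontier hpS) hW (hWS.trans hd2.subset_frontier)
  rcases hpL with hpL | hpL
  · obtain ⟨x, hx, hx'⟩ := mem_closure_iff.1 hpL _ hO hpO
    exact hx'.2 (hOΩ ⟨hx'.1, hx⟩)
  · obtain ⟨r, hr, hball⟩ := Metric.isOpen_iff.1 hO p hpO
    refine hd2.partStar.infinite_inter_ball hpL hr (hd2.inter_finite.subset fun x hx => ⟨?_, hx.1⟩)
    refine hWS ⟨hOW (hball hx.2), ?_⟩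
    have hxf := hd2.star_subset_frontier hx.1
    rw [h2.1.frontier_eq] at hxf
    rw [h1.1.frontier_eq]
    refine ⟨mem_closure_iff.2 fun N hN hxN => ?_, fun h => hxf.2 (hsub h)⟩
    obtain ⟨y, hy, hy2⟩ := mem_closure_iff.1 hxf.1 _ (hN.inter hO) ⟨hxN, hball hx.2⟩
    exact ⟨y, hy.1, hOΩ ⟨hy2, hy.2⟩⟩

theorem exists_smooth_cutoff {A B : Set E2} (hA : IsClosed A) (hB : IsClosed B)
    (hAB : Disjoint A B) : ∃ χ : E2 → ℝ, ContDiff ℝ (⊤ : ℕ∞) χ ∧ EqOn χ 1 A ∧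
      ∃ O, IsOpen O ∧ B ⊆ O ∧ EqOn χ 0 O := by
  obtain ⟨O, hO, hBO, hOA⟩ := normal_exists_closure_subset hB hA.isOpen_compl
    (subset_compl_iff_disjoint_left.2 hAB)
  obtain ⟨χ, h0, h1, -⟩ := exists_contMDiffMap_zero_one_of_isClosed (n := (⊤ : ℕ∞))
    (modelWithCornersSelf ℝ E2) isClosed_closure hA (subset_compl_iff_disjoint_right.1 hOA)
  exact ⟨χ, χ.contMDiff.contDiff, h1, O, hO, hBO, h0.mono subset_closure⟩

end BoundaryTopology

section FormDomain

/-- A bounded Lipschitz domain together with the Steklov part of its boundary. -/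
structure IsSteklovPair (Ω Γ : Set E2) : Prop where
  lip : IsLipschitzDomain Ω
  part : IsBoundaryPart Γ
  nonempty : Γ.Nonempty
  subset : Γ ⊆ frontier Ω

variable {Ω Γ : Set E2}

theorem IsSteklovPair.compact (h : IsSteklovPair Ω Γ) : IsCompact Γ :=
  h.part.isCompact

theorem IsSteklovPair.measure_lt_top (h : IsSteklovPair Ω Γ) : μH[1] Γ < ∞ :=
  (measure_mono h.subset).trans_lt h.lip.hausdorffMeasure_frontier_lt_top

theorem IsSteklovPair.subset_closure (h : IsSteklovPair Ω Γ) : Γ ⊆ closure Ω :=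
  h.subset.trans frontier_subset_closure

def smoothFunctions : Submodule ℝ (E2 → ℝ) where
  carrier := {f | ContDiff ℝ (⊤ : ℕ∞) f}
  add_mem' := fun {f g} (hf : ContDiff ℝ (⊤ : ℕ∞) f) (hg : ContDiff ℝ (⊤ : ℕ∞) g) => hf.add hg
  zero_mem' := contDiff_zero_fun (𝕜 := ℝ) (E := E2) (F := ℝ) (n := (⊤ : ℕ∞))
  smul_mem' := fun c f (hf : ContDiff ℝ (⊤ : ℕ∞) f) => hf.const_smul c

theorem contDiff_coe (f : smoothFunctions) : ContDiff ℝ (⊤ : ℕ∞) (f : E2 → ℝ) := f.2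

theorem differentiable_of_smooth (f : smoothFunctions) : Differentiable ℝ (f : E2 → ℝ) :=
  (contDiff_coe f).differentiable (by simp)

theorem continuous_gradient (f : smoothFunctions) : Continuous (gradient (f : E2 → ℝ)) :=
  (InnerProductSpace.toDual ℝ E2).symm.continuous.comp ((contDiff_coe f).continuous_fderiv (by simp))

theorem norm_gradient (f : E2 → ℝ) (x : E2) : ‖gradient f x‖ = ‖fderiv ℝ f x‖ :=
  (InnerProductSpace.toDual ℝ E2).symm.norm_map _

theorem memLp_gradient (h : IsLipschitzDomain Ω) (f : smoothFunctions) :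
    MemLp (Ω.indicator (gradient (f : E2 → ℝ))) 2 volume := by
  rw [memLp_indicator_iff_restrict h.1.measurableSet]
  have : IsFiniteMeasure (volume.restrict Ω) :=
    ⟨by rw [Measure.restrict_apply_univ]; exact h.2.2.1.measure_lt_top⟩
  obtain ⟨C, hC⟩ := h.2.2.1.isCompact_closure.exists_bound_of_continuousOn
    (continuous_gradient f).continuousOn
  exact MemLp.of_bound (continuous_gradient f).aestronglyMeasurable C
    (ae_restrict_of_forall_mem h.1.measurableSet fun x hx => hC x (subset_closure hx))

theorem memLp_trace (h : IsSteklovPair Ω Γ) {f : E2 → ℝ} (hf : Continuous f) :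
    MemLp f 2 (μH[1].restrict Γ) := by
  have : IsFiniteMeasure ((μH[1] : Measure E2).restrict Γ) :=
    ⟨by rw [Measure.restrict_apply_univ]; exact h.measure_lt_top⟩
  obtain ⟨C, hC⟩ := h.compact.exists_bound_of_continuousOn hf.continuousOn
  exact MemLp.of_bound hf.aestronglyMeasurable C
    (ae_restrict_of_forall_mem h.compact.measurableSet hC)

/-- Pairs of a square-integrable vector field and a square-integrable boundary function. -/
abbrev EnergySpace (Γ : Set E2) : Type :=
  WithLp 2 (Lp E2 2 (volume : Measure E2) × Lp ℝ 2 ((μH[1] : Measure E2).restrict Γ))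

theorem ofReal_norm_toLp_sq {α E : Type*} [MeasurableSpace α] {μ : Measure α}
    [NormedAddCommGroup E] {u : α → E} (hu : MemLp u 2 μ) :
    ENNReal.ofReal (‖hu.toLp u‖ ^ 2) = ∫⁻ x, ‖u x‖ₑ ^ 2 ∂μ := by
  rw [Lp.norm_toLp, ENNReal.ofReal_pow ENNReal.toReal_nonneg, ENNReal.ofReal_toReal hu.2.ne]
  have := eLpNorm_nnreal_pow_eq_lintegral (f := u) (μ := μ) (p := 2) (by simp)
  simpa using this

/-- A smooth function, as the pair of its gradient on `Ω` and its trace on `Γ`. -/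
def embed (h : IsSteklovPair Ω Γ) : smoothFunctions →ₗ[ℝ] EnergySpace Γ where
  toFun f := WithLp.toLp 2 ((memLp_gradient h.lip f).toLp _, (memLp_trace h (contDiff_coe f).continuous).toLp _)
  map_add' f g := by
    have h1 : Ω.indicator (gradient ((f + g : smoothFunctions) : E2 → ℝ)) =
        Ω.indicator (gradient (f : E2 → ℝ)) + Ω.indicator (gradient (g : E2 → ℝ)) := by
      rw [← indicator_add']
      congr 1
      funext x
      simp only [gradient, Submodule.coe_add, Pi.add_apply]
      rw [fderiv_add (differentiable_of_smooth f x) (differentiable_of_smooth g x), map_add]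
    rw [← WithLp.toLp_add, Prod.mk_add_mk, ← MemLp.toLp_add, ← MemLp.toLp_add]
    congr 3
  map_smul' c f := by
    have h1 : Ω.indicator (gradient ((c • f : smoothFunctions) : E2 → ℝ)) =
        c • Ω.indicator (gradient (f : E2 → ℝ)) := by
      funext x
      by_cases hx : x ∈ Ω
      swap
      · simp [hx]
      simp only [indicator_of_mem hx, Pi.smul_apply, gradient, Submodule.coe_smul]
      rw [fderiv_const_smul (differentiable_of_smooth f x)]
      simp
    rw [RingHom.id_apply, ← WithLp.toLp_smul, Prod.smul_mk, ← MemLp.toLp_const_smul,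
      ← MemLp.toLp_const_smul]
    congr 3

theorem embed_fst (h : IsSteklovPair Ω Γ) (f : smoothFunctions) :
    (embed h f).fst = (memLp_gradient h.lip f).toLp _ := rfl

theorem embed_snd (h : IsSteklovPair Ω Γ) (f : smoothFunctions) :
    (embed h f).snd = (memLp_trace h (contDiff_coe f).continuous).toLp _ := rfl

theorem dirEnergy_eq (h : IsSteklovPair Ω Γ) (f : smoothFunctions) :
    dirEnergy Ω f = ENNReal.ofReal (‖(embed h f).fst‖ ^ 2) := by
  rw [embed_fst, ofReal_norm_toLp_sq, dirEnergy, ← lintegral_indicator h.lip.1.measurableSet]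
  refine lintegral_congr fun x => ?_
  by_cases hx : x ∈ Ω
  · simp only [indicator_of_mem hx]
    rw [← enorm_eq_nnnorm, ← ofReal_norm, ← ofReal_norm, norm_gradient]
  · simp [indicator_of_notMem hx]

theorem bdryInt_eq (h : IsSteklovPair Ω Γ) (f : smoothFunctions) :
    bdryInt Γ (fun _ => 1) f = ENNReal.ofReal (‖(embed h f).snd‖ ^ 2) := by
  rw [embed_snd, ofReal_norm_toLp_sq, bdryInt]
  refine lintegral_congr fun x => ?_
  rw [one_mul, ← ofReal_norm, ← ENNReal.ofReal_pow (norm_nonneg _), Real.norm_eq_abs, sq_abs]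

theorem energySpace_norm_sq (z : EnergySpace Γ) : ‖z‖ ^ 2 = ‖z.fst‖ ^ 2 + ‖z.snd‖ ^ 2 :=
  WithLp.prod_norm_sq_eq_of_L2 z

def gradPart (Γ : Set E2) : EnergySpace Γ →L[ℝ] Lp E2 2 (volume : Measure E2) :=
  WithLp.fstL 2 ℝ _ _

def tracePart (Γ : Set E2) : EnergySpace Γ →L[ℝ] Lp ℝ 2 ((μH[1] : Measure E2).restrict Γ) :=
  WithLp.sndL 2 ℝ _ _

theorem tracePart_apply (z : EnergySpace Γ) : tracePart Γ z = z.snd := rfl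

end FormDomain

section TraceOperator

variable {Ω Γ : Set E2}

/-- The completion of `X` in the energy norm. -/
abbrev formDomain (h : IsSteklovPair Ω Γ) (X : Submodule ℝ smoothFunctions) :
    Submodule ℝ (EnergySpace Γ) :=
  (X.map (embed h)).topologicalClosure

/-- The boundary trace on the completion of `X`. -/
def traceOp (h : IsSteklovPair Ω Γ) (X : Submodule ℝ smoothFunctions) :
    formDomain h X →L[ℝ] Lp ℝ 2 ((μH[1] : Measure E2).restrict Γ) :=
  (tracePart Γ).comp (formDomain h X).subtypeL

theorem energySpace_norm_snd_le (z : EnergySpace Γ) : ‖z.snd‖ ≤ ‖z‖ :=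
  le_of_sq_le_sq (by rw [energySpace_norm_sq]; nlinarith [sq_nonneg ‖z.fst‖]) (norm_nonneg _)

theorem energySpace_norm_fst_le (z : EnergySpace Γ) : ‖z.fst‖ ≤ ‖z‖ :=
  le_of_sq_le_sq (by rw [energySpace_norm_sq]; nlinarith [sq_nonneg ‖z.snd‖]) (norm_nonneg _)

theorem forall_mem_formDomain (h : IsSteklovPair Ω Γ) (X : Submodule ℝ smoothFunctions)
    {p : EnergySpace Γ → Prop} (hp : IsClosed {z | p z}) (hX : ∀ f ∈ X, p (embed h f)) :
    ∀ z ∈ formDomain h X, p z := fun z hz => by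
  have hz' : z ∈ closure ((X.map (embed h) : Submodule ℝ (EnergySpace Γ)) : Set (EnergySpace Γ)) :=
    hz
  exact closure_minimal (by rintro _ ⟨f, hf, rfl⟩; exact hX f hf) hp hz'

theorem memLp_label (h : IsSteklovPair Ω Γ) {N : ℕ} {label : E2 → Fin N} (hl : Measurable label)
    (m : Fin N → ℝ) : MemLp (fun x => m (label x)) 2 ((μH[1] : Measure E2).restrict Γ) := by
  have : IsFiniteMeasure ((μH[1] : Measure E2).restrict Γ) :=
    ⟨by rw [Measure.restrict_apply_univ]; exact h.measure_lt_top⟩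
  exact MemLp.of_bound ((measurable_of_finite m).comp hl).aestronglyMeasurable ‖m‖
    (ae_of_all _ fun x => norm_le_pi_norm m _)

def labelMap (h : IsSteklovPair Ω Γ) {N : ℕ} {label : E2 → Fin N} (hl : Measurable label) :
    (Fin N → ℝ) →ₗ[ℝ] Lp ℝ 2 ((μH[1] : Measure E2).restrict Γ) where
  toFun m := (memLp_label h hl m).toLp _
  map_add' m m' := by rw [← MemLp.toLp_add]; rfl
  map_smul' c m := by rw [RingHom.id_apply, ← MemLp.toLp_const_smul]; rfl

theorem norm_snd_sub_starProjection_le (h : IsSteklovPair Ω Γ) (X : Submodule ℝ smoothFunctions)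
    {N : ℕ} {label : E2 → Fin N} (hl : Measurable label) {c : ℝ} (hc : 0 ≤ c)
    (hf : ∀ f : E2 → ℝ, ContDiff ℝ (⊤ : ℕ∞) f → ∃ m : Fin N → ℝ,
      ∫⁻ x in Γ, ENNReal.ofReal ((f x - m (label x)) ^ 2) ∂μH[1]
        ≤ ENNReal.ofReal (c ^ 2) * dirEnergy Ω f) :
    ∀ z ∈ formDomain h X,
      ‖z.snd - (LinearMap.range (labelMap h hl)).starProjection z.snd‖ ≤ c * ‖z.fst‖ := by
  refine forall_mem_formDomain h X ?_ fun f _ => ?_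
  · have h1 : Continuous fun z : EnergySpace Γ => z.snd := (tracePart Γ).continuous
    have h2 : Continuous fun z : EnergySpace Γ => z.fst := (gradPart Γ).continuous
    exact isClosed_le (by fun_prop) (by fun_prop)
  · obtain ⟨m, hm⟩ := hf f (contDiff_coe f)
    rw [Submodule.starProjection_minimal]
    refine (ciInf_le ⟨0, ?_⟩ (⟨labelMap h hl m, m, rfl⟩ : LinearMap.range (labelMap h hl))).trans ?_
    · rintro _ ⟨_, rfl⟩
      exact norm_nonneg _
    refine le_of_sq_le_sq ?_ (by positivity)
    rw [mul_pow]
    refine (ENNReal.ofReal_le_ofReal_iff (by positivity)).1 ?_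
    rw [ENNReal.ofReal_mul (by positivity), ← dirEnergy_eq]
    refine le_trans (le_of_eq ?_) hm
    have h3 : (embed h f).snd - labelMap h hl m =
        ((memLp_trace h (contDiff_coe f).continuous).sub (memLp_label h hl m)).toLp _ :=
      (MemLp.toLp_sub (memLp_trace h (contDiff_coe f).continuous) (memLp_label h hl m)).symm
    simp only [h3]
    rw [ofReal_norm_toLp_sq]
    refine lintegral_congr fun x => ?_
    rw [← ofReal_norm, ← ENNReal.ofReal_pow (norm_nonneg _), Real.norm_eq_abs, sq_abs]
    rfl

theorem isCompactOperator_of_forall_approx {E F : Type*} [NormedAddCommGroup E] [NormedSpace ℝ E]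
    [NormedAddCommGroup F] [NormedSpace ℝ F] [CompleteSpace F] (T : E →L[ℝ] F)
    (h : ∀ c : ℝ, 0 < c → ∃ K : E →L[ℝ] F, IsCompactOperator K ∧ ∀ x, ‖T x - K x‖ ≤ c * ‖x‖) :
    IsCompactOperator T := by
  have hc : ∀ n : ℕ, (0 : ℝ) < 1 / ((n : ℝ) + 1) := fun n => by positivity
  choose K hK hKn using fun n : ℕ => h _ (hc n)
  refine isCompactOperator_of_tendsto (F := K) (l := atTop) ?_ (Eventually.of_forall hK)
  refine tendsto_iff_norm_sub_tendsto_zero.2 (squeeze_zero (fun _ => norm_nonneg _) (fun n => ?_)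
    tendsto_one_div_add_atTop_nhds_zero_nat)
  rw [norm_sub_rev]
  exact ContinuousLinearMap.opNorm_le_bound _ (hc n).le (hKn n)

theorem isCompactOperator_traceOp (h : IsSteklovPair Ω Γ) (X : Submodule ℝ smoothFunctions) :
    IsCompactOperator (traceOp h X) := by
  refine isCompactOperator_of_forall_approx _ fun c hc => ?_
  obtain ⟨N, label, hlm, hlN, hl⟩ := h.lip.exists_label
    (ε := ENNReal.ofReal (c ^ 2)) (by simp; positivity)
  have hlm' : Measurable fun x => (⟨label x, hlN x⟩ : Fin N) := by
    refine measurable_to_countable' fun i => ?_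
    convert hlm (measurableSet_singleton (i : ℕ)) using 1
    ext x
    simp [Fin.ext_iff]
  have key := norm_snd_sub_starProjection_le h X hlm' hc.le fun f hf => by
    obtain ⟨m, hm⟩ := hl f hf
    exact ⟨fun i => m i, (lintegral_mono_set h.subset).trans hm⟩
  set F := LinearMap.range (labelMap h hlm')
  refine ⟨F.subtypeL.comp (F.orthogonalProjectionOnto.comp (traceOp h X)), ?_, fun z => ?_⟩
  · exact (isCompactOperator_of_locallyCompactSpace_dom
      (F.orthogonalProjectionOnto.comp (traceOp h X))).clm_comp F.subtypeL
  · refine (key z z.2).trans ?_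
    gcongr
    exact energySpace_norm_fst_le (z : EnergySpace Γ)

theorem exists_snd_mem_of_fst_eq_zero (h : IsSteklovPair Ω Γ) :
    ∃ F : Submodule ℝ (Lp ℝ 2 ((μH[1] : Measure E2).restrict Γ)), FiniteDimensional ℝ F ∧
      Module.finrank ℝ F ≤ 1 ∧ ∀ z ∈ formDomain h ⊤, z.fst = 0 → z.snd ∈ F := by
  obtain ⟨C, hC, hCf⟩ := h.lip.exists_trace_poincare
  have key := norm_snd_sub_starProjection_le h ⊤ (label := fun _ => (0 : Fin 1))
    measurable_const (Real.sqrt_nonneg C.toReal) fun f hf => by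
      obtain ⟨m, hm⟩ := hCf f hf
      refine ⟨fun _ => m, (lintegral_mono_set h.subset).trans (hm.trans_eq ?_)⟩
      rw [Real.sq_sqrt ENNReal.toReal_nonneg, ENNReal.ofReal_toReal hC]
  refine ⟨_, inferInstance, (LinearMap.finrank_range_le (labelMap h
    (measurable_const : Measurable fun _ : E2 => (0 : Fin 1)))).trans (by simp), fun z hz hz0 => ?_⟩
  have := key z hz
  rw [hz0, norm_zero, mul_zero, norm_le_zero_iff, sub_eq_zero] at this
  rw [this]
  exact Submodule.starProjection_apply_mem _ _

end TraceOperator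

section Admissible

variable {Ω Γ ΓD : Set E2}

theorem eqOn_zero_of_embed_snd_eq_zero (h : IsSteklovPair Ω Γ) {f : smoothFunctions}
    (hf : (embed h f).snd = 0) : EqOn (f : E2 → ℝ) 0 Γ := fun p hp => by
  have h1 : (f : E2 → ℝ) =ᵐ[(μH[1] : Measure E2).restrict Γ] 0 := by
    rw [embed_snd] at hf
    exact ((memLp_trace h (contDiff_coe f).continuous).coeFn_toLp.symm.trans
      (by rw [hf])).trans (Lp.coeFn_zero _ _ _)
  by_contra hne
  have hopen : IsOpen {x | (f : E2 → ℝ) x ≠ 0} :=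
    isOpen_ne_fun (contDiff_coe f).continuous continuous_const
  obtain ⟨r, hr, hb⟩ := Metric.isOpen_iff.1 hopen p hne
  have h2 : (μH[1] : Measure E2).restrict Γ (ball p r) = 0 :=
    measure_mono_null (fun x hx => hb hx) (ae_iff.1 h1)
  rw [Measure.restrict_apply measurableSet_ball, inter_comm] at h2
  exact (h.part.hausdorffMeasure_ball_pos hp hr).ne' h2

theorem fderiv_eq_zero_of_embed_fst_eq_zero (h : IsSteklovPair Ω Γ) {f : smoothFunctions}
    (hf : (embed h f).fst = 0) {x : E2} (hx : x ∈ Ω) : fderiv ℝ (f : E2 → ℝ) x = 0 := by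
  have h1 : Ω.indicator (gradient (f : E2 → ℝ)) =ᵐ[volume] 0 := by
    rw [embed_fst] at hf
    exact ((memLp_gradient h.lip f).coeFn_toLp.symm.trans (by rw [hf])).trans
      (Lp.coeFn_zero _ _ _)
  have h2 : gradient (f : E2 → ℝ) =ᵐ[volume.restrict Ω] 0 := by
    rw [EventuallyEq, ae_restrict_iff' h.lip.1.measurableSet]
    filter_upwards [h1] with y hy hyΩ
    rwa [indicator_of_mem hyΩ] at hy
  have h3 := Measure.eqOn_open_of_ae_eq h2 h.lip.1 (continuous_gradient f).continuousOn
    continuousOn_const hx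
  rw [← norm_eq_zero, ← norm_gradient, h3, Pi.zero_apply, norm_zero]

theorem eqOn_zero_of_embed_eq_zero (h : IsSteklovPair Ω Γ) {f : smoothFunctions}
    (hf : embed h f = 0) : EqOn (f : E2 → ℝ) 0 (closure Ω) := by
  obtain ⟨p, hp⟩ := h.nonempty
  obtain ⟨q, hq⟩ := h.lip.2.1.nonempty
  have hc : ∀ x ∈ Ω, (f : E2 → ℝ) x = (f : E2 → ℝ) q := fun x hx =>
    h.lip.1.is_const_of_fderiv_eq_zero h.lip.2.1.isPreconnected
      (differentiable_of_smooth f).differentiableOn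
      (fun y hy => fderiv_eq_zero_of_embed_fst_eq_zero h (by rw [hf]; rfl) hy) hx hq
  have hcl : EqOn (f : E2 → ℝ) (fun _ => (f : E2 → ℝ) q) (closure Ω) :=
    (show EqOn (f : E2 → ℝ) (fun _ => (f : E2 → ℝ) q) Ω from hc).closure
      (contDiff_coe f).continuous continuous_const
  have h0 := eqOn_zero_of_embed_snd_eq_zero h (f := f) (by rw [hf]; rfl) hp
  intro x hx
  rw [hcl hx, ← hcl (h.subset_closure hp), h0]
  rfl

theorem embed_congr {Ω' : Set E2} (h : IsSteklovPair Ω Γ) (h' : IsSteklovPair Ω' Γ)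
    {f g : smoothFunctions} (hΓ : EqOn (f : E2 → ℝ) g Γ)
    (hΩ : Ω.indicator (gradient (f : E2 → ℝ)) = Ω'.indicator (gradient (g : E2 → ℝ))) :
    embed h f = embed h' g := by
  have h1 : (embed h f).fst = (embed h' g).fst := by
    rw [embed_fst, embed_fst]
    congr 1
  have h2 : (embed h f).snd = (embed h' g).snd := by
    rw [embed_snd, embed_snd, MemLp.toLp_eq_toLp_iff]
    exact ae_restrict_of_forall_mem h.compact.measurableSet hΓ
  exact WithLp.ofLp_injective 2 (Prod.ext h1 h2)

theorem embed_eq_zero (h : IsSteklovPair Ω Γ) {f : smoothFunctions}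
    (hf : EqOn (f : E2 → ℝ) 0 (closure Ω)) : embed h f = 0 := by
  rw [← map_zero (embed h)]
  refine embed_congr h h (fun x hx => hf (h.subset_closure hx)) ?_
  refine indicator_congr fun x hx => ?_
  have : (f : E2 → ℝ) =ᶠ[𝓝 x] ((0 : smoothFunctions) : E2 → ℝ) := by
    filter_upwards [h.lip.1.mem_nhds hx] with y hy using hf (subset_closure hy)
  rw [gradient, gradient, this.fderiv_eq]

theorem steklovMixed_le (h : IsSteklovPair Ω Γ) {X : Submodule ℝ smoothFunctions}
    (hX : ∀ f ∈ X, ∀ᶠ x in nhdsSet ΓD, (f : E2 → ℝ) x = 0) {k : ℕ} (x : Fin (k + 1) → X)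
    (hx : LinearIndependent ℝ fun i => embed h (x i : smoothFunctions)) {m : ℝ} (hm : 0 < m)
    (hmx : ∀ z ∈ Submodule.span ℝ (range x),
      m * ‖embed h (z : smoothFunctions)‖ ^ 2 ≤ ‖(embed h (z : smoothFunctions)).snd‖ ^ 2) :
    steklovMixed Ω Γ ΓD (fun _ => 1) k ≤ ENNReal.ofReal ((1 - m) / m) := by
  set ι : X →ₗ[ℝ] (E2 → ℝ) := smoothFunctions.subtype.comp X.subtype with hι
  have hιinj : Function.Injective ι := Subtype.val_injective.comp Subtype.val_injective
  have hxi : LinearIndependent ℝ x := LinearIndependent.of_comp ((embed h).comp X.subtype) hx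
  have hV : Submodule.span ℝ (range (ι ∘ x)) = (Submodule.span ℝ (range x)).map ι := by
    rw [Submodule.map_span, range_comp]
  have hmem : ∀ f ∈ Submodule.span ℝ (range (ι ∘ x)), ∃ z ∈ Submodule.span ℝ (range x), ι z = f :=
    fun f hf => by rwa [hV] at hf
  have hfin : Module.finrank ℝ (Submodule.span ℝ (range (ι ∘ x))) = k + 1 := by
    rw [hV, ← (Submodule.equivMapOfInjective ι hιinj _).finrank_eq, finrank_span_eq_card hxi,
      Fintype.card_fin]
  have hsm : ∀ f ∈ Submodule.span ℝ (range (ι ∘ x)), ContDiff ℝ (⊤ : ℕ∞) f := fun f hf => by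
    obtain ⟨z, -, rfl⟩ := hmem f hf
    exact contDiff_coe _
  have hvan : ∀ f ∈ Submodule.span ℝ (range (ι ∘ x)), ∀ᶠ x in nhdsSet ΓD, f x = 0 :=
    fun f hf => by
    obtain ⟨z, -, rfl⟩ := hmem f hf
    exact hX _ z.2
  have hne : ∀ f ∈ Submodule.span ℝ (range (ι ∘ x)), EqOn f 0 (closure Ω) → f = 0 := by
    intro f hf hf0
    obtain ⟨z, hz, rfl⟩ := hmem f hf
    obtain ⟨c, rfl⟩ := (Submodule.mem_span_range_iff_exists_fun ℝ).1 hz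
    have h1 := embed_eq_zero h (f := ((∑ i, c i • x i : X) : smoothFunctions)) hf0
    have h2 : ∑ i, c i • embed h (x i : smoothFunctions) = 0 := by
      rw [← h1]
      simp
    have h3 := Fintype.linearIndependent_iff.1 hx c h2
    simp [h3]
  refine (iInf₂_le_of_le (Submodule.span ℝ (range (ι ∘ x))) hfin <|
    iInf₂_le_of_le hsm hvan <| iInf_le _ hne).trans ?_
  refine iSup₂_le fun f hf => iSup_le fun _ => ?_
  obtain ⟨z, hz, rfl⟩ := hmem f hf
  refine ENNReal.div_le_of_le_mul ?_
  have h1 : ι z = ((z : smoothFunctions) : E2 → ℝ) := rfl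
  have h2 := hmx z hz
  rw [energySpace_norm_sq] at h2
  have hm1 : (0 : ℝ) ≤ (1 - m) / m ∨ ‖(embed h (z : smoothFunctions)).fst‖ ^ 2 = 0 := by
    by_cases hm1 : m ≤ 1
    · exact Or.inl (div_nonneg (by linarith) hm.le)
    · right
      nlinarith [sq_nonneg ‖(embed h (z : smoothFunctions)).fst‖,
        sq_nonneg ‖(embed h (z : smoothFunctions)).snd‖]
  rw [h1, dirEnergy_eq h, bdryInt_eq h]
  rcases hm1 with hm1 | hm1
  · rw [← ENNReal.ofReal_mul hm1]
    refine ENNReal.ofReal_le_ofReal ?_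
    rw [div_mul_eq_mul_div, le_div_iff₀ hm]
    nlinarith
  · rw [hm1]
    simp

theorem exists_admissible (h : IsSteklovPair Ω Γ) {k : ℕ} {s : ℝ} (hs : 0 ≤ s)
    (hlt : steklovMixed Ω Γ ΓD (fun _ => 1) k < ENNReal.ofReal s) :
    ∃ V : Submodule ℝ smoothFunctions, Module.finrank ℝ V = k + 1 ∧
      (∀ f ∈ V, ∀ᶠ x in nhdsSet ΓD, (f : E2 → ℝ) x = 0) ∧
      Module.finrank ℝ (V.map (embed h)) = k + 1 ∧
      ∀ w ∈ V.map (embed h), 1 / (1 + s) * ‖w‖ ^ 2 ≤ ‖w.snd‖ ^ 2 := by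
  unfold steklovMixed at hlt
  simp only [iInf_lt_iff] at hlt
  obtain ⟨V, hVk, hVs, hVD, hVi, hlt⟩ := hlt
  set V' := V.comap smoothFunctions.subtype with hV'
  have hVle : V ≤ smoothFunctions := hVs
  have hfin : Module.finrank ℝ V' = k + 1 := by
    rw [← hVk]
    exact (Submodule.comapSubtypeEquivOfLe hVle).finrank_eq
  have hinj : ∀ f ∈ V', embed h f = 0 → f = 0 := fun f hf hf0 =>
    Subtype.ext (hVi f hf (eqOn_zero_of_embed_eq_zero h hf0))
  refine ⟨V', hfin, fun f hf => hVD f hf, ?_, ?_⟩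
  · rw [← hfin]
    have hi : Function.Injective ((embed h).comp V'.subtype) :=
      (injective_iff_map_eq_zero _).2 fun f hf => Subtype.ext (hinj f f.2 hf)
    rw [← LinearMap.finrank_range_of_inj hi, LinearMap.range_comp, Submodule.range_subtype]
  · rintro _ ⟨f, hf, rfl⟩
    by_cases hf0 : EqOn (f : E2 → ℝ) 0 (closure Ω)
    · rw [embed_eq_zero h hf0]
      simp
    have h1 : rayleigh Ω Γ (fun _ => 1) f ≤ ENNReal.ofReal s :=
      ((le_iSup (fun _ : ¬ EqOn (f : E2 → ℝ) 0 (closure Ω) => rayleigh Ω Γ (fun _ => 1) f)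
        hf0).trans (le_iSup₂ (f := fun (g : E2 → ℝ) (_ : g ∈ V) =>
          ⨆ _ : ¬ EqOn g 0 (closure Ω), rayleigh Ω Γ (fun _ => 1) g) (f : E2 → ℝ) hf)).trans hlt.le
    rw [rayleigh, dirEnergy_eq h, bdryInt_eq h,
      ENNReal.div_le_iff_le_mul (Or.inr ENNReal.ofReal_ne_top) (Or.inl ENNReal.ofReal_ne_top),
      ← ENNReal.ofReal_mul hs, ENNReal.ofReal_le_ofReal_iff (by positivity)] at h1
    rw [energySpace_norm_sq, div_mul_eq_mul_div, div_le_iff₀ (by linarith)]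
    nlinarith

theorem exists_pos_mul_norm_sq_le {H B : Type*} [NormedAddCommGroup H] [NormedSpace ℝ H]
    [NormedAddCommGroup B] [NormedSpace ℝ B] (T : H →L[ℝ] B) {n : ℕ} (v : Fin n → H)
    (hv : LinearIndependent ℝ fun i => T (v i)) :
    ∃ m : ℝ, 0 < m ∧ ∃ V : Submodule ℝ H, Module.finrank ℝ V = n ∧
      ∀ x ∈ V, m * ‖x‖ ^ 2 ≤ ‖T x‖ ^ 2 := by
  have hvi : LinearIndependent ℝ v := LinearIndependent.of_comp (T : H →ₗ[ℝ] B) hv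
  set V := Submodule.span ℝ (range v) with hV
  have : FiniteDimensional ℝ V := FiniteDimensional.span_of_finite ℝ (finite_range v)
  have hker : LinearMap.ker ((T : H →ₗ[ℝ] B).comp V.subtype) = ⊥ := by
    rw [LinearMap.ker_eq_bot']
    rintro ⟨x, hx⟩ hx0
    obtain ⟨c, rfl⟩ := (Submodule.mem_span_range_iff_exists_fun ℝ).1 hx
    have h2 : ∑ i, c i • T (v i) = 0 := by
      have : T (∑ i, c i • v i) = 0 := hx0
      simpa using this
    have h3 := Fintype.linearIndependent_iff.1 hv c h2
    simp [h3]
  obtain ⟨K, hK, hKa⟩ := LinearMap.exists_antilipschitzWith _ hker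
  have hK' : (0 : ℝ) < K := hK
  refine ⟨1 / (K : ℝ) ^ 2, by positivity, V, by rw [finrank_span_eq_card hvi, Fintype.card_fin],
    fun x hx => ?_⟩
  have h1 : ‖x‖ ≤ K * ‖T x‖ := by
    have := hKa.le_mul_dist ⟨x, hx⟩ 0
    simpa [dist_zero_right] using this
  rw [div_mul_eq_mul_div, div_le_iff₀ (by positivity), one_mul, mul_comm, ← mul_pow]
  exact pow_le_pow_left₀ (norm_nonneg _) h1 2

theorem exists_test_subspace (h : IsSteklovPair Ω Γ) {X : Submodule ℝ smoothFunctions}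
    {L : Set E2} (hL : IsClosed L) (hinf : (Γ \ L).Infinite)
    (hX : ∀ f : smoothFunctions, (∀ᶠ x in nhdsSet L, (f : E2 → ℝ) x = 0) → f ∈ X) (n : ℕ) :
    ∃ m : ℝ, 0 < m ∧ ∃ V : Submodule ℝ (formDomain h X), Module.finrank ℝ V = n ∧
      ∀ x ∈ V, m * ‖x‖ ^ 2 ≤ ‖traceOp h X x‖ ^ 2 := by
  set p : Fin n → E2 := fun i => hinf.natEmbedding _ i with hp
  have hpi : Function.Injective p := fun i j hij =>
    Fin.ext ((hinf.natEmbedding _).injective (Subtype.ext hij))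
  have hpm : ∀ i, p i ∈ Γ \ L := fun i => (hinf.natEmbedding _ i).2
  obtain ⟨U, hU, hUd⟩ := (finite_range p).t2_separation
  have hbump : ∀ i, ∃ f : E2 → ℝ, tsupport f ⊆ U (p i) \ L ∧ ContDiff ℝ (⊤ : ℕ∞) f ∧ f (p i) = 1 :=
    fun i => by
      obtain ⟨f, h1, -, h2, -, h3⟩ := exists_contDiff_tsupport_subset (n := (⊤ : ℕ∞))
        (((hU (p i)).2.sdiff hL).mem_nhds ⟨(hU (p i)).1, (hpm i).2⟩)
      exact ⟨f, h1, h2, h3⟩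
  choose f hfs hfc hf1 using hbump
  have hfX : ∀ i, (⟨f i, hfc i⟩ : smoothFunctions) ∈ X := fun i => by
    refine hX _ (eventually_nhdsSet_iff_exists.2
      ⟨(tsupport (f i))ᶜ, (isClosed_tsupport _).isOpen_compl, fun x hx hx' => (hfs i hx').2 hx,
        fun x hx => image_eq_zero_of_notMem_tsupport hx⟩)
  refine exists_pos_mul_norm_sq_le (traceOp h X)
    (fun i => ⟨embed h ⟨f i, hfc i⟩, subset_closure ⟨_, hfX i, rfl⟩⟩) ?_
  rw [Fintype.linearIndependent_iff]
  intro c hc j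
  have h1 : (embed h (∑ i, c i • (⟨f i, hfc i⟩ : smoothFunctions))).snd = 0 := by
    rw [← tracePart_apply, map_sum, map_sum]
    simp only [map_smul]
    exact hc
  have h2 := eqOn_zero_of_embed_snd_eq_zero h h1 (hpm j).1
  have h3 : ∀ i, i ≠ j → f i (p j) = 0 := fun i hij => by
    refine image_eq_zero_of_notMem_tsupport fun hx => ?_
    exact Set.disjoint_left.1 (hUd (mem_range_self i) (mem_range_self j) (hpi.ne hij))
      (hfs i hx).1 (hU (p j)).1
  have h4 : ((∑ i, c i • (⟨f i, hfc i⟩ : smoothFunctions) : smoothFunctions) : E2 → ℝ) (p j)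
      = ∑ i, c i * f i (p j) := by
    simp
  rw [h4, Finset.sum_eq_single j (fun i _ hij => by rw [h3 i hij, mul_zero]) (by simp), hf1,
    mul_one] at h2
  exact h2

end Admissible

section WeakEquation

variable {Ω Γ : Set E2}

theorem inner_E2 (v w : E2) : inner ℝ v w = v 0 * w 0 + v 1 * w 1 := by
  rw [PiLp.inner_apply, Fin.sum_univ_two]
  simp [mul_comm]

theorem gradient_apply (f : E2 → ℝ) (x : E2) (i : Fin 2) :
    gradient f x i = fderiv ℝ f x (stdVec i) := by
  rw [← InnerProductSpace.toDual_symm_apply (𝕜 := ℝ), EuclideanSpace.inner_single_right]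
  simp [gradient]

theorem contDiff_fderiv_apply {φ : E2 → ℝ} (hφ : ContDiff ℝ (⊤ : ℕ∞) φ) (v : E2) :
    ContDiff ℝ (⊤ : ℕ∞) fun x => fderiv ℝ φ x v :=
  (hφ.fderiv_right (by simp)).clm_apply contDiff_const

theorem integral_fderiv_mul_fderiv_comm {f φ : E2 → ℝ} (hf : ContDiff ℝ (⊤ : ℕ∞) f)
    (hφ : ContDiff ℝ (⊤ : ℕ∞) φ) (hc : HasCompactSupport φ) (v w : E2) :
    ∫ x, fderiv ℝ f x v * fderiv ℝ φ x w = ∫ x, fderiv ℝ f x w * fderiv ℝ φ x v := by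
  have hc' : ∀ w, HasCompactSupport fun x => fderiv ℝ φ x w := fun w => hc.fderiv_apply ℝ w
  have hibp : ∀ v w : E2, ∫ x, f x * fderiv ℝ (fun y => fderiv ℝ φ y w) x v =
      -∫ x, fderiv ℝ f x v * fderiv ℝ φ x w := fun v w => by
    have hg := contDiff_fderiv_apply hφ w
    refine integral_mul_fderiv_eq_neg_fderiv_mul_of_integrable ?_ ?_ ?_
      (fun x _ => hf.differentiable (by simp) x) (fun x _ => hg.differentiable (by simp) x)
    · exact ((contDiff_fderiv_apply hf v).continuous.mul
        hg.continuous).integrable_of_hasCompactSupport (hc' w).mul_left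
    · exact (hf.continuous.mul (contDiff_fderiv_apply hg v).continuous).integrable_of_hasCompactSupport
        ((hc' w).fderiv_apply ℝ v).mul_left
    · exact (hf.continuous.mul hg.continuous).integrable_of_hasCompactSupport (hc' w).mul_left
  have hsymm : ∀ x, fderiv ℝ (fun y => fderiv ℝ φ y w) x v =
      fderiv ℝ (fun y => fderiv ℝ φ y v) x w := fun x => by
    have hd : DifferentiableAt ℝ (fderiv ℝ φ) x :=
      (hφ.fderiv_right (m := (⊤ : ℕ∞)) (by simp)).differentiable (by simp) x
    have h2 : ∀ w, fderiv ℝ (fun y => fderiv ℝ φ y w) x = (fderiv ℝ (fderiv ℝ φ) x).flip w :=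
      fun w => by
        rw [fderiv_clm_apply hd (differentiableAt_const w)]
        simp
    rw [h2, h2]
    exact (hφ.contDiffAt.isSymmSndFDerivAt (by simpa using ENat.LEInfty.out)) v w
  rw [← neg_inj, ← hibp, ← hibp]
  simp_rw [hsymm]

def rotGradient (φ : E2 → ℝ) (x : E2) : E2 :=
  !₂[fderiv ℝ φ x (stdVec 1), -fderiv ℝ φ x (stdVec 0)]

theorem memLp_rotGradient {φ : E2 → ℝ} (hφ : ContDiff ℝ (⊤ : ℕ∞) φ) (hc : HasCompactSupport φ) :
    MemLp (rotGradient φ) 2 volume := by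
  have h1 : Continuous (rotGradient φ) := by
    refine (PiLp.continuous_toLp 2 _).comp (continuous_pi fun i => ?_)
    fin_cases i
    · exact (contDiff_fderiv_apply hφ _).continuous
    · exact (contDiff_fderiv_apply hφ _).continuous.neg
  refine h1.memLp_of_hasCompactSupport (hc.fderiv (𝕜 := ℝ) |>.mono' fun x hx => ?_)
  refine subset_tsupport _ fun h0 => hx ?_
  ext i
  fin_cases i <;> simp [rotGradient, h0]

theorem inner_fst_rotGradient (h : IsSteklovPair Ω Γ) (X : Submodule ℝ smoothFunctions)
    {φ : E2 → ℝ} (hφ : ContDiff ℝ (⊤ : ℕ∞) φ) (hc : HasCompactSupport φ) (hs : tsupport φ ⊆ Ω) :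
    ∀ z ∈ formDomain h X, inner ℝ z.fst ((memLp_rotGradient hφ hc).toLp _) = 0 := by
  refine forall_mem_formDomain h X ?_ fun f _ => ?_
  · have h2 : Continuous fun z : EnergySpace Γ => z.fst := (gradPart Γ).continuous
    exact isClosed_eq (h2.inner continuous_const) continuous_const
  · have hf := contDiff_coe f
    have hintg : ∀ v w : E2, Integrable fun x => fderiv ℝ (f : E2 → ℝ) x v * fderiv ℝ φ x w :=
      fun v w => ((contDiff_fderiv_apply hf v).continuous.mul
        (contDiff_fderiv_apply hφ w).continuous).integrable_of_hasCompactSupport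
          (hc.fderiv_apply ℝ w).mul_left
    have h1 : (fun x => inner ℝ ((embed h f).fst x) ((memLp_rotGradient hφ hc).toLp _ x)) =ᵐ[volume]
        fun x => fderiv ℝ (f : E2 → ℝ) x (stdVec 0) * fderiv ℝ φ x (stdVec 1) -
          fderiv ℝ (f : E2 → ℝ) x (stdVec 1) * fderiv ℝ φ x (stdVec 0) := by
      rw [embed_fst]
      filter_upwards [(memLp_gradient h.lip f).coeFn_toLp, (memLp_rotGradient hφ hc).coeFn_toLp]
        with x hx1 hx2
      rw [hx1, hx2, inner_E2]
      by_cases hx : x ∈ Ω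
      · rw [indicator_of_mem hx, gradient_apply, gradient_apply]
        simp [rotGradient]
        ring
      · have h0 : fderiv ℝ φ x = 0 := by
          by_contra hne
          exact hx (hs (support_fderiv_subset ℝ hne))
        simp [rotGradient, h0]
    rw [L2.inner_def, integral_congr_ae h1, integral_sub (hintg _ _) (hintg _ _),
      integral_fderiv_mul_fderiv_comm hf hφ hc, sub_self]

theorem inner_fst_gradient (h : IsSteklovPair Ω Γ) (u : Lp E2 2 (volume : Measure E2))
    (φ : smoothFunctions) (hs : tsupport (φ : E2 → ℝ) ⊆ Ω) :
    inner ℝ u (embed h φ).fst = ∫ x, (u x 0 * fderiv ℝ (φ : E2 → ℝ) x (stdVec 0) +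
      u x 1 * fderiv ℝ (φ : E2 → ℝ) x (stdVec 1)) := by
  rw [L2.inner_def, embed_fst]
  refine integral_congr_ae ?_
  filter_upwards [(memLp_gradient h.lip φ).coeFn_toLp] with x hx1
  rw [hx1, inner_E2]
  by_cases hx : x ∈ Ω
  · rw [indicator_of_mem hx, gradient_apply, gradient_apply]
  · have h0 : fderiv ℝ (φ : E2 → ℝ) x = 0 := by
      by_contra hne
      exact hx (hs (support_fderiv_subset ℝ hne))
    simp [h0, hx]

theorem ae_eq_zero_of_inner_eq_zero (h : IsSteklovPair Ω Γ) {X : Submodule ℝ smoothFunctions}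
    {z : EnergySpace Γ} (hz : z ∈ formDomain h X) {U : Set E2} (hU : IsOpen U) (hUne : U.Nonempty)
    (hUΩ : U ⊆ Ω) (hzU : ∀ᵐ x, x ∈ U → z.fst x = 0)
    (hdiv : ∀ φ : smoothFunctions, HasCompactSupport (φ : E2 → ℝ) → tsupport (φ : E2 → ℝ) ⊆ Ω →
      inner ℝ z.fst (embed h φ).fst = 0) :
    ∀ᵐ x, x ∈ Ω → z.fst x = 0 := by
  have hG : LocallyIntegrable z.fst := (Lp.memLp z.fst).locallyIntegrable (by norm_num)
  have hGi : ∀ i, LocallyIntegrable fun x => (z.fst x) i := fun i x => by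
    obtain ⟨s, hs, hi⟩ := hG x
    exact ⟨s, hs, ContinuousLinearMap.integrable_comp
      (EuclideanSpace.proj i : E2 →L[ℝ] ℝ) hi⟩
  set g : E2 → ℂ := fun x => ((z.fst x 0 : ℝ) : ℂ) - Complex.I * ((z.fst x 1 : ℝ) : ℂ) with hg
  have hgl : LocallyIntegrable g := by
    have hofReal : ∀ i, LocallyIntegrable fun x => ((z.fst x i : ℝ) : ℂ) := fun i x => by
      obtain ⟨s, hs, hi⟩ := hGi i x
      exact ⟨s, hs, hi.ofReal⟩
    exact (hofReal 0).sub ((hofReal 1).smul Complex.I)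
  have hw : IsWeaklyHolomorphicOn g Ω := by
    intro φ hφ hc hs
    have hintg : ∀ i v, Integrable fun x => z.fst x i * fderiv ℝ φ x v := fun i v => by
      have := (hGi i).integrable_smul_left_of_hasCompactSupport
        (contDiff_fderiv_apply hφ v).continuous (hc.fderiv_apply ℝ v)
      simpa [mul_comm] using this
    have h1 := hdiv ⟨φ, hφ⟩ hc hs
    rw [inner_fst_gradient h _ _ hs] at h1
    have h2 := inner_fst_rotGradient h X hφ hc hs z hz
    rw [L2.inner_def] at h2
    have h3 : (fun x => inner ℝ (z.fst x) ((memLp_rotGradient hφ hc).toLp _ x)) =ᵐ[volume]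
        fun x => z.fst x 0 * fderiv ℝ φ x (stdVec 1) - z.fst x 1 * fderiv ℝ φ x (stdVec 0) := by
      filter_upwards [(memLp_rotGradient hφ hc).coeFn_toLp] with x hx2
      rw [hx2, inner_E2]
      simp [rotGradient]
      ring
    rw [integral_congr_ae h3] at h2
    have h4 : ∀ x, ((fderiv ℝ φ x (stdVec 0) : ℂ) + Complex.I * (fderiv ℝ φ x (stdVec 1) : ℂ)) * g x
        = ((z.fst x 0 * fderiv ℝ φ x (stdVec 0) + z.fst x 1 * fderiv ℝ φ x (stdVec 1) : ℝ) : ℂ) +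
          Complex.I * ((z.fst x 0 * fderiv ℝ φ x (stdVec 1) -
            z.fst x 1 * fderiv ℝ φ x (stdVec 0) : ℝ) : ℂ) := fun x => by
      rw [hg]
      push_cast
      linear_combination (-(fderiv ℝ φ x (stdVec 1) : ℂ) * ((z.fst x 1 : ℝ) : ℂ)) * Complex.I_sq
    simp_rw [h4]
    rw [integral_add, integral_const_mul, integral_complex_ofReal, integral_complex_ofReal, h1, h2]
    · simp
    · exact ((hintg _ _).add (hintg _ _)).ofReal
    · exact (((hintg _ _).sub (hintg _ _)).ofReal).const_mul _
  have hgU : ∀ᵐ x, x ∈ U → g x = 0 := by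
    filter_upwards [hzU] with x hx hxU
    simp [hg, hx hxU]
  filter_upwards [ae_eq_zero_of_weaklyHolomorphic h.lip.1 h.lip.2.1 hgl hw hU hUne hUΩ hgU]
    with x hx hxΩ
  have h5 := hx hxΩ
  have hre := congrArg Complex.re h5
  have him := congrArg Complex.im h5
  ext i
  fin_cases i
  · simpa [hg] using hre
  · simpa [hg] using him

end WeakEquation

section Restriction

variable {Ω Γ A : Set E2}

def indicatorLp (hA : MeasurableSet A) :
    Lp E2 2 (volume : Measure E2) →ₗ[ℝ] Lp E2 2 (volume : Measure E2) where
  toFun u := ((Lp.memLp u).indicator hA).toLp (A.indicator u)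
  map_add' u v := by
    rw [← MemLp.toLp_add, MemLp.toLp_eq_toLp_iff, ← indicator_add']
    filter_upwards [Lp.coeFn_add u v] with x hx
    by_cases hxA : x ∈ A
    · rw [indicator_of_mem hxA, indicator_of_mem hxA, hx]
    · rw [indicator_of_notMem hxA, indicator_of_notMem hxA]
  map_smul' c u := by
    rw [RingHom.id_apply, ← MemLp.toLp_const_smul, MemLp.toLp_eq_toLp_iff]
    filter_upwards [Lp.coeFn_smul c u] with x hx
    by_cases hxA : x ∈ A
    · rw [Pi.smul_apply, indicator_of_mem hxA, indicator_of_mem hxA, hx]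
      rfl
    · rw [Pi.smul_apply, indicator_of_notMem hxA, indicator_of_notMem hxA, smul_zero]

theorem indicatorLp_apply (hA : MeasurableSet A) (u : Lp E2 2 (volume : Measure E2)) :
    indicatorLp hA u = ((Lp.memLp u).indicator hA).toLp (A.indicator u) := rfl

theorem coeFn_indicatorLp (hA : MeasurableSet A) (u : Lp E2 2 (volume : Measure E2)) :
    (indicatorLp hA u : E2 → E2) =ᵐ[volume] A.indicator u := by
  have hm : MemLp (A.indicator u) 2 volume := (Lp.memLp u).indicator hA
  rw [indicatorLp_apply]
  exact hm.coeFn_toLp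

theorem ofReal_norm_sq_Lp (u : Lp E2 2 (volume : Measure E2)) :
    ENNReal.ofReal (‖u‖ ^ 2) = ∫⁻ x, ‖u x‖ₑ ^ 2 := by
  rw [← ofReal_norm_toLp_sq (Lp.memLp u), Lp.toLp_coeFn]

theorem ofReal_norm_indicatorLp_sq (hA : MeasurableSet A) (u : Lp E2 2 (volume : Measure E2)) :
    ENNReal.ofReal (‖indicatorLp hA u‖ ^ 2) = ∫⁻ x in A, ‖u x‖ₑ ^ 2 := by
  rw [ofReal_norm_sq_Lp, ← lintegral_indicator hA]
  refine lintegral_congr_ae ?_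
  filter_upwards [coeFn_indicatorLp hA u] with x hx
  by_cases hxA : x ∈ A <;> simp [hxA, hx]

theorem norm_indicatorLp_le (hA : MeasurableSet A) (u : Lp E2 2 (volume : Measure E2)) :
    ‖indicatorLp hA u‖ ≤ ‖u‖ := by
  refine le_of_sq_le_sq ((ENNReal.ofReal_le_ofReal_iff (by positivity)).1 ?_) (norm_nonneg _)
  rw [ofReal_norm_indicatorLp_sq, ofReal_norm_sq_Lp]
  exact setLIntegral_le_lintegral _ _

theorem ae_eq_zero_of_norm_indicatorLp_eq (hA : MeasurableSet A)
    {u : Lp E2 2 (volume : Measure E2)} (hu : ‖indicatorLp hA u‖ = ‖u‖) :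
    ∀ᵐ x, x ∉ A → u x = 0 := by
  have h1 := lintegral_add_compl (μ := (volume : Measure E2)) (fun x => ‖u x‖ₑ ^ 2) hA
  rw [← ofReal_norm_indicatorLp_sq hA, ← ofReal_norm_sq_Lp, hu] at h1
  have h2 : ∫⁻ x in Aᶜ, ‖u x‖ₑ ^ 2 = 0 := by
    have h3 : ENNReal.ofReal (‖u‖ ^ 2) + ∫⁻ x in Aᶜ, ‖u x‖ₑ ^ 2 =
      ENNReal.ofReal (‖u‖ ^ 2) + 0 := by rw [h1, add_zero]
    exact (ENNReal.add_right_inj ENNReal.ofReal_ne_top).1 h3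
  have hm : AEMeasurable (fun x => ‖u x‖ₑ ^ 2) (volume.restrict Aᶜ) :=
    ((Lp.aestronglyMeasurable u).enorm.pow_const 2).restrict
  rw [lintegral_eq_zero_iff' hm, EventuallyEq, ae_restrict_iff' hA.compl] at h2
  filter_upwards [h2] with x hx hxA
  simpa using hx hxA

theorem ae_eq_zero_of_mem_formDomain (h : IsSteklovPair Ω Γ) {X : Submodule ℝ smoothFunctions}
    (hA : MeasurableSet A)
    (hX : ∀ f ∈ X, ∀ x ∈ A, Ω.indicator (gradient (f : E2 → ℝ)) x = 0) :
    ∀ z ∈ formDomain h X, ∀ᵐ x, x ∈ A → z.fst x = 0 := by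
  have hiff : ∀ z : EnergySpace Γ, (∀ᵐ x, x ∈ A → z.fst x = 0) ↔
      LpToLpRestrictCLM E2 E2 ℝ volume 2 A (gradPart Γ z) = 0 := fun z => by
    rw [Lp.eq_zero_iff_ae_eq_zero, ← ae_restrict_iff' hA]
    have := LpToLpRestrictCLM_coeFn (μ := volume) (p := 2) ℝ A (gradPart Γ z)
    constructor
    · intro h1
      exact this.trans h1
    · intro h1
      exact this.symm.trans h1
  refine forall_mem_formDomain h X ?_ fun f hf => ?_
  · simp_rw [hiff]
    exact isClosed_eq ((ContinuousLinearMap.continuous _).comp (gradPart Γ).continuous)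
      continuous_const
  · rw [embed_fst]
    filter_upwards [(memLp_gradient h.lip f).coeFn_toLp] with x hx hxA
    rw [hx, hX f hf x hxA]

theorem fst_eq_zero_off (h : IsSteklovPair Ω Γ) (X : Submodule ℝ smoothFunctions) :
    ∀ z ∈ formDomain h X, ∀ᵐ x, x ∉ Ω → z.fst x = 0 :=
  ae_eq_zero_of_mem_formDomain h h.lip.1.measurableSet.compl
    fun _ _ _ hx => indicator_of_notMem hx _

def restrictEnergyAux (Γ : Set E2) (hA : MeasurableSet A) :
    EnergySpace Γ →ₗ[ℝ] EnergySpace Γ where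
  toFun z := WithLp.toLp 2 (indicatorLp hA z.fst, z.snd)
  map_add' z w := by
    change WithLp.toLp 2 (indicatorLp hA (z.fst + w.fst), z.snd + w.snd) = _
    rw [map_add]
    rfl
  map_smul' c z := by
    change WithLp.toLp 2 (indicatorLp hA (c • z.fst), c • z.snd) = _
    rw [map_smul]
    rfl

theorem norm_restrictEnergyAux_le (hA : MeasurableSet A) (z : EnergySpace Γ) :
    ‖restrictEnergyAux Γ hA z‖ ≤ ‖z‖ := by
  refine le_of_sq_le_sq ?_ (norm_nonneg _)
  have h1 : ‖restrictEnergyAux Γ hA z‖ ^ 2 = ‖indicatorLp hA z.fst‖ ^ 2 + ‖z.snd‖ ^ 2 :=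
    energySpace_norm_sq _
  rw [h1, energySpace_norm_sq z]
  have h2 := pow_le_pow_left₀ (norm_nonneg _) (norm_indicatorLp_le hA z.fst) 2
  linarith

/-- Truncation of the vector field to `A`. -/
def restrictEnergy (Γ : Set E2) (hA : MeasurableSet A) : EnergySpace Γ →L[ℝ] EnergySpace Γ :=
  (restrictEnergyAux Γ hA).mkContinuous 1 fun z => by
    rw [one_mul]
    exact norm_restrictEnergyAux_le hA z

theorem restrictEnergy_fst (hA : MeasurableSet A) (z : EnergySpace Γ) :
    (restrictEnergy Γ hA z).fst = indicatorLp hA z.fst := rfl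

theorem restrictEnergy_snd (hA : MeasurableSet A) (z : EnergySpace Γ) :
    (restrictEnergy Γ hA z).snd = z.snd := rfl

theorem norm_restrictEnergy_le (hA : MeasurableSet A) (z : EnergySpace Γ) :
    ‖restrictEnergy Γ hA z‖ ≤ ‖z‖ := norm_restrictEnergyAux_le hA z

theorem restrictEnergy_mem {Ω' : Set E2} (h : IsSteklovPair Ω Γ) (h' : IsSteklovPair Ω' Γ)
    (hsub : Ω' ⊆ Ω) : ∀ z ∈ formDomain h ⊤,
      restrictEnergy Γ h'.lip.1.measurableSet z ∈ formDomain h' ⊤ := by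
  refine forall_mem_formDomain h ⊤ ?_ fun f _ => ?_
  · exact (Submodule.isClosed_topologicalClosure _).preimage (ContinuousLinearMap.continuous _)
  · have : restrictEnergy Γ h'.lip.1.measurableSet (embed h f) = embed h' f := by
      have h1 : (restrictEnergy Γ h'.lip.1.measurableSet (embed h f)).fst = (embed h' f).fst := by
        rw [restrictEnergy_fst, embed_fst, embed_fst, indicatorLp_apply,
          MemLp.toLp_eq_toLp_iff]
        filter_upwards [(memLp_gradient h.lip f).coeFn_toLp] with x hx
        by_cases hxΩ : x ∈ Ω'
        · simp [hxΩ, hsub hxΩ, hx]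
        · simp [hxΩ]
      exact WithLp.ofLp_injective 2 (Prod.ext h1 rfl)
    rw [this]
    exact subset_closure ⟨f, trivial, rfl⟩

end Restriction

section Comparison

variable {Ωa Ωb P Γ ΓDa ΓDb : Set E2}

def toFormDomain (h : IsSteklovPair P Γ) (X : Submodule ℝ smoothFunctions) :
    X →ₗ[ℝ] formDomain h X :=
  ((embed h).comp X.subtype).codRestrict (formDomain h X) fun f =>
    Submodule.le_topologicalClosure _ ⟨f, f.2, rfl⟩

theorem denseRange_toFormDomain (h : IsSteklovPair P Γ) (X : Submodule ℝ smoothFunctions) :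
    DenseRange (toFormDomain h X) := by
  refine (Subtype.dense_iff).2 fun z hz => ?_
  refine closure_mono ?_ hz
  rintro _ ⟨f, hf, rfl⟩
  exact ⟨toFormDomain h X ⟨f, hf⟩, ⟨⟨f, hf⟩, rfl⟩, rfl⟩

theorem exists_admissible_of_steklovMixed_le (ha : IsSteklovPair Ωa Γ) (hb : IsSteklovPair Ωb Γ)
    {k : ℕ} (hle : steklovMixed Ωa Γ ΓDa (fun _ => 1) k ≤ steklovMixed Ωb Γ ΓDb (fun _ => 1) k)
    {Y : Submodule ℝ smoothFunctions} (hY : ∀ f ∈ Y, ∀ᶠ x in nhdsSet ΓDb, (f : E2 → ℝ) x = 0)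
    (x : Fin (k + 1) → Y) (hx : LinearIndependent ℝ fun i => embed hb (x i : smoothFunctions))
    {m m' : ℝ} (hm : 0 < m)
    (hmx : ∀ z ∈ Submodule.span ℝ (range x),
      m * ‖embed hb (z : smoothFunctions)‖ ^ 2 ≤ ‖(embed hb (z : smoothFunctions)).snd‖ ^ 2)
    (hm' : 0 < m') (hmm : m' < m) :
    ∃ V : Submodule ℝ smoothFunctions, Module.finrank ℝ V = k + 1 ∧
      (∀ f ∈ V, ∀ᶠ x in nhdsSet ΓDa, (f : E2 → ℝ) x = 0) ∧
      Module.finrank ℝ (V.map (embed ha)) = k + 1 ∧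
      ∀ w ∈ V.map (embed ha), m' * ‖w‖ ^ 2 ≤ ‖w.snd‖ ^ 2 := by
  have hm1 : m ≤ 1 := by
    have h1 := hmx (x 0) (Submodule.subset_span ⟨0, rfl⟩)
    have h2 := energySpace_norm_snd_le (embed hb (x 0 : smoothFunctions))
    have h3 : 0 < ‖embed hb (x 0 : smoothFunctions)‖ := norm_pos_iff.2 (hx.ne_zero 0)
    have h4 := pow_le_pow_left₀ (norm_nonneg _) h2 2
    by_contra! hm1
    nlinarith [pow_pos h3 2]
  have hs : 0 < (1 - m') / m' := div_pos (by linarith) hm'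
  have hlt : (1 - m) / m < (1 - m') / m' := by
    rw [div_lt_div_iff₀ hm hm']
    nlinarith
  obtain ⟨V, h1, h2, h3, h4⟩ := exists_admissible ha hs.le
    ((hle.trans (steklovMixed_le hb hY x hx hm hmx)).trans_lt
      ((ENNReal.ofReal_lt_ofReal_iff hs).2 hlt))
  refine ⟨V, h1, h2, h3, ?_⟩
  have h5 : 1 / (1 + (1 - m') / m') = m' := by
    field_simp
    ring
  rwa [h5] at h4

theorem exists_eigenvector_of_steklovMixed_le (ha : IsSteklovPair Ωa Γ) (hb : IsSteklovPair Ωb Γ)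
    (hp : IsSteklovPair P Γ) {k : ℕ}
    (hle : steklovMixed Ωa Γ ΓDa (fun _ => 1) k ≤ steklovMixed Ωb Γ ΓDb (fun _ => 1) k)
    {X Y : Submodule ℝ smoothFunctions}
    (hY : ∀ f ∈ Y, ∀ᶠ x in nhdsSet ΓDb, (f : E2 → ℝ) x = 0)
    (hX : ∀ f : smoothFunctions, (∀ᶠ x in nhdsSet ΓDa, (f : E2 → ℝ) x = 0) →
      embed ha f ∈ X.map (embed hp))
    {R : EnergySpace Γ →L[ℝ] EnergySpace Γ} (hR : ∀ z, ‖R z‖ ≤ ‖z‖) (hRs : ∀ z, (R z).snd = z.snd)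
    (hRm : ∀ z ∈ formDomain hp X, R z ∈ formDomain hb Y)
    {L : Set E2} (hL : IsClosed L) (hinf : (Γ \ L).Infinite)
    (hXL : ∀ f : smoothFunctions, (∀ᶠ x in nhdsSet L, (f : E2 → ℝ) x = 0) → f ∈ X) :
    ∃ l : ℝ, 0 < l ∧ ∃ V : Submodule ℝ (formDomain hp X), Module.finrank ℝ V = k + 1 ∧
      (∀ z ∈ V, l * ‖z‖ ^ 2 ≤ ‖traceOp hp X z‖ ^ 2) ∧ ∃ z ∈ formDomain hp X, z ≠ 0 ∧
        ‖R z‖ = ‖z‖ ∧ ‖z.snd‖ ^ 2 = l * ‖z‖ ^ 2 ∧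
        ∀ y ∈ formDomain hb Y, inner ℝ z.snd y.snd = l * inner ℝ (R z) y := by
  have hcX : CompleteSpace (formDomain hp X) :=
    (Submodule.isClosed_topologicalClosure _).completeSpace_coe
  have hcY : CompleteSpace (formDomain hb Y) :=
    (Submodule.isClosed_topologicalClosure _).completeSpace_coe
  let S := (R : EnergySpace Γ →ₗ[ℝ] EnergySpace Γ).restrict hRm
  have hS : ∀ z, traceOp hb Y (S z) = traceOp hp X z := fun z => hRs z
  have hS1 : ∀ z, ‖S z‖ ≤ ‖z‖ := fun z => hR z
  have hT1 : ∀ y, ‖traceOp hb Y y‖ ≤ ‖y‖ := fun y => energySpace_norm_snd_le (y : EnergySpace Γ)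
  have hJ : DenseRange (toFormDomain hb Y) := denseRange_toFormDomain hb Y
  have hcomp : ∀ m : ℝ, 0 < m → (∃ x : Fin (k + 1) → Y,
      LinearIndependent ℝ (fun i => toFormDomain hb Y (x i)) ∧
      ∀ z ∈ Submodule.span ℝ (range x),
        m * ‖toFormDomain hb Y z‖ ^ 2 ≤ ‖traceOp hb Y (toFormDomain hb Y z)‖ ^ 2) →
      ∀ m' : ℝ, 0 < m' → m' < m → ∃ V : Submodule ℝ (formDomain hp X),
        Module.finrank ℝ V = k + 1 ∧ ∀ x ∈ V, m' * ‖x‖ ^ 2 ≤ ‖traceOp hp X x‖ ^ 2 := by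
    rintro m hm ⟨x, hx, hmx⟩ m' hm' hmm
    have hx' : LinearIndependent ℝ fun i => embed hb (x i : smoothFunctions) :=
      hx.map' (formDomain hb Y).subtype (Submodule.ker_subtype _)
    obtain ⟨V, -, hVD, hVk, hVm⟩ := exists_admissible_of_steklovMixed_le ha hb hle hY x hx' hm
      hmx hm' hmm
    have hVX : V.map (embed ha) ≤ formDomain hp X := by
      rintro _ ⟨f, hf, rfl⟩
      exact Submodule.le_topologicalClosure _ (hX f (hVD f hf))
    refine ⟨(V.map (embed ha)).comap (formDomain hp X).subtype, ?_, fun z hz => hVm z hz⟩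
    rw [← hVk]
    exact (Submodule.comapSubtypeEquivOfLe hVX).finrank_eq
  have hcmp := exists_common_eigenvector
    (traceOp hp X) (isCompactOperator_traceOp hp X) (traceOp hb Y) (isCompactOperator_traceOp hb Y)
    hT1 S hS hS1 (X := Y)
  have hpos := hcmp (toFormDomain hb Y) hJ k hcomp
  obtain ⟨l, hl, V, hV, hVl, z, -, hz0, hzR, hzl, hzy⟩ :=
    hpos (exists_test_subspace hp hL hinf hXL (k + 1))
  exact ⟨l, hl, V, hV, hVl, z, z.2, fun h => hz0 (Subtype.ext h), hzR, hzl,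
    fun y hy => (congrArg (inner ℝ · y.snd) (hRs z)).symm.trans (hzy ⟨y, hy⟩)⟩

theorem finrank_le_one_of_norm_le_trace (h : IsSteklovPair P Γ) {X : Submodule ℝ smoothFunctions}
    {V : Submodule ℝ (formDomain h X)} (hV : ∀ z ∈ V, ‖z‖ ^ 2 ≤ ‖traceOp h X z‖ ^ 2) :
    Module.finrank ℝ V ≤ 1 := by
  obtain ⟨F, hF, hF1, hFm⟩ := exists_snd_mem_of_fst_eq_zero h
  have hfst : ∀ z ∈ V, (z : EnergySpace Γ).fst = 0 := fun z hz => by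
    have h1 : ‖(z : EnergySpace Γ)‖ ^ 2 ≤ ‖(z : EnergySpace Γ).snd‖ ^ 2 := hV z hz
    rw [energySpace_norm_sq] at h1
    exact norm_eq_zero.1 (pow_eq_zero_iff (two_ne_zero)|>.1
      (le_antisymm (by linarith) (sq_nonneg _)))
  have hle : formDomain h X ≤ formDomain h ⊤ :=
    Submodule.topologicalClosure_mono (Submodule.map_mono le_top)
  let g : V →ₗ[ℝ] F := ((traceOp h X : _ →ₗ[ℝ] _).comp V.subtype).codRestrict F fun z =>
    hFm _ (hle (z : formDomain h X).2) (hfst z z.2)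
  have hg : Function.Injective g := (injective_iff_map_eq_zero g).2 fun z hz => by
    have h1 : traceOp h X z = 0 := congrArg Subtype.val hz
    have h2 := hV z z.2
    rw [h1, norm_zero] at h2
    exact Subtype.ext (norm_eq_zero.1 (pow_eq_zero_iff (two_ne_zero)|>.1
      (le_antisymm (by linarith) (sq_nonneg _))))
  exact (LinearMap.finrank_le_finrank_of_injective hg).trans hF1

theorem false_of_eigenvector (h : IsSteklovPair P Γ) {X : Submodule ℝ smoothFunctions} {k : ℕ}
    (hk : 1 ≤ k) {l : ℝ} {V : Submodule ℝ (formDomain h X)} (hVk : Module.finrank ℝ V = k + 1)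
    (hV : ∀ z ∈ V, l * ‖z‖ ^ 2 ≤ ‖traceOp h X z‖ ^ 2) {z : EnergySpace Γ}
    (hz : z ∈ formDomain h X) (hz0 : z ≠ 0) (hzl : ‖z.snd‖ ^ 2 = l * ‖z‖ ^ 2)
    {U : Set E2} (hU : IsOpen U) (hUne : U.Nonempty) (hUP : U ⊆ P)
    (hzU : ∀ᵐ x, x ∈ U → z.fst x = 0)
    (hdiv : ∀ φ : smoothFunctions, tsupport (φ : E2 → ℝ) ⊆ P →
      inner ℝ z.fst (embed h φ).fst = 0) : False := by
  have h1 : z.fst = 0 := by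
    rw [Lp.eq_zero_iff_ae_eq_zero]
    filter_upwards [ae_eq_zero_of_inner_eq_zero h hz hU hUne hUP hzU fun φ _ hφ => hdiv φ hφ,
      fst_eq_zero_off h X z hz] with x hx hx'
    by_cases hxP : x ∈ P
    · exact hx hxP
    · exact hx' hxP
  have hl : l = 1 := by
    have h2 := energySpace_norm_sq z
    rw [h1, norm_zero] at h2
    have h3 : 0 < ‖z‖ ^ 2 := by positivity
    nlinarith
  subst hl
  have := finrank_le_one_of_norm_le_trace h (V := V) fun z hz => by simpa using hV z hz
  omega

theorem inner_fst_embed_eq_zero (h : IsSteklovPair P Γ) {l : ℝ} (hl : 0 < l) {z z' : EnergySpace Γ}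
    {φ : smoothFunctions} (hφ : EqOn (φ : E2 → ℝ) 0 Γ)
    (hz : inner ℝ z.snd (embed h φ).snd = l * inner ℝ z' (embed h φ)) :
    inner ℝ z'.fst (embed h φ).fst = 0 := by
  have h1 : (embed h φ).snd = 0 := by
    rw [embed_snd, Lp.eq_zero_iff_ae_eq_zero]
    refine (MemLp.coeFn_toLp _).trans ?_
    exact ae_restrict_of_forall_mem h.compact.measurableSet hφ
  have h2 : inner ℝ z' (embed h φ) =
    inner ℝ z'.fst (embed h φ).fst + inner ℝ z'.snd (embed h φ).snd := rfl
  rw [h2, h1, inner_zero_right, inner_zero_right, add_zero] at hz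
  exact (mul_eq_zero.1 hz.symm).resolve_left hl.ne'

theorem eqOn_zero_frontier {f : E2 → ℝ} (hP : IsOpen P) (hΓ : Γ ⊆ frontier P)
    (hf : tsupport f ⊆ P) : EqOn f 0 Γ := fun _ hx =>
  image_eq_zero_of_notMem_tsupport fun hxs => disjoint_left.1 (disjoint_frontier_iff_isOpen.2 hP) (hΓ hx) (hf hxs)

end Comparison

section Monotonicity

variable {Ω Ω₁ Ω₂ Γ L : Set E2}

/-- Smooth functions vanishing on a neighbourhood of `L`. -/
def vanishingNear (L : Set E2) : Submodule ℝ smoothFunctions where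
  carrier := {f | ∀ᶠ x in nhdsSet L, (f : E2 → ℝ) x = 0}
  add_mem' := fun {f g} (hf : ∀ᶠ x in nhdsSet L, (f : E2 → ℝ) x = 0)
      (hg : ∀ᶠ x in nhdsSet L, (g : E2 → ℝ) x = 0) =>
    (hf.and hg).mono fun x hx => by simp [hx.1, hx.2]
  zero_mem' := by
    change ∀ᶠ x in nhdsSet L, ((0 : smoothFunctions) : E2 → ℝ) x = 0
    exact Eventually.of_forall fun _ => rfl
  smul_mem' := fun c f (hf : ∀ᶠ x in nhdsSet L, (f : E2 → ℝ) x = 0) =>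
    hf.mono fun x hx => by simp [hx]

theorem indicator_gradient_eq_zero {f : smoothFunctions} (hf : f ∈ vanishingNear L) {x : E2}
    (hx : x ∈ L) : Ω.indicator (gradient (f : E2 → ℝ)) x = 0 := by
  have h1 : (f : E2 → ℝ) =ᶠ[𝓝 x] fun _ => 0 := eventually_nhdsSet_iff_forall.1 hf x hx
  have h2 : gradient (f : E2 → ℝ) x = 0 := by
    rw [gradient, h1.fderiv_eq]
    simp
  rw [indicator_apply_eq_zero]
  exact fun _ => h2

/-- A function vanishing near `ΓD` can be cut off outside `Ω₁` without changing its energy. -/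
theorem embed_mem_map_vanishingNear {ΓD : Set E2} (h1 : IsSteklovPair Ω₁ Γ)
    (h2 : IsSteklovPair Ω₂ Γ) (hsub : Ω₁ ⊆ Ω₂) (hL : IsClosed L) (hΩL : Ω₂ \ Ω₁ ⊆ L)
    (hdisj : Disjoint (closure Ω₁ \ ΓD) L) (f : smoothFunctions)
    (hf : ∀ᶠ x in nhdsSet ΓD, (f : E2 → ℝ) x = 0) :
    embed h1 f ∈ (vanishingNear L).map (embed h2) := by
  obtain ⟨N, hN, hDN, hfN⟩ := eventually_nhdsSet_iff_exists.1 hf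
  obtain ⟨χ, hχ, hχ1, O, hO, hLO, hχ0⟩ := exists_smooth_cutoff
    (isClosed_closure (s := Ω₁) |>.sdiff hN) hL (hdisj.mono_left (sdiff_subset_sdiff_right hDN))
  set g : smoothFunctions := ⟨fun x => χ x * (f : E2 → ℝ) x, hχ.mul (contDiff_coe f)⟩ with hg
  have hgL : g ∈ vanishingNear L := by
    refine eventually_nhdsSet_iff_exists.2 ⟨O, hO, hLO, fun x hx => ?_⟩
    change χ x * (f : E2 → ℝ) x = 0
    rw [hχ0 hx, Pi.zero_apply, zero_mul]
  have hfg : EqOn (f : E2 → ℝ) g (closure Ω₁) := fun x hx => by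
    change (f : E2 → ℝ) x = χ x * (f : E2 → ℝ) x
    by_cases hxN : x ∈ N
    · rw [hfN x hxN, mul_zero]
    · rw [hχ1 ⟨hx, hxN⟩, Pi.one_apply, one_mul]
  refine ⟨g, hgL, (embed_congr h1 h2 (hfg.mono h1.subset_closure) ?_).symm⟩
  funext x
  by_cases hx1 : x ∈ Ω₁
  · rw [indicator_of_mem hx1, indicator_of_mem (hsub hx1), gradient, gradient]
    congr 1
    refine EventuallyEq.fderiv_eq ?_
    filter_upwards [h1.lip.1.mem_nhds hx1] with y hy using hfg (subset_closure hy)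
  · rw [indicator_of_notMem hx1]
    by_cases hx2 : x ∈ Ω₂
    · exact (indicator_gradient_eq_zero hgL (hΩL ⟨hx2, hx1⟩)).symm
    · rw [indicator_of_notMem hx2]

theorem steklovD_strictAnti {Γstar₁ Γstar₂ : Set E2} (h1 : IsLipschitzDomain Ω₁)
    (h2 : IsLipschitzDomain Ω₂) (hsub : Ω₁ ⊆ Ω₂) (hne : Ω₁ ≠ Ω₂)
    (hd1 : SteklovDecomp Ω₁ Γ Γstar₁) (hd2 : SteklovDecomp Ω₂ Γ Γstar₂) {k : ℕ} (hk : 1 ≤ k) :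
    steklovD Ω₂ Γ Γstar₂ k < steklovD Ω₁ Γ Γstar₁ k := by
  by_contra! hle
  have hp1 : IsSteklovPair Ω₁ Γ := ⟨h1, hd1.partS, hd1.nonemptyS, hd1.subset_frontier⟩
  have hp2 : IsSteklovPair Ω₂ Γ := ⟨h2, hd2.partS, hd2.nonemptyS, hd2.subset_frontier⟩
  set L := closure (Ω₂ \ Ω₁) ∪ Γstar₂ with hLdef
  have hL : IsClosed L := isClosed_closure.union hd2.partStar.isCompact.isClosed
  have hdisj : Disjoint (closure Ω₁ \ Γstar₁) L := disjoint_closure_diff h1 h2 hsub hd1 hd2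
  have hΩL : Ω₂ \ Ω₁ ⊆ L := subset_closure.trans subset_union_left
  have hinf : (Γ \ L).Infinite := hd1.infinite_diff.mono fun x hx =>
    ⟨hx.1, disjoint_left.1 hdisj ⟨hp1.subset_closure hx.1, hx.2⟩⟩
  have hXY : vanishingNear L ≤ vanishingNear Γstar₂ := fun f hf =>
    Eventually.filter_mono (nhdsSet_mono subset_union_right) hf
  obtain ⟨l, hl, V, hVk, hV, z, hz, hz0, -, hzl, hzy⟩ := exists_eigenvector_of_steklovMixed_le
    hp1 hp2 hp2 hle (Y := vanishingNear Γstar₂) (fun f hf => hf)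
    (embed_mem_map_vanishingNear hp1 hp2 hsub hL hΩL hdisj)
    (R := ContinuousLinearMap.id ℝ _) (fun z => le_rfl) (fun z => rfl)
    (fun z hz => Submodule.topologicalClosure_mono (Submodule.map_mono hXY) hz) hL hinf
    (fun f hf => hf)
  refine false_of_eigenvector hp2 hk hVk hV hz hz0 hzl (h2.1.sdiff isClosed_closure)
    (nonempty_diff_closure h1 h2.1 hsub hne) sdiff_subset ?_ fun φ hφ => ?_
  · filter_upwards [ae_eq_zero_of_mem_formDomain hp2 (A := Ω₂ \ Ω₁)
      (h2.1.measurableSet.diff h1.1.measurableSet)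
      (fun f hf x hx => indicator_gradient_eq_zero hf (hΩL hx)) z hz] with x hx hxU
    exact hx ⟨hxU.1, fun hx1 => hxU.2 (subset_closure hx1)⟩
  · have hφ0 : EqOn (φ : E2 → ℝ) 0 Γ := eqOn_zero_frontier h2.1 hp2.subset hφ
    have hφY : φ ∈ vanishingNear Γstar₂ := by
      refine eventually_nhdsSet_iff_exists.2 ⟨(tsupport (φ : E2 → ℝ))ᶜ,
        (isClosed_tsupport _).isOpen_compl, fun x hx hxs => ?_,
        fun x hx => image_eq_zero_of_notMem_tsupport hx⟩
      exact disjoint_left.1 (disjoint_frontier_iff_isOpen.2 h2.1) (hd2.star_subset_frontier hx)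
        (hφ hxs)
    exact inner_fst_embed_eq_zero hp2 hl hφ0
      (hzy _ (Submodule.le_topologicalClosure _ ⟨φ, hφY, rfl⟩))

theorem inner_indicatorLp_fst_embed (h1 : IsSteklovPair Ω₁ Γ) (h2 : IsSteklovPair Ω₂ Γ)
    (hsub : Ω₁ ⊆ Ω₂) {u : Lp E2 2 (volume : Measure E2)} (hu : ∀ᵐ x, x ∉ Ω₁ → u x = 0)
    (φ : smoothFunctions) :
    inner ℝ (indicatorLp h1.lip.1.measurableSet u) (embed h1 φ).fst =
      inner ℝ u (embed h2 φ).fst := by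
  rw [L2.inner_def, L2.inner_def, embed_fst, embed_fst]
  refine integral_congr_ae ?_
  filter_upwards [(memLp_gradient h1.lip φ).coeFn_toLp, (memLp_gradient h2.lip φ).coeFn_toLp,
    coeFn_indicatorLp h1.lip.1.measurableSet u, hu] with x hx1 hx2 hx3 hx4
  rw [hx1, hx2, hx3]
  by_cases hx : x ∈ Ω₁
  · rw [indicator_of_mem hx, indicator_of_mem hx, indicator_of_mem (hsub hx)]
  · rw [indicator_of_notMem hx, hx4 hx, inner_zero_left, inner_zero_left]

theorem steklovN_strictMono (h1 : IsSteklovPair Ω₁ Γ) (h2 : IsSteklovPair Ω₂ Γ)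
    (hinf : Γ.Infinite) (hsub : Ω₁ ⊆ Ω₂) (hne : Ω₁ ≠ Ω₂) {k : ℕ} (hk : 1 ≤ k) :
    steklovN Ω₁ Γ k < steklovN Ω₂ Γ k := by
  by_contra! hle
  have hm := h1.lip.1.measurableSet
  obtain ⟨l, hl, V, hVk, hV, z, hz, hz0, hzR, hzl, hzy⟩ := exists_eigenvector_of_steklovMixed_le
    h2 h1 h2 hle (X := ⊤) (Y := ⊤) (fun f _ => by simp)
    (fun f _ => ⟨f, trivial, rfl⟩) (R := restrictEnergy Γ hm)
    (norm_restrictEnergy_le hm) (restrictEnergy_snd hm) (restrictEnergy_mem h2 h1 hsub)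
    isClosed_empty (by simpa using hinf) (fun f _ => trivial)
  have hz1 : ∀ᵐ x, x ∉ Ω₁ → z.fst x = 0 := by
    refine ae_eq_zero_of_norm_indicatorLp_eq hm ?_
    have h3 := congrArg (· ^ 2) hzR
    simp only [energySpace_norm_sq, restrictEnergy_fst, restrictEnergy_snd] at h3
    exact (pow_left_inj₀ (norm_nonneg _) (norm_nonneg _) two_ne_zero).1 (add_right_cancel h3)
  refine false_of_eigenvector h2 hk hVk hV hz hz0 hzl (h2.lip.1.sdiff isClosed_closure)
    (nonempty_diff_closure h1.lip h2.lip.1 hsub hne) sdiff_subset ?_ fun φ hφ => ?_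
  · filter_upwards [hz1] with x hx hxU
    exact hx fun hx1 => hxU.2 (subset_closure hx1)
  · rw [← inner_indicatorLp_fst_embed h1 h2 hsub hz1, ← restrictEnergy_fst]
    exact inner_fst_embed_eq_zero h1 hl (eqOn_zero_frontier h2.lip.1 h2.subset hφ)
      (hzy _ (Submodule.le_topologicalClosure _ ⟨φ, trivial, rfl⟩))

end Monotonicity

theorem statement3 (Ω₁ Ω₂ ΓS Γstar₁ Γstar₂ : Set E2)
    (h1 : IsLipschitzDomain Ω₁) (h2 : IsLipschitzDomain Ω₂)
    (hsub : Ω₁ ⊆ Ω₂) (hne : Ω₁ ≠ Ω₂)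
    (hcomp : Nat.card (ConnectedComponents ↥(frontier Ω₁))
      = Nat.card (ConnectedComponents ↥(frontier Ω₂)))
    (hd1 : SteklovDecomp Ω₁ ΓS Γstar₁) (hd2 : SteklovDecomp Ω₂ ΓS Γstar₂)
    (k : ℕ) (hk : 1 ≤ k) :
    steklovD Ω₂ ΓS Γstar₂ k < steklovD Ω₁ ΓS Γstar₁ k ∧
    steklovN Ω₁ ΓS k < steklovN Ω₂ ΓS k :=
  ⟨steklovD_strictAnti h1 h2 hsub hne hd1 hd2 hk,
    steklovN_strictMono ⟨h1, hd1.partS, hd1.nonemptyS, hd1.subset_frontier⟩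
      ⟨h2, hd2.partS, hd2.nonemptyS, hd2.subset_frontier⟩
      (hd1.infinite_diff.mono sdiff_subset) hsub hne hk⟩

end
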